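/- There exists a real number x₀ such that for all real x ≥ x₀ and every completely multiplicative function f with -1 ≤ f(n) ≤ 1 for all positive integers n, one has ∑_{n ≤ x} f(n)/n ≥ -1/(log log x)^{3/5}. -/

import Mathlib

/-- A completely multiplicative function `f : ℕ → ℝ` (on positive integers):
`f 1 = 1` and `f (m * n) = f m * f n` for all positive `m, n`. -/
def IsComplMult (f : ℕ → ℝ) : Prop :=
  f 1 = 1 ∧ ∀ m n : ℕ, 0 < m → 0 < n → f (m * n) = f m * f n

namespace NegTrunc

section

open Finset Real
open ArithmeticFunction (vonMangoldt)

/-- The positive integers up to `x`. -/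
noncomputable def upTo (x : ℝ) : Finset ℕ := Ioc 0 ⌊x⌋₊

lemma mem_upTo {x : ℝ} {n : ℕ} : n ∈ upTo x ↔ 0 < n ∧ (n : ℝ) ≤ x := by
  simp only [upTo, mem_Ioc]
  refine and_congr_right fun h => Nat.le_floor_iff' h.ne'

lemma pos_of_mem_upTo {x : ℝ} {n : ℕ} (h : n ∈ upTo x) : (0 : ℝ) < n :=
  Nat.cast_pos.2 (mem_upTo.1 h).1

lemma le_of_mem_upTo {x : ℝ} {n : ℕ} (h : n ∈ upTo x) : (n : ℝ) ≤ x := (mem_upTo.1 h).2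

lemma one_le_of_mem_upTo {x : ℝ} {n : ℕ} (h : n ∈ upTo x) : (1 : ℝ) ≤ n := by
  exact_mod_cast (mem_upTo.1 h).1

lemma one_le_div_of_mem_upTo {x : ℝ} {n : ℕ} (h : n ∈ upTo x) : 1 ≤ x / n :=
  (one_le_div (pos_of_mem_upTo h)).2 (le_of_mem_upTo h)

lemma upTo_subset {x y : ℝ} (h : x ≤ y) : upTo x ⊆ upTo y := fun _ hn =>
  mem_upTo.2 ⟨(mem_upTo.1 hn).1, (mem_upTo.1 hn).2.trans h⟩

lemma upTo_natCast (N : ℕ) : upTo (N : ℝ) = Ioc 0 N := by simp [upTo]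

/-- Summatory function of `a`. -/
noncomputable def summ (a : ℕ → ℝ) (x : ℝ) : ℝ := ∑ n ∈ upTo x, a n

lemma sum_upTo_comm (F : ℕ → ℕ → ℝ) (x : ℝ) :
    ∑ n ∈ upTo x, ∑ m ∈ upTo (x / n), F n m = ∑ m ∈ upTo x, ∑ n ∈ upTo (x / m), F n m := by
  refine Finset.sum_comm' fun n m => ?_
  simp only [mem_upTo]
  constructor
  · rintro ⟨⟨hn, hx⟩, hm, h⟩
    have hn' : (0 : ℝ) < n := Nat.cast_pos.2 hn
    have hm' : (0 : ℝ) < m := Nat.cast_pos.2 hm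
    have hn1 : (1 : ℝ) ≤ n := by exact_mod_cast hn
    rw [le_div_iff₀ hn'] at h
    refine ⟨⟨hn, ?_⟩, hm, by nlinarith⟩
    rw [le_div_iff₀ hm']; linarith
  · rintro ⟨⟨hn, h⟩, hm, hx⟩
    have hn' : (0 : ℝ) < n := Nat.cast_pos.2 hn
    have hm' : (0 : ℝ) < m := Nat.cast_pos.2 hm
    have hm1 : (1 : ℝ) ≤ m := by exact_mod_cast hm
    rw [le_div_iff₀ hm'] at h
    refine ⟨⟨hn, by nlinarith⟩, hm, ?_⟩
    rw [le_div_iff₀ hn']; linarith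

lemma sum_upTo_conv (F : ℕ → ℕ → ℝ) (x : ℝ) :
    ∑ n ∈ upTo x, ∑ p ∈ n.divisorsAntidiagonal, F p.1 p.2
      = ∑ n ∈ upTo x, ∑ m ∈ upTo (x / n), F n m := by
  rw [Finset.sum_sigma', Finset.sum_sigma']
  refine Finset.sum_bij' (fun s _ => ⟨s.2.1, s.2.2⟩) (fun t _ => ⟨t.1 * t.2, (t.1, t.2)⟩)
    ?_ ?_ ?_ ?_ ?_
  · rintro ⟨n, d, e⟩ h
    simp only [mem_sigma, mem_upTo, Nat.mem_divisorsAntidiagonal] at h ⊢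
    obtain ⟨⟨hn, hx⟩, rfl, hne⟩ := h
    have hd : 0 < d := Nat.pos_of_mul_pos_right hn
    have he : 0 < e := Nat.pos_of_mul_pos_left hn
    have hd' : (0 : ℝ) < d := Nat.cast_pos.2 hd
    have he1 : (1 : ℝ) ≤ e := by exact_mod_cast he
    push_cast at hx
    refine ⟨⟨hd, by nlinarith⟩, he, ?_⟩
    rw [le_div_iff₀ hd']; linarith
  · rintro ⟨d, e⟩ h
    simp only [mem_sigma, mem_upTo, Nat.mem_divisorsAntidiagonal] at h ⊢
    obtain ⟨⟨hd, hx⟩, he, h⟩ := h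
    have hd' : (0 : ℝ) < d := Nat.cast_pos.2 hd
    rw [le_div_iff₀ hd'] at h
    refine ⟨⟨Nat.mul_pos hd he, by push_cast; linarith⟩, trivial, (Nat.mul_pos hd he).ne'⟩
  · rintro ⟨n, d, e⟩ h
    simp only [mem_sigma, mem_upTo, Nat.mem_divisorsAntidiagonal] at h ⊢
    obtain ⟨_, rfl, _⟩ := h
    rfl
  · rintro ⟨d, e⟩ h; rfl
  · rintro ⟨n, d, e⟩ h; rfl

lemma sum_inv_upTo_le {x : ℝ} (hx : 1 ≤ x) : ∑ n ∈ upTo x, (1 : ℝ) / n ≤ 1 + log x := by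
  have h := harmonic_floor_le_one_add_log x hx
  rw [harmonic_eq_sum_Icc] at h
  push_cast at h
  simpa [upTo, ← Finset.Icc_add_one_left_eq_Ioc, one_div] using h

lemma log_le_sum_inv_upTo {x : ℝ} (hx : 1 ≤ x) : log x ≤ ∑ n ∈ upTo x, (1 : ℝ) / n := by
  have h := log_le_harmonic_floor x (by linarith)
  rw [harmonic_eq_sum_Icc] at h
  push_cast at h
  simpa [upTo, ← Finset.Icc_add_one_left_eq_Ioc, one_div] using h

lemma sum_inv_sq_Ioc_le (N : ℕ) (hN : 0 < N) :
    ∑ n ∈ Ioc 0 N, (1 : ℝ) / (n : ℝ) ^ 2 ≤ 2 - 1 / N := by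
  induction N, hN using Nat.le_induction with
  | base => norm_num [show Ioc 0 1 = {1} from rfl]
  | succ n hn ih =>
    rw [Finset.sum_Ioc_succ_top (Nat.zero_le n)]
    have hn' : (1 : ℝ) ≤ n := by exact_mod_cast hn
    push_cast
    have : (1 : ℝ) / ((n : ℝ) + 1) ^ 2 ≤ 1 / n - 1 / (n + 1) := by
      rw [div_sub_div _ _ (by positivity) (by positivity), div_le_div_iff₀ (by positivity)
        (by positivity)]
      nlinarith
    linarith

lemma sum_inv_sq_upTo_le (x : ℝ) : ∑ n ∈ upTo x, (1 : ℝ) / (n : ℝ) ^ 2 ≤ 2 := by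
  rcases Nat.eq_zero_or_pos ⌊x⌋₊ with h | h
  · simp [upTo, h]
  · have := sum_inv_sq_Ioc_le _ h
    have h2 : (0 : ℝ) ≤ 1 / (⌊x⌋₊ : ℝ) := by positivity
    rw [upTo]; linarith

lemma sum_mul_log_div_le {b : ℕ → ℝ} {K : ℝ} (hb : ∀ n, 0 < n → 0 ≤ b n)
    (hB : ∀ x, 1 ≤ x → summ b x ≤ K * x) {x : ℝ} (hx : 1 ≤ x) :
    ∑ n ∈ upTo x, b n * log (x / n) ≤ 2 * K * x := by
  have hK : 0 ≤ K := by
    have h1 := hB 1 le_rfl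
    have h2 : 0 ≤ summ b 1 := Finset.sum_nonneg fun n hn => hb n (mem_upTo.1 hn).1
    linarith
  calc ∑ n ∈ upTo x, b n * log (x / n)
      ≤ ∑ n ∈ upTo x, ∑ m ∈ upTo (x / n), b n * (1 / m) := by
        refine Finset.sum_le_sum fun n hn => ?_
        rw [← Finset.mul_sum]
        exact mul_le_mul_of_nonneg_left (log_le_sum_inv_upTo (one_le_div_of_mem_upTo hn))
          (hb n (mem_upTo.1 hn).1)
    _ = ∑ m ∈ upTo x, (1 / (m : ℝ)) * summ b (x / m) := by
        rw [sum_upTo_comm]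
        refine Finset.sum_congr rfl fun m _ => ?_
        rw [summ, Finset.mul_sum]
        exact Finset.sum_congr rfl fun _ _ => mul_comm _ _
    _ ≤ ∑ m ∈ upTo x, K * x * (1 / (m : ℝ) ^ 2) := by
        refine Finset.sum_le_sum fun m hm => ?_
        have hm0 := pos_of_mem_upTo hm
        have := mul_le_mul_of_nonneg_left (hB (x / m) (one_le_div_of_mem_upTo hm))
          (by positivity : 0 ≤ 1 / (m : ℝ))
        refine this.trans (le_of_eq ?_)
        field_simp
    _ ≤ 2 * K * x := by
        rw [← Finset.mul_sum]
        have := mul_le_mul_of_nonneg_left (sum_inv_sq_upTo_le x) (by positivity : 0 ≤ K * x)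
        linarith

/-- The von Mangoldt function as a real function on `ℕ`. -/
noncomputable abbrev vM : ℕ → ℝ := fun n => vonMangoldt n

lemma vM_nonneg (n : ℕ) : 0 ≤ vM n := ArithmeticFunction.vonMangoldt_nonneg

lemma summ_vM (x : ℝ) : summ vM x = Chebyshev.psi x := rfl

lemma exists_psi_le : ∃ C : ℝ, 1 ≤ C ∧ ∀ x : ℝ, 1 ≤ x → summ vM x ≤ C * x :=
  ⟨log 4 + 4, by have : 0 ≤ log 4 := log_nonneg (by norm_num)
                 linarith, fun x hx => by
    rw [summ_vM]; exact Chebyshev.psi_le_const_mul_self (by linarith)⟩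

lemma summ_one {x : ℝ} (hx : 0 ≤ x) : summ (fun _ => 1) x ≤ x := by
  simp only [summ, upTo, sum_const, Nat.card_Ioc, nsmul_eq_mul, mul_one, Nat.sub_zero]
  exact Nat.floor_le hx

lemma summ_one_eq (x : ℝ) : summ (fun _ => 1) x = ⌊x⌋₊ := by
  simp [summ, upTo]

lemma sum_log_upTo {x : ℝ} (hx : 1 ≤ x) :
    |∑ n ∈ upTo x, log n - x * log x| ≤ 2 * x + log x := by
  have h1 : ∑ n ∈ upTo x, log n = ⌊x⌋₊ * log x - ∑ n ∈ upTo x, log (x / n) := by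
    have : ∑ n ∈ upTo x, log (x / n) = ∑ n ∈ upTo x, (log x - log n) :=
      Finset.sum_congr rfl fun n hn => by
        rw [log_div (by linarith) (pos_of_mem_upTo hn).ne']
    rw [this, Finset.sum_sub_distrib]
    simp [upTo]
  have h2 : ∑ n ∈ upTo x, log (x / n) ≤ 2 * x := by
    have := sum_mul_log_div_le (b := fun _ => 1) (K := 1) (by simp)
      (fun x hx => by simpa using summ_one (by linarith)) hx
    simpa using this
  have h3 : 0 ≤ ∑ n ∈ upTo x, log (x / n) :=
    Finset.sum_nonneg fun n hn => log_nonneg (one_le_div_of_mem_upTo hn)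
  have h4 := Nat.floor_le (by linarith : 0 ≤ x)
  have h5 := Nat.lt_floor_add_one x
  have h6 : 0 ≤ log x := log_nonneg hx
  rw [h1, abs_le]
  constructor <;> nlinarith

lemma sum_vM_floor_div (x : ℝ) :
    ∑ n ∈ upTo x, vM n * summ (fun _ => 1) (x / n) = ∑ n ∈ upTo x, log n := by
  have := sum_upTo_conv (fun d _ => vM d) x
  simp only [summ, Finset.mul_sum, mul_one]
  rw [← this]
  refine Finset.sum_congr rfl fun n hn => ?_
  rw [← ArithmeticFunction.vonMangoldt_sum, Nat.sum_divisorsAntidiagonal (f := fun d _ => vM d)]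

lemma exists_mertens : ∃ C : ℝ, 1 ≤ C ∧ ∀ x : ℝ, 1 ≤ x →
    |∑ n ∈ upTo x, vM n / n - log x| ≤ C := by
  obtain ⟨C, hC, h⟩ := exists_psi_le
  refine ⟨C + 3, by linarith, fun x hx => ?_⟩
  have h1 := sum_log_upTo hx
  rw [← sum_vM_floor_div] at h1
  have h2 : ∑ n ∈ upTo x, vM n * summ (fun _ => 1) (x / n) ≤ x * ∑ n ∈ upTo x, vM n / n := by
    rw [Finset.mul_sum]
    refine Finset.sum_le_sum fun n hn => ?_
    have := mul_le_mul_of_nonneg_left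
      (summ_one (by linarith [one_le_div_of_mem_upTo hn] : 0 ≤ x / n)) (vM_nonneg n)
    refine this.trans (le_of_eq (by ring))
  have h3 : x * ∑ n ∈ upTo x, vM n / n
      ≤ ∑ n ∈ upTo x, vM n * summ (fun _ => 1) (x / n) + summ vM x := by
    rw [Finset.mul_sum, summ, ← Finset.sum_add_distrib]
    refine Finset.sum_le_sum fun n hn => ?_
    have := mul_le_mul_of_nonneg_left (Nat.lt_floor_add_one (x / n)).le (vM_nonneg n)
    rw [summ_one_eq]
    have e : x * (vM n / n) = vM n * (x / n) := by ring
    linarith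
  have h4 := h x hx
  have h5 : log x ≤ x := (log_le_sub_one_of_pos (by linarith)).trans (by linarith)
  have hx0 : 0 < x := by linarith
  rw [abs_le] at h1 ⊢
  set Q := ∑ n ∈ upTo x, vM n / n
  constructor
  · by_contra! hh
    have : x * (Q - log x) < x * (-(C + 3)) := mul_lt_mul_of_pos_left hh hx0
    nlinarith
  · by_contra! hh
    have : x * (C + 3) < x * (Q - log x) := mul_lt_mul_of_pos_left hh hx0
    nlinarith

/-- Selberg's function `Λ * Λ + Λ log`. -/
noncomputable def vM2 (n : ℕ) : ℝ :=
  ∑ p ∈ n.divisorsAntidiagonal, vM p.1 * vM p.2 + vM n * log n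

lemma log_succ_sub_log_le {n : ℕ} (hn : 0 < n) : log ((n : ℝ) + 1) - log n ≤ 1 / n := by
  have hn' : (0 : ℝ) < n := by exact_mod_cast hn
  rw [← log_div (by positivity) (by positivity)]
  refine (log_le_sub_one_of_pos (by positivity)).trans (le_of_eq ?_)
  field_simp; ring

lemma le_log_succ_sub_log {n : ℕ} (hn : 0 < n) :
    1 / ((n : ℝ) + 1) ≤ log ((n : ℝ) + 1) - log n := by
  have hn' : (0 : ℝ) < n := by exact_mod_cast hn
  rw [← log_div (by positivity) (by positivity)]
  refine le_trans (le_of_eq ?_) (one_sub_inv_le_log_of_pos (by positivity))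
  field_simp; ring

lemma log_factorial_bounds {N : ℕ} (hN : 0 < N) :
    N * log N - N ≤ ∑ n ∈ Ioc 0 N, log n ∧
      ∑ n ∈ Ioc 0 N, log n ≤ N * log N - N + log N + 1 := by
  induction N, hN using Nat.le_induction with
  | base => norm_num [show Ioc 0 1 = {1} from rfl]
  | succ n hn ih =>
    rw [Finset.sum_Ioc_succ_top (Nat.zero_le n)]
    have hn' : (0 : ℝ) < n := by exact_mod_cast hn
    have h1 := log_succ_sub_log_le hn
    have h2 := le_log_succ_sub_log hn
    rw [le_div_iff₀ hn'] at h1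
    rw [div_le_iff₀ (by positivity)] at h2
    push_cast
    constructor <;> nlinarith [ih.1, ih.2]

lemma harmonic_bounds {N : ℕ} (hN : 0 < N) :
    log N + eulerMascheroniConstant ≤ ∑ n ∈ Ioc 0 N, (1 : ℝ) / n ∧
      ∑ n ∈ Ioc 0 N, (1 : ℝ) / n ≤ log N + eulerMascheroniConstant + 1 / N := by
  have h1 := eulerMascheroniSeq_lt_eulerMascheroniConstant N
  have h2 := eulerMascheroniConstant_lt_eulerMascheroniSeq' N
  have e : ((harmonic N : ℚ) : ℝ) = ∑ n ∈ Ioc 0 N, (1 : ℝ) / n := by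
    rw [harmonic_eq_sum_Icc]
    push_cast
    simp [← Finset.Icc_add_one_left_eq_Ioc, one_div]
  rw [eulerMascheroniSeq, e] at h1
  rw [eulerMascheroniSeq', if_neg hN.ne', e] at h2
  have := log_succ_sub_log_le hN
  constructor <;> linarith

lemma eulerMascheroni_mem : 0 ≤ eulerMascheroniConstant ∧ eulerMascheroniConstant ≤ 1 :=
  ⟨by linarith [one_half_lt_eulerMascheroniConstant],
    by linarith [eulerMascheroniConstant_lt_two_thirds]⟩

lemma sum_div_upTo (x : ℝ) : ∑ n ∈ upTo x, x / n = x * ∑ n ∈ upTo x, (1 : ℝ) / n := by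
  rw [Finset.mul_sum]; exact Finset.sum_congr rfl fun _ _ => by ring

/-- The remainder used in the Tatuzawa-Iseki argument. -/
noncomputable def psiRem (x : ℝ) : ℝ := summ vM x - x + 1 + eulerMascheroniConstant

lemma abs_sum_psiRem_le {y : ℝ} (hy : 1 ≤ y) :
    |∑ m ∈ upTo y, psiRem (y / m)| ≤ 7 * (1 + log y) := by
  have e : ∑ m ∈ upTo y, psiRem (y / m) = ∑ n ∈ upTo y, log n - y * ∑ n ∈ upTo y, (1 : ℝ) / n
      + (1 + eulerMascheroniConstant) * ⌊y⌋₊ := by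
    have h1 : ∑ m ∈ upTo y, summ vM (y / m) = ∑ n ∈ upTo y, log n := by
      rw [← sum_vM_floor_div]
      simp only [summ, Finset.mul_sum, mul_one]
      rw [sum_upTo_comm]
    simp only [psiRem, Finset.sum_add_distrib, Finset.sum_sub_distrib, h1, sum_div_upTo]
    simp [upTo]; ring
  have hN : 0 < ⌊y⌋₊ := Nat.floor_pos.2 hy
  obtain ⟨a1, a2⟩ := log_factorial_bounds hN
  obtain ⟨b1, b2⟩ := harmonic_bounds hN
  obtain ⟨c1, c2⟩ := eulerMascheroni_mem
  rw [e, upTo]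
  have f1 := Nat.floor_le (by linarith : 0 ≤ y)
  have f2 := Nat.lt_floor_add_one y
  set N := ⌊y⌋₊
  set γ := eulerMascheroniConstant
  set A := ∑ n ∈ Ioc 0 N, log n
  set B := ∑ n ∈ Ioc 0 N, (1 : ℝ) / n
  have hN1 : (1 : ℝ) ≤ N := by exact_mod_cast hN
  have l0 : 0 ≤ log N := log_nonneg hN1
  have l1 : log N ≤ log y := log_le_log (by linarith) f1
  have m1 : y * (log N + γ) ≤ y * B := mul_le_mul_of_nonneg_left b1 (by linarith)
  have m2 : y * B ≤ y * (log N + γ) + 2 := by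
    have : y * B ≤ y * (log N + γ + 1 / N) := mul_le_mul_of_nonneg_left b2 (by linarith)
    have h3 : y * (1 / N) ≤ 2 := by
      rw [mul_one_div, div_le_iff₀ (by linarith)]; linarith
    nlinarith
  have n1 : 0 ≤ (y - N) * log N := mul_nonneg (by linarith) l0
  have n2 : (y - N) * log N ≤ 1 * log N := mul_le_mul_of_nonneg_right (by linarith) l0
  have n3 : 0 ≤ (y - N) * γ := mul_nonneg (by linarith) c1
  have n4 : (y - N) * γ ≤ 1 * γ := mul_le_mul_of_nonneg_right (by linarith) c1
  rw [abs_le]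
  constructor <;> nlinarith

lemma one_add_log_sq_le {y : ℝ} (hy : 1 ≤ y) : (1 + log y) ^ 2 ≤ 16 * √y := by
  have h0 : 0 ≤ log y := log_nonneg hy
  have h1 : log √√y = log y / 4 := by
    rw [log_sqrt (sqrt_nonneg _), log_sqrt (by linarith)]; ring
  have h2 := log_le_sub_one_of_pos (show 0 < √√y from sqrt_pos.2 (sqrt_pos.2 (by linarith)))
  have h3 : 1 + log y ≤ 4 * √√y := by linarith
  have h4 : √√y ^ 2 = √y := sq_sqrt (sqrt_nonneg _)
  nlinarith [pow_le_pow_left₀ (by linarith) h3 2]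

lemma sum_inv_sqrt_Ioc_le (N : ℕ) : ∑ n ∈ Ioc 0 N, 1 / √(n : ℝ) ≤ 2 * √N := by
  induction N with
  | zero => simp
  | succ n ih =>
    rw [Finset.sum_Ioc_succ_top (Nat.zero_le n)]
    push_cast
    have h1 : 0 < √((n : ℝ) + 1) := sqrt_pos.2 (by positivity)
    have h2 := sq_sqrt (by positivity : (0 : ℝ) ≤ (n : ℝ) + 1)
    have h3 := sq_sqrt (by positivity : (0 : ℝ) ≤ (n : ℝ))
    have : 1 / √((n : ℝ) + 1) ≤ 2 * √((n : ℝ) + 1) - 2 * √n := by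
      rw [div_le_iff₀ h1]
      nlinarith [sq_nonneg (√((n : ℝ) + 1) - √n)]
    linarith

lemma sum_sqrt_div_upTo_le {x : ℝ} (hx : 1 ≤ x) : ∑ n ∈ upTo x, √(x / n) ≤ 2 * x := by
  have : ∑ n ∈ upTo x, √(x / n) = √x * ∑ n ∈ Ioc 0 ⌊x⌋₊, 1 / √(n : ℝ) := by
    rw [Finset.mul_sum, upTo]
    refine Finset.sum_congr rfl fun n _ => ?_
    rw [sqrt_div (by linarith)]; ring
  rw [this]
  have h1 := sum_inv_sqrt_Ioc_le ⌊x⌋₊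
  have h2 : √(⌊x⌋₊ : ℝ) ≤ √x := sqrt_le_sqrt (Nat.floor_le (by linarith))
  have h3 := sq_sqrt (by linarith : 0 ≤ x)
  nlinarith [sqrt_nonneg x]

lemma sum_moebius_psiRem {x : ℝ} (hx : 1 ≤ x) :
    ∑ n ∈ upTo x, (ArithmeticFunction.moebius n : ℝ) * log (x / n) *
        ∑ m ∈ upTo (x / n), psiRem (x / n / m)
      = psiRem x * log x + ∑ n ∈ upTo x, vM n * psiRem (x / n) := by
  have h := sum_upTo_conv (fun n m => (ArithmeticFunction.moebius n : ℝ) * log (x / n) *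
    psiRem (x / (n * m : ℕ))) x
  simp only [Finset.mul_sum]
  have e1 : ∀ n m : ℕ, x / n / m = x / (n * m : ℕ) := fun n m => by push_cast; rw [div_div]
  simp only [e1, ← h]
  have h1 : psiRem x * log x = ∑ n ∈ upTo x, if n = 1 then psiRem x * log x else 0 := by
    rw [Finset.sum_ite_eq' (upTo x), if_pos (mem_upTo.2 ⟨one_pos, by simpa using hx⟩)]
  rw [h1, ← Finset.sum_add_distrib]
  refine Finset.sum_congr rfl fun k hk => ?_
  have hk0 := (mem_upTo.1 hk).1
  have e2 : ∑ p ∈ k.divisorsAntidiagonal, (ArithmeticFunction.moebius p.1 : ℝ) *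
      log (x / p.1) * psiRem (x / (p.1 * p.2 : ℕ)) =
      (log x * ∑ d ∈ k.divisors, (ArithmeticFunction.moebius d : ℝ)
        - ∑ d ∈ k.divisors, (ArithmeticFunction.moebius d : ℝ) * log d) * psiRem (x / k) := by
    rw [Finset.mul_sum, ← Finset.sum_sub_distrib, Finset.sum_mul,
      ← Nat.sum_divisorsAntidiagonal (f := fun d _ =>
        (log x * (ArithmeticFunction.moebius d : ℝ) -
          (ArithmeticFunction.moebius d : ℝ) * log d) * psiRem (x / k))]
    refine Finset.sum_congr rfl fun p hp => ?_
    have hp' := Nat.mem_divisorsAntidiagonal.1 hp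
    have : (p.1 : ℝ) ≠ 0 := by
      rintro h0
      rw [Nat.cast_eq_zero] at h0
      simp [h0] at hp'; omega
    rw [hp'.1, log_div (by linarith) this]; ring
  have e3 : ∑ d ∈ k.divisors, (ArithmeticFunction.moebius d : ℝ) = if k = 1 then 1 else 0 := by
    have := congrArg (fun z : ℤ => (z : ℝ))
      (DFunLike.congr_fun ArithmeticFunction.moebius_mul_coe_zeta k)
    rw [ArithmeticFunction.coe_mul_zeta_apply, ArithmeticFunction.one_apply] at this
    push_cast at this
    exact this
  have e4 : ∑ d ∈ k.divisors, (ArithmeticFunction.moebius d : ℝ) * log d = -vM k :=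
    ArithmeticFunction.sum_moebius_mul_log_eq
  rw [e2, e3, e4]
  split_ifs with hk1
  · subst hk1; simp; ring
  · ring

lemma exists_psiRem_le : ∃ C : ℝ, 1 ≤ C ∧ ∀ x : ℝ, 1 ≤ x →
    |psiRem x * log x + ∑ n ∈ upTo x, vM n * psiRem (x / n)| ≤ C * x := by
  refine ⟨7 * 16 * 2, by norm_num, fun x hx => ?_⟩
  rw [← sum_moebius_psiRem hx]
  calc _ ≤ ∑ n ∈ upTo x, 7 * 16 * √(x / n) := by
        refine (Finset.abs_sum_le_sum_abs _ _).trans (Finset.sum_le_sum fun n hn => ?_)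
        have h1 := one_le_div_of_mem_upTo hn
        have h2 := abs_sum_psiRem_le h1
        have h3 := one_add_log_sq_le h1
        have h4 := log_nonneg h1
        rw [abs_mul, abs_mul, abs_of_nonneg h4]
        have h5 : |(ArithmeticFunction.moebius n : ℝ)| ≤ 1 := by
          exact_mod_cast ArithmeticFunction.abs_moebius_le_one (n := n)
        calc _ ≤ 1 * (1 + log (x / n)) * (7 * (1 + log (x / n))) := by gcongr; linarith
          _ ≤ _ := by nlinarith
    _ ≤ _ := by
        rw [← Finset.mul_sum]
        nlinarith [sum_sqrt_div_upTo_le hx]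

lemma sum_vM_mul_psi (x : ℝ) : ∑ n ∈ upTo x, vM n * summ vM (x / n)
    = ∑ n ∈ upTo x, ∑ p ∈ n.divisorsAntidiagonal, vM p.1 * vM p.2 := by
  rw [sum_upTo_conv (fun d e => vM d * vM e)]
  simp only [summ, Finset.mul_sum]

lemma sum_mul_log_eq (a : ℕ → ℝ) {x : ℝ} (hx : 0 < x) :
    ∑ n ∈ upTo x, a n * log n = summ a x * log x - ∑ n ∈ upTo x, a n * log (x / n) := by
  rw [summ, Finset.sum_mul, ← Finset.sum_sub_distrib]
  refine Finset.sum_congr rfl fun n hn => ?_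
  rw [log_div hx.ne' (pos_of_mem_upTo hn).ne']; ring

lemma exists_selberg : ∃ C : ℝ, 1 ≤ C ∧ ∀ x : ℝ, 0 ≤ x →
    |∑ n ∈ upTo x, (vM2 n - 2 * log n)| ≤ C * x := by
  obtain ⟨C, hC, h⟩ := exists_psiRem_le
  obtain ⟨C1, hC1, h1⟩ := exists_psi_le
  obtain ⟨C2, hC2, h2⟩ := exists_mertens
  refine ⟨C + C2 + 4 * C1 + 20, by linarith, fun x hx0 => ?_⟩
  rcases lt_or_ge x 1 with hx | hx
  · have : upTo x = ∅ := by simp [upTo, Nat.floor_eq_zero.2 hx]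
    simp only [this, Finset.sum_empty, abs_zero]; positivity
  have a := h x hx
  have b := h1 x hx
  have b0 : 0 ≤ summ vM x := Finset.sum_nonneg fun n _ => vM_nonneg n
  have c := h2 x hx
  have d := sum_log_upTo hx
  have e := sum_mul_log_div_le (b := vM) (fun n _ => vM_nonneg n) h1 hx
  have e0 : 0 ≤ ∑ n ∈ upTo x, vM n * log (x / n) :=
    Finset.sum_nonneg fun n hn => mul_nonneg (vM_nonneg n) (log_nonneg (one_le_div_of_mem_upTo hn))
  have l0 := log_nonneg hx
  have l1 : log x ≤ x := (log_le_sub_one_of_pos (by linarith)).trans (by linarith)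
  obtain ⟨g0, g1⟩ := eulerMascheroni_mem
  have key : ∑ n ∈ upTo x, vM n * psiRem (x / n) = ∑ n ∈ upTo x, vM n * summ vM (x / n)
      - x * ∑ n ∈ upTo x, vM n / n + (1 + eulerMascheroniConstant) * summ vM x := by
    rw [summ, Finset.mul_sum, Finset.mul_sum, ← Finset.sum_sub_distrib, ← Finset.sum_add_distrib]
    refine Finset.sum_congr rfl fun n _ => ?_
    rw [psiRem]; ring
  rw [key, psiRem] at a
  have key2 : ∑ n ∈ upTo x, (vM2 n - 2 * log n) = ∑ n ∈ upTo x, vM n * summ vM (x / n)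
      + (summ vM x * log x - ∑ n ∈ upTo x, vM n * log (x / n)) - 2 * ∑ n ∈ upTo x, log n := by
    rw [sum_vM_mul_psi, ← sum_mul_log_eq vM (by linarith), Finset.sum_sub_distrib, Finset.mul_sum]
    simp only [vM2, Finset.sum_add_distrib]
  rw [key2]
  set γ := eulerMascheroniConstant
  set P := summ vM x
  set Q := ∑ n ∈ upTo x, vM n / n
  set W := ∑ n ∈ upTo x, vM n * summ vM (x / n)
  have hq : |x * Q - x * log x| ≤ C2 * x := by
    rw [← mul_sub, abs_mul, abs_of_nonneg hx0, mul_comm]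
    exact mul_le_mul_of_nonneg_right c hx0
  have p1 : 0 ≤ γ * P := mul_nonneg g0 b0
  have p2 : γ * P ≤ P := mul_le_of_le_one_left b0 g1
  have p3 : 0 ≤ γ * log x := mul_nonneg g0 l0
  have p4 : γ * log x ≤ log x := mul_le_of_le_one_left l0 g1
  rw [abs_le] at *
  constructor <;> nlinarith

end

section

open Finset MeasureTheory Real intervalIntegral

lemma intervalIntegrable_of_bdd {g : ℝ → ℝ} (hm : Measurable g) {K : ℝ} (hK : ∀ q, |g q| ≤ K)
    (a b : ℝ) : IntervalIntegrable g volume a b :=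
  (intervalIntegrable_const (c := K)).mono_fun hm.aestronglyMeasurable
    (Filter.Eventually.of_forall fun q => by
      simp only [Real.norm_eq_abs]
      exact (hK q).trans (le_abs_self K))

lemma sum_Ioc_by_parts (c W : ℕ → ℝ) (M : ℕ) :
    ∑ n ∈ Ioc 0 (M + 1), c n * W n = (∑ n ∈ Ioc 0 (M + 1), c n) * W (M + 1)
      + ∑ n ∈ Ioc 0 M, (∑ k ∈ Ioc 0 n, c k) * (W n - W (n + 1)) := by
  induction M with
  | zero => simp
  | succ M ih =>
    rw [Finset.sum_Ioc_succ_top (Nat.zero_le _), ih, Finset.sum_Ioc_succ_top (b := M + 1)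
      (Nat.zero_le _), Finset.sum_Ioc_succ_top (Nat.zero_le M) (fun n => (∑ k ∈ Ioc 0 n, c k) *
        (W n - W (n + 1)))]
    ring

lemma integral_log_split {g : ℝ → ℝ} (hg : ∀ a b, IntervalIntegrable g volume a b) (M : ℕ) :
    ∫ w in (0 : ℝ)..log (M + 1), g w
      = ∑ n ∈ Ioc 0 M, ∫ w in log (n : ℝ)..log (n + 1), g w := by
  induction M with
  | zero => simp
  | succ M ih =>
    rw [Finset.sum_Ioc_succ_top (Nat.zero_le _), ← ih]
    push_cast
    exact (integral_add_adjacent_intervals (hg _ _) (hg _ _)).symm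

lemma integrable_mul_comp {K r : ℝ} {Φ : ℝ → ℝ} (hΦ : Measurable Φ) (hb : ∀ q, |Φ q| ≤ K)
    (a b : ℝ) :
    IntervalIntegrable (fun w => w * Φ (r - w)) volume a b :=
  (intervalIntegrable_of_bdd (hΦ.comp (measurable_const.sub measurable_id))
    (fun q => hb (r - q)) a b).continuousOn_mul continuousOn_id

lemma integral_sub_bound_of_log_interval {K r : ℝ} {Φ V : ℝ → ℝ} (hΦ : Measurable Φ)
    (hb : ∀ q, |Φ q| ≤ K)
    (hΦV : ∀ s t, 1 ≤ s → s ≤ t → |t * Φ (log t) - s * Φ (log s)| ≤ V t - V s)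
    {n : ℕ} (hn : 0 < n) (hnr : (n : ℝ) + 1 ≤ exp r) :
    |(∫ w in log (n : ℝ)..log (n + 1), w * Φ (r - w)) - log n * (Φ (r - log n) / n)|
      ≤ (n * (V (exp r / n) - V (exp r / (n + 1)))) / exp r + K * (1 / (n : ℝ) ^ 2) := by
  have hn' : (0 : ℝ) < n := by exact_mod_cast hn
  have hn1 : (1 : ℝ) ≤ n := by exact_mod_cast hn
  have hx := exp_pos r
  have hle : log (n : ℝ) ≤ log (n + 1) := log_le_log hn' (by linarith)
  have hK : 0 ≤ K := (abs_nonneg _).trans (hb 0)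
  have hexp : ∫ w in log (n : ℝ)..log (n + 1), exp w = 1 := by
    rw [integral_exp, exp_log hn', exp_log (by positivity)]; ring
  have e1 : (∫ w in log (n : ℝ)..log (n + 1), w * Φ (r - w)) - log n * (Φ (r - log n) / n)
      = ∫ w in log (n : ℝ)..log (n + 1), (w * Φ (r - w) - log n * (Φ (r - log n) / n) * exp w) := by
    rw [intervalIntegral.integral_sub (integrable_mul_comp hΦ hb _ _)
      (Continuous.intervalIntegrable (by fun_prop) _ _), intervalIntegral.integral_const_mul,
      hexp, mul_one]
  set D := n * (V (exp r / n) - V (exp r / (n + 1))) + 1 / n * (K * (exp r / n)) with hD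
  have e2 : (n * (V (exp r / n) - V (exp r / (n + 1)))) / exp r + K * (1 / (n : ℝ) ^ 2)
      = ∫ w in log (n : ℝ)..log (n + 1), D / exp r * exp w := by
    rw [intervalIntegral.integral_const_mul, hexp, hD]; field_simp
  rw [e1, e2, ← Real.norm_eq_abs]
  refine intervalIntegral.norm_integral_le_of_norm_le hle
    (Filter.Eventually.of_forall fun w hw => ?_)
    (Continuous.intervalIntegrable (by fun_prop) _ _)
  have hw0 : 0 ≤ w := (log_nonneg hn1).trans hw.1.le
  have hwn : w ≤ n := hw.2.trans ((log_le_sub_one_of_pos (by positivity)).trans (by linarith))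
  have hew : (n : ℝ) < exp w := by rw [← exp_log hn']; exact exp_lt_exp.2 hw.1
  have hew2 : exp w ≤ n + 1 := by
    rw [← exp_log (show (0 : ℝ) < n + 1 by positivity)]; exact exp_le_exp.2 hw.2
  have hdw : w - log n ≤ 1 / n := by linarith [hw.2, log_succ_sub_log_le hn]
  set t := exp r / n
  set s := exp r / exp w
  have hs1 : 1 ≤ s := (one_le_div (exp_pos w)).2 (by linarith)
  have hst : s ≤ t := div_le_div_of_nonneg_left hx.le hn' hew.le
  have hls : log s = r - w := by simp [s, log_div]
  have hlt : log t = r - log n := by simp [t, log_div, hn'.ne']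
  have h1 := hΦV s t hs1 hst
  have h2 : V (exp r / (n + 1)) ≤ V s := by
    have := (abs_nonneg _).trans (hΦV (exp r / (n + 1)) s
      ((one_le_div (by positivity)).2 (by linarith))
      (div_le_div_of_nonneg_left hx.le (exp_pos w) hew2))
    linarith
  rw [hls, hlt] at h1
  have e3 : w * Φ (r - w) - log n * (Φ (r - log n) / n) * exp w
      = (w * (s * Φ (r - w) - t * Φ (r - log n)) + (w - log n) * (t * Φ (r - log n)))
        * (exp w / exp r) := by
    simp only [s, t]; field_simp; ring
  rw [e3, Real.norm_eq_abs, abs_mul, abs_of_pos (by positivity : 0 < exp w / exp r)]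
  have e4 : D / exp r * exp w = D * (exp w / exp r) := by ring
  rw [e4]
  refine mul_le_mul_of_nonneg_right ?_ (by positivity)
  have ht0 : 0 ≤ t := by positivity
  have h3 : |t * Φ (r - log n)| ≤ K * t := by
    rw [abs_mul, abs_of_nonneg ht0, mul_comm]; exact mul_le_mul_of_nonneg_right (hb _) ht0
  calc _ ≤ |w * (s * Φ (r - w) - t * Φ (r - log n))| + |(w - log n) * (t * Φ (r - log n))| :=
        abs_add_le _ _
    _ ≤ n * (V t - V (exp r / (n + 1))) + 1 / n * (K * t) := by
        rw [abs_mul, abs_mul, abs_of_nonneg hw0, abs_of_nonneg (by linarith [hw.1] : 0 ≤ w - log n),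
          abs_sub_comm]
        have : V t - V s ≤ V t - V (exp r / (n + 1)) := by linarith
        have h4 := h1.trans this
        gcongr

lemma sum_V_bound {K r : ℝ} {V : ℝ → ℝ}
    (hV : ∀ t, 1 ≤ t → 0 ≤ V t ∧ V t ≤ K * t)
    (hr : 0 ≤ r) {M : ℕ} (hM : (M : ℝ) + 1 ≤ exp r) :
    ∑ n ∈ Ioc 0 M, (n : ℝ) * (V (exp r / n) - V (exp r / (n + 1))) ≤ K * exp r * (1 + r) := by
  have h := sum_Ioc_by_parts (fun _ => 1) (fun n => V (exp r / n)) M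
  have hM1 : (M : ℝ) + 1 = ((M + 1 : ℕ) : ℝ) := by push_cast; ring
  have h1 : ∀ n ∈ Ioc 0 (M + 1), V (exp r / n) ≤ K * exp r * (1 / n) := fun n hn => by
    have hn0 : (0 : ℝ) < n := by exact_mod_cast (mem_Ioc.1 hn).1
    have hn1 : (n : ℝ) ≤ M + 1 := by rw [hM1]; exact_mod_cast (mem_Ioc.1 hn).2
    refine ((hV (exp r / n) ((one_le_div hn0).2 (hn1.trans hM))).2).trans (le_of_eq (by ring))
  have hK : 0 ≤ K := by
    have := hV 1 le_rfl
    linarith [this.1, this.2]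
  have h2 : ∑ n ∈ Ioc 0 (M + 1), (1 : ℝ) / n ≤ 1 + r := by
    have := sum_inv_upTo_le (x := exp r) (one_le_exp hr)
    rw [log_exp] at this
    refine le_trans (Finset.sum_le_sum_of_subset_of_nonneg ?_ fun _ _ _ => by positivity) this
    rw [← upTo_natCast]
    exact upTo_subset (by push_cast; exact hM)
  have h3 : 0 ≤ V (exp r / (M + 1 : ℕ)) :=
    (hV _ ((one_le_div (by positivity)).2 (by push_cast; exact hM))).1
  have h4 := Finset.sum_le_sum h1
  rw [← Finset.mul_sum] at h4
  simp only [one_mul, sum_const, Nat.card_Ioc, Nat.sub_zero, nsmul_eq_mul, mul_one] at h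
  have h5 : K * exp r * ∑ n ∈ Ioc 0 (M + 1), (1 : ℝ) / n ≤ K * exp r * (1 + r) :=
    mul_le_mul_of_nonneg_left h2 (by positivity)
  have h6 : 0 ≤ ((M + 1 : ℕ) : ℝ) * V (exp r / (M + 1 : ℕ)) := by positivity
  push_cast at *
  linarith

/-- Selberg's formula, tested against functions of bounded variation type. -/
lemma exists_selberg_integral : ∃ C : ℝ, 1 ≤ C ∧ ∀ (K : ℝ) (Φ V : ℝ → ℝ), Measurable Φ →
    (∀ q, |Φ q| ≤ K) → (∀ t, 1 ≤ t → 0 ≤ V t ∧ V t ≤ K * t) →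
    (∀ s t, 1 ≤ s → s ≤ t → |t * Φ (log t) - s * Φ (log s)| ≤ V t - V s) →
    ∀ r, 0 ≤ r → |∑ n ∈ upTo (exp r), vM2 n / n * Φ (r - log n)
      - 2 * ∫ q in (0 : ℝ)..r, (r - q) * Φ q| ≤ C * K * (r + 1) := by
  obtain ⟨C, hC, hsel⟩ := exists_selberg
  refine ⟨2 * C + 10, by linarith, fun K Φ V hΦ hb hV hΦV r hr => ?_⟩
  have hx := exp_pos r
  have hK : 0 ≤ K := (abs_nonneg _).trans (hb 0)
  obtain ⟨M, hM⟩ : ∃ M, ⌊exp r⌋₊ = M + 1 :=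
    Nat.exists_eq_succ_of_ne_zero (Nat.floor_pos.2 (one_le_exp hr)).ne'
  have hMx : (M : ℝ) + 1 ≤ exp r := by
    have := Nat.floor_le hx.le
    rw [hM] at this; push_cast at this; exact this
  have hMx2 : exp r ≤ M + 1 + 1 := by
    have := (Nat.lt_floor_add_one (exp r)).le
    rw [hM] at this; push_cast at this; exact this
  have hup : upTo (exp r) = Ioc 0 (M + 1) := by rw [upTo, hM]
  set W : ℕ → ℝ := fun n => Φ (r - log n) / n with hW
  have hWM : |W (M + 1)| ≤ K / (M + 1) := by
    simp only [hW]; push_cast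
    rw [abs_div, abs_of_pos (by positivity : (0 : ℝ) < M + 1)]
    gcongr; exact hb _
  have hVsum := sum_V_bound hV hr hMx
  -- the arithmetic part
  have hA : |∑ n ∈ Ioc 0 (M + 1), (vM2 n - 2 * log n) * W n| ≤ C * K * (1 + r) + C * K := by
    rw [sum_Ioc_by_parts]
    refine (abs_add_le _ _).trans ?_
    have h1 : |(∑ n ∈ Ioc 0 (M + 1), (vM2 n - 2 * log n)) * W (M + 1)| ≤ C * K := by
      have := hsel (M + 1 : ℕ) (Nat.cast_nonneg _)
      rw [upTo_natCast] at this
      rw [abs_mul]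
      push_cast at this
      calc _ ≤ C * (M + 1) * (K / (M + 1)) := by gcongr
        _ = C * K := by field_simp
    have h2 : |∑ n ∈ Ioc 0 M, (∑ k ∈ Ioc 0 n, (vM2 k - 2 * log k)) * (W n - W (n + 1))|
        ≤ C * K * (1 + r) := by
      calc _ ≤ ∑ n ∈ Ioc 0 M, C / exp r * ((n : ℝ) * (V (exp r / n) - V (exp r / (n + 1)))) := by
            refine (Finset.abs_sum_le_sum_abs _ _).trans (Finset.sum_le_sum fun n hn => ?_)
            have hn0 : (0 : ℝ) < n := by exact_mod_cast (mem_Ioc.1 hn).1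
            have hn1 : (n : ℝ) ≤ M := by exact_mod_cast (mem_Ioc.1 hn).2
            have a1 := hsel n hn0.le
            rw [upTo_natCast] at a1
            have a2 := hΦV (exp r / (n + 1)) (exp r / n)
              ((one_le_div (by positivity)).2 (by linarith))
              (div_le_div_of_nonneg_left hx.le hn0 (by linarith))
            have e1 : log (exp r / n) = r - log n := by
              rw [log_div hx.ne' hn0.ne', log_exp]
            have e2 : log (exp r / (n + 1)) = r - log (n + 1) := by
              rw [log_div hx.ne' (by positivity), log_exp]
            rw [e1, e2] at a2
            have e3 : W n - W (n + 1) = (exp r / n * Φ (r - log n)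
                - exp r / (n + 1) * Φ (r - log (n + 1))) / exp r := by
              simp only [hW]; push_cast; field_simp
            rw [abs_mul, e3, abs_div, abs_of_pos hx]
            calc _ ≤ C * n * ((V (exp r / n) - V (exp r / (n + 1))) / exp r) := by gcongr
              _ = _ := by ring
        _ ≤ C / exp r * (K * exp r * (1 + r)) := by
            rw [← Finset.mul_sum]; gcongr
        _ = C * K * (1 + r) := by field_simp
    linarith
  -- the integral part
  have hint := integrable_mul_comp (r := r) hΦ hb
  have hI1 : ∫ q in (0 : ℝ)..r, (r - q) * Φ q = ∫ w in (0 : ℝ)..r, w * Φ (r - w) := by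
    have := integral_comp_sub_left (a := 0) (b := r) (fun w => w * Φ (r - w)) r
    simpa using this
  have hI2 : ∫ w in (0 : ℝ)..r, w * Φ (r - w)
      = ∑ n ∈ Ioc 0 M, (∫ w in log (n : ℝ)..log (n + 1), w * Φ (r - w))
        + ∫ w in log ((M : ℝ) + 1)..r, w * Φ (r - w) := by
    rw [← integral_log_split hint, integral_add_adjacent_intervals (hint _ _) (hint _ _)]
  have hlr : log ((M : ℝ) + 1) ≤ r := by
    rw [← log_exp r]; exact log_le_log (by positivity) hMx
  have hl0 : 0 ≤ log ((M : ℝ) + 1) := log_nonneg (by linarith [Nat.cast_nonneg (α := ℝ) M])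
  have hI3 : |∫ w in log ((M : ℝ) + 1)..r, w * Φ (r - w)| ≤ r * K := by
    have h1 : ‖∫ w in log ((M : ℝ) + 1)..r, w * Φ (r - w)‖
        ≤ r * K * |r - log ((M : ℝ) + 1)| := by
      refine norm_integral_le_of_norm_le_const fun w hw => ?_
      rw [Set.uIoc_of_le hlr] at hw
      rw [Real.norm_eq_abs, abs_mul, abs_of_nonneg (hl0.trans hw.1.le)]
      exact mul_le_mul hw.2 (hb _) (abs_nonneg _) hr
    have h2 : |r - log ((M : ℝ) + 1)| ≤ 1 := by
      rw [abs_of_nonneg (by linarith)]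
      have : r ≤ log ((M : ℝ) + 1 + 1) := by
        rw [← log_exp r]; exact log_le_log hx hMx2
      have h3 := log_succ_sub_log_le (Nat.succ_pos M)
      push_cast at h3
      have h4 : 1 / ((M : ℝ) + 1) ≤ 1 := by
        rw [div_le_one (by positivity)]; linarith [Nat.cast_nonneg (α := ℝ) M]
      linarith
    rw [Real.norm_eq_abs] at h1
    exact h1.trans (mul_le_of_le_one_right (by positivity) h2)
  have hI4 : |∑ n ∈ Ioc 0 M, ((∫ w in log (n : ℝ)..log (n + 1), w * Φ (r - w)) - log n * W n)|
      ≤ K * (1 + r) + K * 2 := by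
    calc _ ≤ ∑ n ∈ Ioc 0 M, ((n * (V (exp r / n) - V (exp r / (n + 1)))) / exp r
            + K * (1 / (n : ℝ) ^ 2)) := by
          refine (Finset.abs_sum_le_sum_abs _ _).trans (Finset.sum_le_sum fun n hn => ?_)
          have hn1 : (n : ℝ) ≤ M := by exact_mod_cast (mem_Ioc.1 hn).2
          exact integral_sub_bound_of_log_interval hΦ hb hΦV (mem_Ioc.1 hn).1 (by linarith)
      _ ≤ K * exp r * (1 + r) / exp r + K * 2 := by
          rw [Finset.sum_add_distrib, ← Finset.sum_div, ← Finset.mul_sum]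
          have := sum_inv_sq_upTo_le (M : ℝ)
          rw [upTo_natCast] at this
          gcongr
      _ = _ := by field_simp
  have hlast : |log ((M : ℝ) + 1) * W (M + 1)| ≤ r * K := by
    rw [abs_mul, abs_of_nonneg hl0]
    refine mul_le_mul hlr (hWM.trans (div_le_self hK ?_)) (abs_nonneg _) hr
    linarith [Nat.cast_nonneg (α := ℝ) M]
  have hsplit : ∑ n ∈ Ioc 0 (M + 1), (vM2 n - 2 * log n) * W n
      = ∑ n ∈ Ioc 0 (M + 1), vM2 n / n * Φ (r - log n)
        - 2 * (∑ n ∈ Ioc 0 M, log n * W n + log ((M : ℝ) + 1) * W (M + 1)) := by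
    have : ∑ n ∈ Ioc 0 M, log n * W n + log ((M : ℝ) + 1) * W (M + 1)
        = ∑ n ∈ Ioc 0 (M + 1), log n * W n := by
      rw [Finset.sum_Ioc_succ_top (Nat.zero_le _)]; push_cast; rfl
    rw [this, Finset.mul_sum, ← Finset.sum_sub_distrib]
    refine Finset.sum_congr rfl fun n _ => ?_
    simp only [hW]; ring
  rw [hup, hI1, hI2]
  rw [hsplit] at hA
  rw [Finset.sum_sub_distrib] at hI4
  have hCK : K ≤ C * K := le_mul_of_one_le_left hK hC
  have hCKr : K * r ≤ C * K * r := mul_le_mul_of_nonneg_right hCK hr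
  have hKr : 0 ≤ K * r := mul_nonneg hK hr
  rw [abs_le] at *
  constructor <;> nlinarith

end

section

open Finset MeasureTheory Real

/-- The mean value `e^{-r} ∑_{n ≤ e^r} a n`. -/
noncomputable def meanVal (a : ℕ → ℝ) (r : ℝ) : ℝ := exp (-r) * summ a (exp r)

lemma summ_eq_zero (a : ℕ → ℝ) {x : ℝ} (hx : x < 1) : summ a x = 0 := by
  simp [summ, upTo, Nat.floor_eq_zero.2 hx]

lemma meanVal_eq_zero (a : ℕ → ℝ) {r : ℝ} (hr : r < 0) : meanVal a r = 0 := by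
  rw [meanVal, summ_eq_zero a (by simpa using hr), mul_zero]

lemma summ_exp (a : ℕ → ℝ) (r : ℝ) : summ a (exp r) = exp r * meanVal a r := by
  rw [meanVal, ← mul_assoc, ← exp_add]; simp

lemma mul_meanVal_log (a : ℕ → ℝ) {t : ℝ} (ht : 0 < t) : t * meanVal a (log t) = summ a t := by
  rw [meanVal, exp_neg, exp_log ht]; field_simp

lemma meanVal_sub_log (a : ℕ → ℝ) (r : ℝ) {n : ℕ} (hn : 0 < n) :
    meanVal a (r - log n) / n = summ a (exp r / n) / exp r := by
  have hn' : (0 : ℝ) < n := by exact_mod_cast hn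
  rw [meanVal, neg_sub, exp_sub, exp_sub, exp_log hn']
  field_simp

lemma measurable_summ (a : ℕ → ℝ) : Measurable (summ a) := by
  have : summ a = (fun N : ℕ => ∑ n ∈ Ioc 0 N, a n) ∘ fun x : ℝ => ⌊x⌋₊ := rfl
  rw [this]
  exact (measurable_from_nat).comp Nat.measurable_floor

lemma measurable_meanVal (a : ℕ → ℝ) : Measurable (meanVal a) :=
  (measurable_exp.comp measurable_neg).mul ((measurable_summ a).comp measurable_exp)

lemma summ_sub (a : ℕ → ℝ) {s t : ℝ} (hst : s ≤ t) :
    summ a t - summ a s = ∑ n ∈ upTo t \ upTo s, a n := by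
  rw [summ, summ, ← Finset.sum_sdiff (upTo_subset hst)]; ring

lemma abs_summ_sub_le (a : ℕ → ℝ) {s t : ℝ} (hst : s ≤ t) :
    |summ a t - summ a s| ≤ summ (fun n => |a n|) t - summ (fun n => |a n|) s := by
  rw [summ_sub _ hst, summ_sub _ hst]
  exact Finset.abs_sum_le_sum_abs _ _

lemma abs_summ_le (a : ℕ → ℝ) (x : ℝ) : |summ a x| ≤ summ (fun n => |a n|) x :=
  Finset.abs_sum_le_sum_abs _ _

lemma summ_abs_nonneg (a : ℕ → ℝ) (x : ℝ) : 0 ≤ summ (fun n => |a n|) x :=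
  Finset.sum_nonneg fun _ _ => abs_nonneg _

/-- `a` behaves like a multiplicative function whose values at prime powers are controlled by
`φ`. -/
structure MulLike (a φ : ℕ → ℝ) (K : ℝ) : Prop where
  sum_abs_le : ∀ x, 1 ≤ x → summ (fun n => |a n|) x ≤ K * x
  abs_le_one : ∀ n, 0 < n → |φ n| ≤ 1
  log_le : ∀ x, 1 ≤ x →
    |summ a x * log x - ∑ n ∈ upTo x, φ n * vM n * summ a (x / n)| ≤ K * x

/-- The twisted Selberg function. -/
noncomputable def twist (φ : ℕ → ℝ) (n : ℕ) : ℝ :=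
  ∑ p ∈ n.divisorsAntidiagonal, (φ p.1 * vM p.1) * (φ p.2 * vM p.2) + φ n * vM n * log n

lemma abs_mul_vM_le {φ : ℕ → ℝ} (hφ : ∀ n, 0 < n → |φ n| ≤ 1) (n : ℕ) : |φ n * vM n| ≤ vM n := by
  rcases Nat.eq_zero_or_pos n with rfl | hn
  · simp [vM]
  · rw [abs_mul, abs_of_nonneg (vM_nonneg n)]
    exact mul_le_of_le_one_left (vM_nonneg n) (hφ n hn)

lemma abs_twist_le {φ : ℕ → ℝ} (hφ : ∀ n, 0 < n → |φ n| ≤ 1) (n : ℕ) :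
    |twist φ n| ≤ vM2 n := by
  refine (abs_add_le _ _).trans (add_le_add ?_ ?_)
  · refine (Finset.abs_sum_le_sum_abs _ _).trans (Finset.sum_le_sum fun p _ => ?_)
    rw [abs_mul]
    exact mul_le_mul (abs_mul_vM_le hφ _) (abs_mul_vM_le hφ _) (abs_nonneg _) (vM_nonneg _)
  · rw [abs_mul, abs_of_nonneg (log_natCast_nonneg n)]
    exact mul_le_mul_of_nonneg_right (abs_mul_vM_le hφ _) (log_natCast_nonneg n)

section
variable {a φ : ℕ → ℝ} {K : ℝ}

lemma MulLike.nonneg (h : MulLike a φ K) : 0 ≤ K := by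
  have := (summ_abs_nonneg a 1).trans (h.sum_abs_le 1 le_rfl)
  linarith

lemma MulLike.abs_meanVal_le (h : MulLike a φ K) (r : ℝ) : |meanVal a r| ≤ K := by
  rcases lt_or_ge r 0 with hr | hr
  · rw [meanVal_eq_zero a hr, abs_zero]; exact h.nonneg
  · have h1 := (abs_summ_le a (exp r)).trans (h.sum_abs_le (exp r) (one_le_exp hr))
    rw [summ_exp, abs_mul, abs_of_pos (exp_pos r), mul_comm] at h1
    exact le_of_mul_le_mul_right h1 (exp_pos r)

end

lemma exists_second_iterate : ∃ C : ℝ, 1 ≤ C ∧ ∀ (a φ : ℕ → ℝ) (K : ℝ), MulLike a φ K →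
    ∀ r, 0 ≤ r → |r ^ 2 * meanVal a r
      - ∑ n ∈ upTo (exp r), twist φ n / n * meanVal a (r - log n)| ≤ C * K * (r + 1) := by
  obtain ⟨C, hC, hm⟩ := exists_mertens
  refine ⟨C + 2, by linarith, fun a φ K h r hr => ?_⟩
  have hK := h.nonneg
  have hx := exp_pos r
  have hx1 := one_le_exp hr
  set x := exp r with hxdef
  have hlog : log x = r := log_exp r
  have h0 := h.log_le x hx1
  have h1 : |∑ n ∈ upTo x, φ n * vM n * (summ a (x / n) * log (x / n)
      - ∑ m ∈ upTo (x / n), φ m * vM m * summ a (x / n / m))| ≤ K * x * (C + r) := by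
    calc _ ≤ ∑ n ∈ upTo x, K * x * (vM n / n) := by
          refine (Finset.abs_sum_le_sum_abs _ _).trans (Finset.sum_le_sum fun n hn => ?_)
          rw [abs_mul]
          calc _ ≤ vM n * (K * (x / n)) := mul_le_mul (abs_mul_vM_le h.abs_le_one n)
                (h.log_le _ (one_le_div_of_mem_upTo hn)) (abs_nonneg _) (vM_nonneg n)
            _ = _ := by ring
      _ ≤ K * x * (C + r) := by
          rw [← Finset.mul_sum]
          have := (abs_le.1 (hm x hx1)).2
          rw [hlog] at this
          exact mul_le_mul_of_nonneg_left (by linarith) (by positivity)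
  have h2 : ∑ n ∈ upTo x, φ n * vM n * ∑ m ∈ upTo (x / n), φ m * vM m * summ a (x / n / m)
      = ∑ n ∈ upTo x, (∑ p ∈ n.divisorsAntidiagonal, (φ p.1 * vM p.1) * (φ p.2 * vM p.2))
          * summ a (x / n) := by
    have := sum_upTo_conv (fun n m => (φ n * vM n) * (φ m * vM m) * summ a (x / (n * m : ℕ))) x
    simp only [Finset.mul_sum]
    have e1 : ∀ n m : ℕ, x / n / m = x / (n * m : ℕ) := fun n m => by push_cast; rw [div_div]
    simp only [e1, ← mul_assoc] at this ⊢
    rw [← this]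
    refine Finset.sum_congr rfl fun n _ => ?_
    rw [Finset.sum_mul]
    refine Finset.sum_congr rfl fun p hp => ?_
    rw [(Nat.mem_divisorsAntidiagonal.1 hp).1]
  have h3 : ∑ n ∈ upTo x, twist φ n / n * meanVal a (r - log n)
      = (∑ n ∈ upTo x, twist φ n * summ a (x / n)) / x := by
    rw [Finset.sum_div]
    refine Finset.sum_congr rfl fun n hn => ?_
    rw [div_mul_eq_mul_div, mul_div_assoc, meanVal_sub_log a r (mem_upTo.1 hn).1, mul_div_assoc]
  have h4 : ∑ n ∈ upTo x, twist φ n * summ a (x / n)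
      = ∑ n ∈ upTo x, φ n * vM n * ∑ m ∈ upTo (x / n), φ m * vM m * summ a (x / n / m)
        + (r * ∑ n ∈ upTo x, φ n * vM n * summ a (x / n)
          - ∑ n ∈ upTo x, φ n * vM n * (summ a (x / n) * log (x / n))) := by
    rw [h2, Finset.mul_sum, ← Finset.sum_sub_distrib, ← Finset.sum_add_distrib]
    refine Finset.sum_congr rfl fun n hn => ?_
    rw [twist, log_div hx.ne' (pos_of_mem_upTo hn).ne', hlog]; ring
  have h5 : r ^ 2 * meanVal a r - (∑ n ∈ upTo x, twist φ n * summ a (x / n)) / x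
      = (r * (summ a x * log x - ∑ n ∈ upTo x, φ n * vM n * summ a (x / n))
        + ∑ n ∈ upTo x, φ n * vM n * (summ a (x / n) * log (x / n)
      - ∑ m ∈ upTo (x / n), φ m * vM m * summ a (x / n / m))) / x := by
    rw [h4, hlog]
    simp only [mul_sub, Finset.sum_sub_distrib]
    rw [hxdef, summ_exp]; field_simp; ring
  rw [h3, h5, abs_div, abs_of_pos hx, div_le_iff₀ hx]
  refine (abs_add_le _ _).trans ?_
  rw [abs_mul, abs_of_nonneg hr]
  have h6 := mul_le_mul_of_nonneg_left h0 hr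
  have : 0 ≤ K * x := by positivity
  nlinarith [mul_nonneg this hr, mul_nonneg (mul_nonneg this hr) (by linarith : 0 ≤ C)]

lemma exists_abs_meanVal_iterate : ∃ C : ℝ, 1 ≤ C ∧ ∀ (a φ : ℕ → ℝ) (K : ℝ), MulLike a φ K →
    ∀ r, 0 ≤ r → |∑ n ∈ upTo (exp r), vM2 n / n * |meanVal a (r - log n)|
      - 2 * (∫ q in (0 : ℝ)..r, (r - q) * |meanVal a q|)| ≤ C * K * (r + 1) := by
  obtain ⟨C, hC, hT⟩ := exists_selberg_integral
  refine ⟨C, hC, fun a φ K h r hr => hT K (fun q => |meanVal a q|)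
    (fun t => summ (fun n => |a n|) t) (measurable_meanVal a).abs
    (fun q => by simpa using h.abs_meanVal_le q)
    (fun t ht => ⟨summ_abs_nonneg a t, h.sum_abs_le t ht⟩) (fun s t hs hst => ?_) r hr⟩
  have e : ∀ t : ℝ, 0 < t → t * |meanVal a (log t)| = |summ a t| := fun t ht => by
    rw [← mul_meanVal_log a ht, abs_mul, abs_of_pos ht]
  rw [e t (by linarith), e s (by linarith)]
  exact (abs_abs_sub_abs_le _ _).trans (abs_summ_sub_le a hst)

lemma exists_integral_inequality : ∃ C : ℝ, 1 ≤ C ∧ ∀ (a φ : ℕ → ℝ) (K : ℝ), MulLike a φ K →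
    ∀ r, 0 ≤ r → r ^ 2 * |meanVal a r|
      ≤ 2 * (∫ q in (0 : ℝ)..r, (r - q) * |meanVal a q|) + C * K * (r + 1) := by
  obtain ⟨C1, hC1, h1⟩ := exists_second_iterate
  obtain ⟨C2, hC2, h2⟩ := exists_abs_meanVal_iterate
  refine ⟨C1 + C2, by linarith, fun a φ K h r hr => ?_⟩
  have a1 := h1 a φ K h r hr
  have a2 := (abs_le.1 (h2 a φ K h r hr)).2
  have a3 : |∑ n ∈ upTo (exp r), twist φ n / n * meanVal a (r - log n)|
      ≤ ∑ n ∈ upTo (exp r), vM2 n / n * |meanVal a (r - log n)| := by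
    refine (Finset.abs_sum_le_sum_abs _ _).trans (Finset.sum_le_sum fun n _ => ?_)
    rw [abs_mul, abs_div, Nat.abs_cast]
    gcongr
    exact abs_twist_le h.abs_le_one n
  have a4 := abs_sub_abs_le_abs_sub (r ^ 2 * meanVal a r)
    (∑ n ∈ upTo (exp r), twist φ n / n * meanVal a (r - log n))
  rw [abs_mul, abs_of_nonneg (sq_nonneg r)] at a4
  linarith

/-- Complete multiplicativity together with the bound `|f| ≤ 1`. -/
structure BddMul (f : ℕ → ℝ) : Prop where
  map_one : f 1 = 1
  map_mul : ∀ m n : ℕ, 0 < m → 0 < n → f (m * n) = f m * f n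
  abs_le : ∀ n, 0 < n → |f n| ≤ 1

lemma sum_vM_antidiagonal {f : ℕ → ℝ} (hf : BddMul f) (n : ℕ) :
    ∑ p ∈ n.divisorsAntidiagonal, f p.1 * vM p.1 * f p.2 = f n * log n := by
  rw [← ArithmeticFunction.vonMangoldt_sum, ← Nat.sum_divisorsAntidiagonal (f := fun d _ => vM d),
    Finset.mul_sum]
  refine Finset.sum_congr rfl fun p hp => ?_
  obtain ⟨h1, h2⟩ := Nat.mem_divisorsAntidiagonal.1 hp
  rw [← h1, hf.map_mul _ _ (Nat.pos_of_ne_zero (left_ne_zero_of_mul (h1 ▸ h2)))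
    (Nat.pos_of_ne_zero (right_ne_zero_of_mul (h1 ▸ h2)))]
  ring

lemma BddMul.sum_mul_log {f : ℕ → ℝ} (hf : BddMul f) (x : ℝ) :
    ∑ n ∈ upTo x, f n * log n = ∑ n ∈ upTo x, f n * vM n * summ f (x / n) := by
  simp only [summ, Finset.mul_sum]
  rw [← sum_upTo_conv (fun d e => f d * vM d * f e)]
  exact Finset.sum_congr rfl fun n _ => (sum_vM_antidiagonal hf n).symm

lemma BddMul.summ_abs_le {f : ℕ → ℝ} (hf : BddMul f) {x : ℝ} (hx : 0 ≤ x) :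
    summ (fun n => |f n|) x ≤ x :=
  (Finset.sum_le_sum fun n hn => hf.abs_le n (mem_upTo.1 hn).1).trans (summ_one hx)

lemma BddMul.mulLike {f : ℕ → ℝ} (hf : BddMul f) : MulLike f f 2 where
  sum_abs_le x hx := by linarith [hf.summ_abs_le (by linarith : 0 ≤ x)]
  abs_le_one := hf.abs_le
  log_le x hx := by
    rw [← hf.sum_mul_log, sum_mul_log_eq f (by linarith), sub_sub_cancel]
    have h := sum_mul_log_div_le (b := fun n => |f n|) (K := 1) (fun _ _ => abs_nonneg _)
      (fun x hx => by simpa using hf.summ_abs_le (by linarith : 0 ≤ x)) hx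
    refine (Finset.abs_sum_le_sum_abs _ _).trans ?_
    refine le_trans (Finset.sum_le_sum fun n hn => le_of_eq ?_) (h.trans (by linarith))
    rw [abs_mul, abs_of_nonneg (log_nonneg (one_le_div_of_mem_upTo hn))]

lemma exists_mulLike_vM : ∃ K : ℝ, MulLike (fun n => vM n - 1) (fun _ => -1) K := by
  obtain ⟨C, hC, hpsi⟩ := exists_psi_le
  obtain ⟨C1, hC1, hsel⟩ := exists_selberg
  have hb : ∀ x, 1 ≤ x → summ (fun n => |vM n - 1|) x ≤ (C + 1) * x := fun x hx => by
    have h1 : summ (fun n => |vM n - 1|) x ≤ summ vM x + summ (fun _ => 1) x := by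
      rw [summ, summ, summ, ← Finset.sum_add_distrib]
      refine Finset.sum_le_sum fun n _ => (abs_sub _ _).trans ?_
      rw [abs_of_nonneg (vM_nonneg n), abs_one]
    linarith [hpsi x hx, summ_one (by linarith : 0 ≤ x)]
  refine ⟨2 * (C + 1) + C1, fun x hx => (hb x hx).trans ?_, fun n _ => by simp, fun x hx => ?_⟩
  · gcongr; linarith
  have h1 := sum_mul_log_eq (fun n => vM n - 1) (by linarith : 0 < x)
  have h2 : ∑ n ∈ upTo x, vM n * summ (fun n => vM n - 1) (x / n)
      = ∑ n ∈ upTo x, ((∑ p ∈ n.divisorsAntidiagonal, vM p.1 * vM p.2) - log n) := by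
    rw [Finset.sum_sub_distrib, ← sum_vM_floor_div, ← sum_vM_mul_psi, ← Finset.sum_sub_distrib]
    refine Finset.sum_congr rfl fun n _ => ?_
    rw [← mul_sub, summ, summ, summ, Finset.sum_sub_distrib]
  have h3 : ∑ n ∈ upTo x, -1 * vM n * summ (fun n => vM n - 1) (x / n)
      = -∑ n ∈ upTo x, vM n * summ (fun n => vM n - 1) (x / n) := by
    rw [← Finset.sum_neg_distrib]
    exact Finset.sum_congr rfl fun n _ => by ring
  have h4 : summ (fun n => vM n - 1) x * log x
      - ∑ n ∈ upTo x, -1 * vM n * summ (fun n => vM n - 1) (x / n)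
      = ∑ n ∈ upTo x, (vM2 n - 2 * log n) + ∑ n ∈ upTo x, (vM n - 1) * log (x / n) := by
    have h5 : ∑ n ∈ upTo x, (vM2 n - 2 * log n) = ∑ n ∈ upTo x, (vM n - 1) * log n
        + ∑ n ∈ upTo x, ((∑ p ∈ n.divisorsAntidiagonal, vM p.1 * vM p.2) - log n) := by
      rw [← Finset.sum_add_distrib]
      exact Finset.sum_congr rfl fun n _ => by rw [vM2]; ring
    rw [h3, h2, h5, h1]; ring
  rw [h4]
  have h6 : |∑ n ∈ upTo x, (vM n - 1) * log (x / n)| ≤ 2 * (C + 1) * x := by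
    refine (Finset.abs_sum_le_sum_abs _ _).trans (le_trans (Finset.sum_le_sum fun n hn =>
      le_of_eq ?_) (sum_mul_log_div_le (b := fun n => |vM n - 1|) (fun _ _ => abs_nonneg _) hb hx))
    rw [abs_mul, abs_of_nonneg (log_nonneg (one_le_div_of_mem_upTo hn))]
  have h7 := hsel x (by linarith)
  refine (abs_add_le _ _).trans ?_
  linarith

/-- Truncation of `y` to `[-α, α]`. -/
noncomputable def clip (α y : ℝ) : ℝ := max (-α) (min α y)

lemma abs_clip_le {α : ℝ} (hα : 0 ≤ α) (y : ℝ) : |clip α y| ≤ α := by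
  rw [abs_le]
  exact ⟨le_max_left _ _, max_le (by linarith) (min_le_left _ _)⟩

lemma clip_of_abs_le {α y : ℝ} (h : |y| ≤ α) : clip α y = y := by
  rw [clip, min_eq_right (abs_le.1 h).2, max_eq_right (abs_le.1 h).1]

lemma clip_neg {α : ℝ} (hα : 0 ≤ α) (y : ℝ) : clip α (-y) = -clip α y := by
  have h3 : -α ≤ α := by linarith
  simp only [clip]
  rcases le_total α y with h | h <;> rcases le_total (-α) y with h' | h' <;>
  rcases le_total α (-y) with h1 | h1 <;> rcases le_total (-α) (-y) with h2 | h2 <;>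
  simp only [min_eq_left, min_eq_right, max_eq_left, max_eq_right, h, h', h1, h2, h3] <;> linarith

lemma clip_nonneg {α y : ℝ} (hα : 0 ≤ α) (hy : 0 ≤ y) : 0 ≤ clip α y :=
  le_max_of_le_right (le_min hα hy)

lemma clip_le_self {α y : ℝ} (hα : 0 ≤ α) (hy : 0 ≤ y) : clip α y ≤ y :=
  max_le (by linarith) (min_le_right _ _)

lemma clip_nonpos {α y : ℝ} (hα : 0 ≤ α) (hy : y ≤ 0) : clip α y ≤ 0 :=
  max_le (by linarith) (min_le_of_right_le hy)

lemma mul_clip {t : ℝ} (ht : 0 ≤ t) (α y : ℝ) : t * clip α y = clip (t * α) (t * y) := by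
  rw [clip, clip, mul_max_of_nonneg _ _ ht, mul_min_of_nonneg _ _ ht, mul_neg]

lemma abs_clip_sub_clip_le (α β u v : ℝ) : |clip α u - clip β v| ≤ |u - v| + |α - β| := by
  have h1 := abs_max_sub_max_le_max (-α) (min α u) (-β) (min β v)
  have h2 := abs_min_sub_min_le_max α u β v
  have h3 : |-α - -β| = |α - β| := by rw [neg_sub_neg, abs_sub_comm]
  rw [h3] at h1
  have h4 := abs_nonneg (u - v)
  have h5 := abs_nonneg (α - β)
  refine h1.trans (max_le (by linarith) (h2.trans (max_le (by linarith) (by linarith))))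

lemma measurable_clip (α : ℝ) : Measurable (clip α) :=
  measurable_const.max (measurable_const.min measurable_id)

lemma clip_defect_aux {α L k x y : ℝ} (hα : 0 ≤ α) (hk : |k| ≤ L) :
    L * (|clip α x * clip α y| - clip α x * clip α y)
      ≤ 2 * α * ((L * |x| - k * x) + (L * |y| - k * y)) := by
  have hL : 0 ≤ L := (abs_nonneg k).trans hk
  have nn : ∀ z, 0 ≤ L * |z| - k * z := fun z => by
    have : k * z ≤ |k| * |z| := (le_abs_self _).trans (abs_mul _ _).le
    nlinarith [mul_le_mul_of_nonneg_right hk (abs_nonneg z)]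
  have rhs : 0 ≤ 2 * α * ((L * |x| - k * x) + (L * |y| - k * y)) :=
    mul_nonneg (by linarith) (add_nonneg (nn x) (nn y))
  have main : ∀ x y, 0 ≤ x → y ≤ 0 → L * (|clip α x * clip α y| - clip α x * clip α y)
      ≤ 2 * α * ((L * |x| - k * x) + (L * |y| - k * y)) := by
    intro x y hx hy
    have a1 := clip_nonneg hα hx
    have a2 := clip_nonneg hα (neg_nonneg.2 hy)
    have a3 := clip_le_self hα hx
    have a4 := clip_le_self hα (neg_nonneg.2 hy)
    have a5 := (le_abs_self _).trans (abs_clip_le hα x)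
    have a6 := (le_abs_self _).trans (abs_clip_le hα (-y))
    rw [clip_neg hα] at a2 a4 a6
    rw [abs_of_nonpos (by nlinarith : clip α x * clip α y ≤ 0)]
    have b1 : clip α x * -clip α y ≤ α * x := by nlinarith
    have b2 : clip α x * -clip α y ≤ α * (-y) := by nlinarith
    rcases le_total 0 k with hk0 | hk0
    · have c1 := nn x
      rw [abs_of_nonpos hy]
      have c2 : 0 ≤ α * (L * |x| - k * x) := mul_nonneg hα c1
      have c3 : 0 ≤ α * (k * -y) := mul_nonneg hα (mul_nonneg hk0 (by linarith))
      have c4 := mul_le_mul_of_nonneg_left b2 hL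
      nlinarith
    · have c1 := nn y
      rw [abs_of_nonneg hx]
      have c2 : 0 ≤ α * (L * |y| - k * y) := mul_nonneg hα c1
      have c3 : 0 ≤ α * (-k * x) := mul_nonneg hα (mul_nonneg (by linarith) hx)
      have c4 := mul_le_mul_of_nonneg_left b1 hL
      nlinarith
  rcases le_total 0 x with hx | hx <;> rcases le_total 0 y with hy | hy
  · rw [abs_of_nonneg (mul_nonneg (clip_nonneg hα hx) (clip_nonneg hα hy)), sub_self, mul_zero]
    exact rhs
  · exact main x y hx hy
  · have := main y x hy hx
    rw [mul_comm (clip α y)] at this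
    linarith
  · rw [abs_of_nonneg (mul_nonneg_of_nonpos_of_nonpos (clip_nonpos hα hx) (clip_nonpos hα hy)),
      sub_self, mul_zero]
    exact rhs

lemma clip_defect {α L k x y s s' : ℝ} (hα : 0 ≤ α) (hk : |k| ≤ L) (hs : s = 1 ∨ s = -1)
    (hs' : s' = 1 ∨ s' = -1) :
    L * (|clip α x * clip α y| - s * s' * (clip α x * clip α y))
      ≤ 2 * α * ((L * |x| - s * (k * x)) + (L * |y| - s' * (k * y))) := by
  have cs : ∀ s z, (s = 1 ∨ s = -1) → clip α (s * z) = s * clip α z := by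
    rintro s z (rfl | rfl) <;> simp [clip_neg hα]
  have as : ∀ s z : ℝ, (s = 1 ∨ s = -1) → |s * z| = |z| := by
    rintro s z (rfl | rfl) <;> simp
  have := clip_defect_aux (x := s * x) (y := s' * y) hα hk
  rw [cs s x hs, cs s' y hs', as s x hs, as s' y hs'] at this
  have e : |s * clip α x * (s' * clip α y)| = |clip α x * clip α y| := by
    rw [mul_mul_mul_comm, mul_assoc s s', as s _ hs, as s' _ hs']
  rw [e] at this
  linarith

/-- The loss in the triangle inequality for the twisted Selberg sum. -/
noncomputable def loss (a φ : ℕ → ℝ) (r : ℝ) : ℝ :=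
  ∑ n ∈ upTo (exp r), vM2 n / n * |meanVal a (r - log n)|
    - |∑ n ∈ upTo (exp r), twist φ n / n * meanVal a (r - log n)|

lemma exists_sign_loss (a φ : ℕ → ℝ) (r : ℝ) : ∃ s : ℝ, (s = 1 ∨ s = -1) ∧
    loss a φ r = ∑ n ∈ upTo (exp r), (vM2 n * |meanVal a (r - log n)|
      - s * (twist φ n * meanVal a (r - log n))) / n := by
  obtain ⟨s, hs, h⟩ : ∃ s : ℝ, (s = 1 ∨ s = -1) ∧
      |∑ n ∈ upTo (exp r), twist φ n / n * meanVal a (r - log n)|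
        = s * ∑ n ∈ upTo (exp r), twist φ n / n * meanVal a (r - log n) := by
    rcases abs_choice (∑ n ∈ upTo (exp r), twist φ n / n * meanVal a (r - log n)) with h | h
    · exact ⟨1, Or.inl rfl, by rw [h, one_mul]⟩
    · exact ⟨-1, Or.inr rfl, by rw [h]; ring⟩
  refine ⟨s, hs, ?_⟩
  rw [loss, h, Finset.mul_sum, ← Finset.sum_sub_distrib]
  exact Finset.sum_congr rfl fun n _ => by ring

lemma abs_sign_mul_twist_le {a φ : ℕ → ℝ} {K : ℝ} (h : MulLike a φ K) {s : ℝ}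
    (hs : s = 1 ∨ s = -1) (n : ℕ) (y : ℝ) : 0 ≤ vM2 n * |y| - s * (twist φ n * y) := by
  have h1 : s * (twist φ n * y) ≤ |twist φ n| * |y| := by
    rw [← abs_mul]
    rcases hs with rfl | rfl
    · linarith [le_abs_self (twist φ n * y)]
    · linarith [neg_le_abs (twist φ n * y)]
  nlinarith [mul_le_mul_of_nonneg_right (abs_twist_le h.abs_le_one n) (abs_nonneg y)]

/-- Test function detecting sign changes of `y q * y (q + h)` relative to `c`. -/
noncomputable def signTest (y : ℝ → ℝ) (c h q : ℝ) : ℝ :=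
  |y q * y (q + h)| - c * (y q * y (q + h))

lemma signTest_nonneg (y : ℝ → ℝ) {c : ℝ} (hc : c = 1 ∨ c = -1) (h q : ℝ) :
    0 ≤ signTest y c h q := by
  rcases hc with rfl | rfl
  · have := le_abs_self (y q * y (q + h))
    simp only [signTest]; linarith
  · have := neg_le_abs (y q * y (q + h))
    simp only [signTest]; linarith

lemma signTest_le {y : ℝ → ℝ} {c α : ℝ} (hc : c = 1 ∨ c = -1) (hy : ∀ q, |y q| ≤ α) (h q : ℝ) :
    signTest y c h q ≤ 2 * α ^ 2 := by
  have h1 : |y q * y (q + h)| ≤ α ^ 2 := by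
    rw [abs_mul, sq]
    exact mul_le_mul (hy _) (hy _) (abs_nonneg _) ((abs_nonneg _).trans (hy q))
  have h2 := abs_le.1 h1
  rcases hc with rfl | rfl <;> simp only [signTest] <;> linarith

lemma measurable_signTest {y : ℝ → ℝ} (hy : Measurable y) (c h : ℝ) :
    Measurable (signTest y c h) := by
  have h1 : Measurable fun q => y (q + h) := hy.comp (measurable_id.add_const h)
  exact (hy.mul h1).abs.sub ((hy.mul h1).const_mul c)

lemma sum_signTest_le_loss {a φ : ℕ → ℝ} {K α r h : ℝ} (hm : MulLike a φ K) (hα : 0 ≤ α)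
    (hh : 0 ≤ h) : ∃ c : ℝ, (c = 1 ∨ c = -1) ∧
      ∑ n ∈ upTo (exp r), vM2 n / n * signTest (fun q => clip α (meanVal a q)) c h (r - log n)
        ≤ 2 * α * (loss a φ r + loss a φ (r + h)) := by
  obtain ⟨s, hs, h1⟩ := exists_sign_loss a φ r
  obtain ⟨s', hs', h2⟩ := exists_sign_loss a φ (r + h)
  refine ⟨s * s', by rcases hs with rfl | rfl <;> rcases hs' with rfl | rfl <;> simp, ?_⟩
  have h3 : ∑ n ∈ upTo (exp r), (vM2 n * |meanVal a (r + h - log n)|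
      - s' * (twist φ n * meanVal a (r + h - log n))) / n ≤ loss a φ (r + h) := by
    rw [h2]
    refine Finset.sum_le_sum_of_subset_of_nonneg (upTo_subset (exp_le_exp.2 (by linarith)))
      fun n _ _ => div_nonneg (abs_sign_mul_twist_le hm hs' n _) (Nat.cast_nonneg n)
  calc _ ≤ ∑ n ∈ upTo (exp r), 2 * α * ((vM2 n * |meanVal a (r - log n)|
        - s * (twist φ n * meanVal a (r - log n))) / n + (vM2 n * |meanVal a (r + h - log n)|
        - s' * (twist φ n * meanVal a (r + h - log n))) / n) := by
        refine Finset.sum_le_sum fun n _ => ?_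
        have := clip_defect (x := meanVal a (r - log n)) (y := meanVal a (r + h - log n)) hα
          (abs_twist_le hm.abs_le_one n) hs hs'
        rw [signTest, sub_add_eq_add_sub, ← add_div, div_mul_eq_mul_div, mul_div_assoc']
        gcongr
    _ ≤ _ := by
        rw [← Finset.mul_sum, Finset.sum_add_distrib, ← h1]
        gcongr

lemma variation_signTest {a φ : ℕ → ℝ} {K α h c : ℝ} (hm : MulLike a φ K) (hα : 0 ≤ α)
    (hh : 0 ≤ h) (hc : c = 1 ∨ c = -1) :
    ∃ V : ℝ → ℝ, (∀ t, 1 ≤ t → 0 ≤ V t ∧ V t ≤ 2 * α * (2 * K + 3 * α) * t) ∧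
      ∀ s t, 1 ≤ s → s ≤ t →
        |t * signTest (fun q => clip α (meanVal a q)) c h (log t)
          - s * signTest (fun q => clip α (meanVal a q)) c h (log s)| ≤ V t - V s := by
  set A : ℝ → ℝ := fun t => summ (fun n => |a n|) t with hA
  have hl := exp_pos h
  have hl1 := one_le_exp hh
  refine ⟨fun t => 2 * α * (A t + A (exp h * t) / exp h + 3 * α * t), fun t ht => ?_,
    fun s t hs hst => ?_⟩
  · have b1 := hm.sum_abs_le t ht
    have b2 : A (exp h * t) / exp h ≤ K * t := by
      rw [div_le_iff₀ hl]
      refine (hm.sum_abs_le (exp h * t) (by nlinarith)).trans (le_of_eq (by ring))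
    have b3 : 0 ≤ A t := summ_abs_nonneg a t
    have b4 : 0 ≤ A (exp h * t) / exp h := div_nonneg (summ_abs_nonneg a _) hl.le
    refine ⟨by positivity, ?_⟩
    rw [mul_assoc]
    refine mul_le_mul_of_nonneg_left ?_ (by linarith)
    linarith
  set X : ℝ → ℝ := fun t => clip α (meanVal a (log t)) with hX
  set Y : ℝ → ℝ := fun t => clip α (meanVal a (log t + h)) with hY
  have hX' : ∀ t, 0 < t → t * X t = clip (t * α) (summ a t) := fun t ht => by
    rw [hX]; simp only [mul_clip ht.le, mul_meanVal_log a ht]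
  have hY' : ∀ t, 0 < t → t * Y t = clip (exp h * t * α) (summ a (exp h * t)) / exp h :=
    fun t ht => by
    have e : log t + h = log (exp h * t) := by
      rw [log_mul hl.ne' ht.ne', log_exp]; ring
    have e2 := mul_clip (by positivity : 0 ≤ exp h * t) α (meanVal a (log (exp h * t)))
    rw [mul_meanVal_log a (by positivity)] at e2
    rw [hY]; simp only [e]; rw [← e2]; field_simp
  have ht : 0 < t := by linarith
  have hs0 : 0 < s := by linarith
  have v1 : |t * X t - s * X s| ≤ A t - A s + α * (t - s) := by
    rw [hX' t ht, hX' s hs0]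
    refine (abs_clip_sub_clip_le _ _ _ _).trans (add_le_add (abs_summ_sub_le a hst) (le_of_eq ?_))
    rw [← sub_mul, abs_mul, abs_of_nonneg (by linarith : 0 ≤ t - s), abs_of_nonneg hα, mul_comm]
  have v2 : |t * Y t - s * Y s| ≤ A (exp h * t) / exp h - A (exp h * s) / exp h + α * (t - s) := by
    rw [hY' t ht, hY' s hs0, ← sub_div, abs_div, abs_of_pos hl, div_le_iff₀ hl]
    have hle : exp h * s ≤ exp h * t := by gcongr
    have e : |exp h * t * α - exp h * s * α| = exp h * (α * (t - s)) := by
      rw [← sub_mul, ← mul_sub, abs_mul, abs_mul, abs_of_pos hl,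
        abs_of_nonneg (by linarith : 0 ≤ t - s), abs_of_nonneg hα]; ring
    have e2 : (A (exp h * t) / exp h - A (exp h * s) / exp h + α * (t - s)) * exp h
        = A (exp h * t) - A (exp h * s) + exp h * (α * (t - s)) := by field_simp
    have e3 := abs_clip_sub_clip_le (exp h * t * α) (exp h * s * α) (summ a (exp h * t))
      (summ a (exp h * s))
    have e4 := abs_summ_sub_le a hle
    rw [e2]
    simp only [hA]
    linarith
  have bX : ∀ t, |X t| ≤ α := fun t => abs_clip_le hα _
  have bY : ∀ t, |Y t| ≤ α := fun t => abs_clip_le hα _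
  have v3 : |t * (X t * Y t) - s * (X s * Y s)| ≤ α * (A t - A s + α * (t - s))
      + α * (A (exp h * t) / exp h - A (exp h * s) / exp h + α * (t - s) + α * (t - s)) := by
    have e : t * (X t * Y t) - s * (X s * Y s)
        = Y t * (t * X t - s * X s) + X s * ((t * Y t - s * Y s) - (t - s) * Y t) := by ring
    rw [e]
    refine (abs_add_le _ _).trans (add_le_add ?_ ?_)
    · rw [abs_mul]
      exact mul_le_mul (bY t) v1 (abs_nonneg _) hα
    · rw [abs_mul]
      refine mul_le_mul (bX s) ((abs_sub _ _).trans (add_le_add v2 ?_)) (abs_nonneg _) hα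
      rw [abs_mul, abs_of_nonneg (by linarith : 0 ≤ t - s), mul_comm]
      exact mul_le_mul_of_nonneg_right (bY t) (by linarith)
  have e : ∀ t, 0 < t → t * signTest (fun q => clip α (meanVal a q)) c h (log t)
      = |t * (X t * Y t)| - c * (t * (X t * Y t)) := fun t ht => by
    rw [abs_mul, abs_of_pos ht]; simp only [signTest, hX, hY]; ring
  rw [e t ht, e s hs0]
  have v4 := abs_abs_sub_abs_le (t * (X t * Y t)) (s * (X s * Y s))
  have v5 : |c * (t * (X t * Y t)) - c * (s * (X s * Y s))|
      = |t * (X t * Y t) - s * (X s * Y s)| := by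
    rw [← mul_sub, abs_mul]; rcases hc with rfl | rfl <;> simp
  have v6 := abs_sub (|t * (X t * Y t)| - |s * (X s * Y s)|)
    (c * (t * (X t * Y t)) - c * (s * (X s * Y s)))
  rw [v5] at v6
  have e2 : |t * (X t * Y t)| - c * (t * (X t * Y t)) - (|s * (X s * Y s)| - c * (s * (X s * Y s)))
    = |t * (X t * Y t)| - |s * (X s * Y s)| - (c * (t * (X t * Y t)) - c * (s * (X s * Y s))) := by
    ring
  rw [e2]
  linarith

/-- If the autocorrelations of `h` are nearly nonnegative, then `h` nearly has constant sign. -/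
lemma sq_integral_abs_sub_le {h : ℝ → ℝ} (hi : Integrable h) {A T β : ℝ}
    (hT : 0 ≤ T) (hs : ∀ q, h q ≠ 0 → A ≤ q ∧ q ≤ A + T)
    (hJ : ∀ u, 0 ≤ u → u ≤ T → ∫ q, (|h q * h (q + u)| - h q * h (q + u)) ≤ β) :
    (∫ q, |h q|) ^ 2 - (∫ q, h q) ^ 2 ≤ 2 * T * β := by
  have hprod : Integrable (fun z : ℝ × ℝ => h z.1 * h z.2) (volume.prod volume) := hi.mul_prod hi
  set k : ℝ × ℝ → ℝ := fun z => |h z.1 * h z.2| - h z.1 * h z.2 with hk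
  have hkint : Integrable k (volume.prod volume) := hprod.abs.sub hprod
  have mp : MeasurePreserving (fun z : ℝ × ℝ => (z.1, z.1 + z.2)) (volume.prod volume)
    (volume.prod volume) := measurePreserving_prod_add volume volume
  have hcomp : Integrable (fun z : ℝ × ℝ => k (z.1, z.1 + z.2)) (volume.prod volume) :=
    (mp.integrable_comp hkint.aestronglyMeasurable).2 hkint
  set J : ℝ → ℝ := fun u => ∫ q, (|h q * h (q + u)| - h q * h (q + u)) with hJdef
  have hJint : Integrable J := hcomp.integral_prod_right
  have e1 : ∫ z, k z ∂(volume.prod volume) = (∫ q, |h q|) ^ 2 - (∫ q, h q) ^ 2 := by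
    simp only [hk]
    rw [integral_sub hprod.abs hprod, integral_prod_mul h h, sq, sq]
    simp only [abs_mul]
    rw [integral_prod_mul (fun q => |h q|) (fun q => |h q|)]
  have e2 : ∫ z, k z ∂(volume.prod volume) = ∫ u, J u := by
    have : ∫ z : ℝ × ℝ, k (z.1, z.1 + z.2) ∂(volume.prod volume)
        = ∫ z, k z ∂(volume.prod volume) := by
      have := integral_map (μ := (volume : Measure ℝ).prod volume) mp.measurable.aemeasurable
        (f := k) (by rw [mp.map_eq]; exact hkint.aestronglyMeasurable)
      rw [mp.map_eq] at this
      exact this.symm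
    rw [← this, integral_prod_symm _ hcomp]
  have hJneg : ∀ u, J (-u) = J u := fun u => by
    simp only [hJdef]
    rw [← integral_add_right_eq_self _ u]
    refine integral_congr_ae (Filter.Eventually.of_forall fun q => ?_)
    simp only [add_neg_cancel_right, mul_comm]
  have hJ0 : ∀ u, T < u → J u = 0 := fun u hu => by
    have : ∀ q, |h q * h (q + u)| - h q * h (q + u) = 0 := fun q => by
      have : h q * h (q + u) = 0 := by
        by_contra hne
        have h1 := hs q (left_ne_zero_of_mul hne)
        have h2 := hs _ (right_ne_zero_of_mul hne)
        linarith [h1.1, h2.2]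
      rw [this, abs_zero, sub_zero]
    simp only [hJdef, this, integral_zero]
  have hle : ∀ u, J u ≤ (Set.Icc (-T) T).indicator (fun _ => β) u := fun u => by
    by_cases hu : u ∈ Set.Icc (-T) T
    · rw [Set.indicator_of_mem hu]
      rcases le_total 0 u with h0 | h0
      · exact hJ u h0 hu.2
      · rw [← hJneg]; exact hJ (-u) (by linarith) (by linarith [hu.1])
    · rw [Set.indicator_of_notMem hu]
      rw [Set.mem_Icc, not_and_or, not_le, not_le] at hu
      rcases hu with hu | hu
      · rw [← hJneg, hJ0 _ (by linarith)]
      · rw [hJ0 _ hu]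
  rw [← e1, e2]
  calc ∫ u, J u ≤ ∫ u, (Set.Icc (-T) T).indicator (fun _ => β) u :=
        integral_mono hJint ((integrable_indicator_iff measurableSet_Icc).2
          (integrableOn_const (by simp))) hle
    _ = 2 * T * β := by
        rw [integral_indicator measurableSet_Icc, setIntegral_const, smul_eq_mul,
          Measure.real, Real.volume_Icc, ENNReal.toReal_ofReal (by linarith)]
        ring

lemma le_integral_of_autocorr {H : ℝ → ℝ} {K κ R α ε : ℝ} (hm : Measurable H)
    (hK : ∀ q, |H q| ≤ K) (hκ : 0 ≤ κ) (hκ' : κ ≤ 1 / 32) (hR : 0 < R) (hα : 0 < α)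
    (hε : 0 ≤ ε) (hε' : ε ≤ 1 / 10 ^ 6)
    (h0 : ∫ q in (0 : ℝ)..(κ * R), |H q| ≤ ε * α * R)
    (h1 : ∫ q in (κ * R)..(3 * R / 4), (α - |H q|) ≤ 8 * ε * α * R)
    (hle : ∀ q, κ * R ≤ q → q ≤ R → |H q| ≤ α)
    (hJ : ∀ u, 0 ≤ u → u ≤ R / 4 →
      ∫ q in (κ * R)..(R / 4), (|H q * H (q + u)| - H q * H (q + u)) ≤ 2184 * ε * α ^ 2 * R)
    (hpos : 0 ≤ ∫ q in (κ * R)..(R / 4), H q) {r : ℝ} (hr : R / 8 ≤ r) (hr' : r ≤ R / 4) :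
    α * R / 32 ≤ ∫ q in (0 : ℝ)..r, H q := by
  have hκR : κ * R ≤ R / 32 := by nlinarith
  have hκR0 : 0 ≤ κ * R := by positivity
  have iH := intervalIntegrable_of_bdd hm hK
  have iA : ∀ a b, IntervalIntegrable (fun q => |H q|) volume a b :=
    intervalIntegrable_of_bdd hm.abs (K := K) (fun q => by rw [abs_abs]; exact hK q)
  have iD : ∀ a b, IntervalIntegrable (fun q => α - |H q|) volume a b := fun a b =>
    intervalIntegrable_const.sub (iA a b)
  have iS : ∀ a b, IntervalIntegrable (fun q => |H q| - H q) volume a b := fun a b =>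
    (iA a b).sub (iH a b)
  have hle4 : κ * R ≤ R / 4 := by linarith
  set h : ℝ → ℝ := (Set.Ioc (κ * R) (R / 4)).indicator H with hh
  have hhi : Integrable h := (integrable_indicator_iff measurableSet_Ioc).2
    ((intervalIntegrable_iff_integrableOn_Ioc_of_le hle4).1 (iH _ _))
  have habs : ∀ q, |h q| = (Set.Ioc (κ * R) (R / 4)).indicator (fun q => |H q|) q := fun q => by
    by_cases hq : q ∈ Set.Ioc (κ * R) (R / 4) <;> simp [hh, hq]
  have main := sq_integral_abs_sub_le hhi (A := κ * R) (T := R / 4)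
    (β := 2184 * ε * α ^ 2 * R) (by linarith) (fun q hq => by
      have := Set.mem_of_indicator_ne_zero hq
      exact ⟨this.1.le, by linarith [this.2]⟩) (fun u hu hu' => by
      refine le_trans ?_ (hJ u hu hu')
      have iJ : IntervalIntegrable (fun q => |H q * H (q + u)| - H q * H (q + u)) volume
          (κ * R) (R / 4) := by
        have hmu : Measurable fun q => H q * H (q + u) :=
          hm.mul (hm.comp (measurable_id.add_const u))
        have hb : ∀ q, |H q * H (q + u)| ≤ K * K := fun q => by
          rw [abs_mul]; exact mul_le_mul (hK _) (hK _) (abs_nonneg _) ((abs_nonneg _).trans (hK q))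
        exact (intervalIntegrable_of_bdd hmu.abs (K := K * K)
          (fun q => by rw [abs_abs]; exact hb q) _ _).sub (intervalIntegrable_of_bdd hmu hb _ _)
      rw [intervalIntegral.integral_of_le hle4, ← integral_indicator measurableSet_Ioc]
      have nn : ∀ y : ℝ, 0 ≤ |y| - y := fun y => by linarith [le_abs_self y]
      refine integral_mono_of_nonneg (Filter.Eventually.of_forall fun q => nn _)
        ((integrable_indicator_iff measurableSet_Ioc).2
          ((intervalIntegrable_iff_integrableOn_Ioc_of_le hle4).1 iJ))
        (Filter.Eventually.of_forall fun q => ?_)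
      by_cases hq : q ∈ Set.Ioc (κ * R) (R / 4)
      · by_cases hq' : q + u ∈ Set.Ioc (κ * R) (R / 4)
        · simp only [hh, Set.indicator_of_mem hq, Set.indicator_of_mem hq']; exact le_rfl
        · simp only [hh, Set.indicator_of_mem hq, Set.indicator_of_notMem hq', mul_zero, abs_zero,
            sub_zero]
          exact nn _
      · simp only [hh, Set.indicator_of_notMem hq, zero_mul, abs_zero, sub_zero]; exact le_rfl)
  simp only [habs] at main
  rw [hh, integral_indicator measurableSet_Ioc, integral_indicator measurableSet_Ioc,
    ← intervalIntegral.integral_of_le hle4, ← intervalIntegral.integral_of_le hle4] at main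
  set I := ∫ q in (κ * R)..(R / 4), |H q| with hI
  set p := ∫ q in (κ * R)..(R / 4), H q with hp
  have hsub : ∀ b, κ * R ≤ b → b ≤ 3 * R / 4 →
      ∫ q in (κ * R)..b, (α - |H q|) ≤ 8 * ε * α * R := fun b hb hb' => by
    refine le_trans (intervalIntegral.integral_mono_interval le_rfl hb hb' ?_ (iD _ _)) h1
    refine (ae_restrict_iff' measurableSet_Ioc).2 (Filter.Eventually.of_forall fun q hq => ?_)
    exact sub_nonneg.2 (hle q hq.1.le (by linarith [hq.2]))
  have hmass : ∀ b, κ * R ≤ b → b ≤ 3 * R / 4 →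
      α * (b - κ * R) - 8 * ε * α * R ≤ ∫ q in (κ * R)..b, |H q| := fun b hb hb' => by
    have := hsub b hb hb'
    rw [intervalIntegral.integral_sub intervalIntegrable_const (iA _ _),
      intervalIntegral.integral_const, smul_eq_mul] at this
    linarith
  have hαR : 0 < α * R := by positivity
  have hεαR : ε * (α * R) ≤ 1 / 10 ^ 6 * (α * R) := mul_le_mul_of_nonneg_right hε' hαR.le
  have hIlow : α * R / 8 ≤ I := by
    have := hmass (R / 4) hle4 (by linarith)
    nlinarith
  have hdef : I - p ≤ 8736 * ε * α * R := by
    have h3 : (I - p) * (I + p) ≤ 8736 * ε * α * R * (α * R / 8) := by nlinarith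
    by_contra hc
    push Not at hc
    have h4 : 0 ≤ 8736 * ε * α * R := by positivity
    have h5 : 8736 * ε * α * R * (α * R / 8) < (I - p) * (I + p) :=
      calc _ ≤ 8736 * ε * α * R * (I + p) := mul_le_mul_of_nonneg_left (by linarith) h4
        _ < _ := mul_lt_mul_of_pos_right hc (by linarith [mul_pos hα hR])
    linarith
  have hrκ : κ * R ≤ r := by linarith
  have hdefr : ∫ q in (κ * R)..r, (|H q| - H q) ≤ 8736 * ε * α * R := by
    have : ∫ q in (κ * R)..r, (|H q| - H q) ≤ ∫ q in (κ * R)..(R / 4), (|H q| - H q) := by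
      refine intervalIntegral.integral_mono_interval le_rfl hrκ hr' ?_ (iS _ _)
      exact Filter.Eventually.of_forall fun q => sub_nonneg.2 (le_abs_self _)
    rw [intervalIntegral.integral_sub (iA (κ * R) (R / 4)) (iH _ _)] at this
    linarith
  rw [intervalIntegral.integral_sub (iA _ _) (iH _ _)] at hdefr
  have hmr := hmass r hrκ (by linarith)
  have hlow : -(ε * α * R) ≤ ∫ q in (0 : ℝ)..(κ * R), H q := by
    have := intervalIntegral.abs_integral_le_integral_abs (f := H) (μ := volume) hκR0
    have := neg_abs_le (∫ q in (0 : ℝ)..(κ * R), H q)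
    linarith
  rw [← intervalIntegral.integral_add_adjacent_intervals (iH 0 (κ * R)) (iH (κ * R) r)]
  nlinarith [mul_le_mul_of_nonneg_left hκR hα.le, mul_le_mul_of_nonneg_left hr hα.le]

/-- The absolute mean value of `a` nearly attains its supremum `α` over `[κ R, R]` at `R`, and has
small integral over `[0, κ R]`. -/
structure NearMax (a : ℕ → ℝ) (ε κ R α : ℝ) : Prop where
  ε_pos : 0 < ε
  ε_le : ε ≤ 1 / 10 ^ 6
  κ_nonneg : 0 ≤ κ
  κ_le : κ ≤ 1 / 32
  one_le : 1 ≤ R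
  α_pos : 0 < α
  abs_le : ∀ q, κ * R ≤ q → q ≤ R → |meanVal a q| ≤ α
  le_abs : (1 - ε) * α ≤ |meanVal a R|
  integral_le : ∫ q in (0 : ℝ)..(κ * R), |meanVal a q| ≤ ε * α * R

lemma MulLike.intervalIntegrable_abs {a φ : ℕ → ℝ} {K : ℝ} (h : MulLike a φ K) (s t : ℝ) :
    IntervalIntegrable (fun q => |meanVal a q|) volume s t :=
  intervalIntegrable_of_bdd (measurable_meanVal a).abs (K := K)
    (fun q => by rw [abs_abs]; exact h.abs_meanVal_le q) _ _

lemma MulLike.intervalIntegrable {a φ : ℕ → ℝ} {K : ℝ} (h : MulLike a φ K) (s t : ℝ) :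
    IntervalIntegrable (meanVal a) volume s t :=
  intervalIntegrable_of_bdd (measurable_meanVal a) h.abs_meanVal_le _ _

lemma MulLike.loss_nonneg {a φ : ℕ → ℝ} {K : ℝ} (h : MulLike a φ K) (r : ℝ) : 0 ≤ loss a φ r := by
  obtain ⟨s, hs, e⟩ := exists_sign_loss a φ r
  rw [e]
  exact Finset.sum_nonneg fun n _ =>
    div_nonneg (abs_sign_mul_twist_le h hs n _) (Nat.cast_nonneg n)

lemma exists_loss_le : ∃ C : ℝ, 1 ≤ C ∧ ∀ (a φ : ℕ → ℝ) (K ε κ R α : ℝ), MulLike a φ K →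
    NearMax a ε κ R α → C * K ≤ ε * α * R → ∀ r, κ * R ≤ r → r ≤ R →
    loss a φ r + 2 * (∫ q in (κ * R)..r, (r - q) * (α - |meanVal a q|))
      ≤ r ^ 2 * (α - |meanVal a r|) + 3 * ε * α * R ^ 2 := by
  obtain ⟨C1, hC1, h1⟩ := exists_second_iterate
  obtain ⟨C2, hC2, h2⟩ := exists_abs_meanVal_iterate
  refine ⟨2 * (C1 + C2), by linarith, fun a φ K ε κ R α hm hb hCK r hr hrR => ?_⟩
  have hR := hb.one_le
  have hκR : 0 ≤ κ * R := mul_nonneg hb.κ_nonneg (by linarith)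
  have hr0 : 0 ≤ r := hκR.trans hr
  have h1 := h1 a φ K hm r hr0
  have h2 := h2 a φ K hm r hr0
  have iA := hm.intervalIntegrable_abs
  have iM : ∀ s t, IntervalIntegrable (fun q => (r - q) * |meanVal a q|) volume s t := fun s t =>
    (iA s t).continuousOn_mul (by fun_prop)
  have iM' : ∀ s t, IntervalIntegrable (fun q => (r - q) * (α - |meanVal a q|)) volume s t :=
    fun s t => (intervalIntegrable_const.sub (iA s t)).continuousOn_mul (by fun_prop)
  have e1 : ∫ q in (κ * R)..r, (r - q) * |meanVal a q| = α * (r - κ * R) ^ 2 / 2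
      - ∫ q in (κ * R)..r, (r - q) * (α - |meanVal a q|) := by
    have : ∫ q in (κ * R)..r, (r - q) * α = α * (r - κ * R) ^ 2 / 2 := by
      rw [intervalIntegral.integral_mul_const,
        intervalIntegral.integral_comp_sub_left (fun q => q) r, sub_self, integral_id]
      ring
    rw [← this, ← intervalIntegral.integral_sub
      ((by fun_prop : Continuous fun q : ℝ => (r - q) * α).intervalIntegrable _ _) (iM' _ _)]
    exact intervalIntegral.integral_congr fun q _ => by ring
  have e2 : ∫ q in (0 : ℝ)..(κ * R), (r - q) * |meanVal a q| ≤ R * (ε * α * R) := by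
    refine le_trans ?_ (mul_le_mul_of_nonneg_left hb.integral_le (by linarith))
    rw [← intervalIntegral.integral_const_mul]
    refine intervalIntegral.integral_mono_on hκR (iM _ _) ((iA _ _).const_mul R) fun q hq => ?_
    exact mul_le_mul_of_nonneg_right (by linarith [hq.1]) (abs_nonneg _)
  rw [← intervalIntegral.integral_add_adjacent_intervals (iM 0 (κ * R)) (iM _ _), e1] at h2
  have hK := hm.nonneg
  have hα := hb.α_pos
  have hε := hb.ε_pos
  have e3 : α * (r - κ * R) ^ 2 ≤ α * r ^ 2 :=
    mul_le_mul_of_nonneg_left (by nlinarith) hα.le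
  have e4 : (C1 + C2) * K * (r + 1) ≤ ε * α * R ^ 2 := by
    have : (C1 + C2) * K * (r + 1) ≤ (C1 + C2) * K * (2 * R) :=
      mul_le_mul_of_nonneg_left (by linarith) (mul_nonneg (by linarith) hK)
    have := mul_le_mul_of_nonneg_right hCK (by linarith : 0 ≤ R)
    nlinarith
  have e5 := (abs_le.1 h2).2
  have e6 : r ^ 2 * |meanVal a r| ≤ |∑ n ∈ upTo (exp r), twist φ n / n * meanVal a (r - log n)|
      + C1 * K * (r + 1) := by
    have := abs_sub_abs_le_abs_sub (r ^ 2 * meanVal a r)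
      (∑ n ∈ upTo (exp r), twist φ n / n * meanVal a (r - log n))
    rw [abs_mul, abs_of_nonneg (sq_nonneg r)] at this
    linarith
  rw [loss]
  nlinarith

/-- The conclusion of `exists_loss_le`. -/
def LossBound (a φ : ℕ → ℝ) (ε κ R α : ℝ) : Prop := ∀ r, κ * R ≤ r → r ≤ R →
    loss a φ r + 2 * (∫ q in (κ * R)..r, (r - q) * (α - |meanVal a q|))
      ≤ r ^ 2 * (α - |meanVal a r|) + 3 * ε * α * R ^ 2

section
variable {a φ : ℕ → ℝ} {K ε κ R α : ℝ}

lemma NearMax.integral_defect_le (hm : MulLike a φ K) (hb : NearMax a ε κ R α)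
    (hl : LossBound a φ ε κ R α) :
    ∫ q in (κ * R)..(3 * R / 4), (α - |meanVal a q|) ≤ 8 * ε * α * R := by
  have hR := hb.one_le
  have hκR : κ * R ≤ R / 32 := by nlinarith [hb.κ_le]
  have h1 := hl R (by linarith) le_rfl
  have h2 := hm.loss_nonneg R
  have iA := hm.intervalIntegrable_abs
  have iD : ∀ s t, IntervalIntegrable (fun q => α - |meanVal a q|) volume s t := fun s t =>
    intervalIntegrable_const.sub (iA s t)
  have iM : ∀ s t, IntervalIntegrable (fun q => (R - q) * (α - |meanVal a q|)) volume s t :=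
    fun s t => (iD s t).continuousOn_mul (by fun_prop)
  have h3 : R / 4 * (∫ q in (κ * R)..(3 * R / 4), (α - |meanVal a q|))
      ≤ ∫ q in (κ * R)..R, (R - q) * (α - |meanVal a q|) := by
    rw [← intervalIntegral.integral_const_mul]
    refine (intervalIntegral.integral_mono_on (by linarith) ((iD _ _).const_mul _) (iM _ _)
      fun q hq => mul_le_mul_of_nonneg_right (by linarith [hq.2])
        (sub_nonneg.2 (hb.abs_le q hq.1 (by linarith [hq.2])))).trans ?_
    refine intervalIntegral.integral_mono_interval le_rfl (by linarith) (by linarith) ?_ (iM _ _)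
    refine (ae_restrict_iff' measurableSet_Ioc).2 (Filter.Eventually.of_forall fun q hq => ?_)
    exact mul_nonneg (by linarith [hq.2]) (sub_nonneg.2 (hb.abs_le q hq.1.le hq.2))
  have h4 := mul_le_mul_of_nonneg_left hb.le_abs (sq_nonneg R)
  have h5 : R / 4 * (∫ q in (κ * R)..(3 * R / 4), (α - |meanVal a q|))
      ≤ R / 4 * (8 * ε * α * R) := by nlinarith
  exact le_of_mul_le_mul_left h5 (by linarith)

lemma NearMax.integral_shift_defect_le (hm : MulLike a φ K) (hb : NearMax a ε κ R α)
    (hl : LossBound a φ ε κ R α) {s t u : ℝ} (hu : 0 ≤ u) (hs : κ * R ≤ s) (hst : s ≤ t)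
    (ht : t + u ≤ 3 * R / 4) :
    ∫ q in s..t, (α - |meanVal a (q + u)|) ≤ 8 * ε * α * R := by
  rw [intervalIntegral.integral_comp_add_right (fun q => α - |meanVal a q|) u]
  refine le_trans (intervalIntegral.integral_mono_interval (by linarith) (by linarith) ht ?_
    (intervalIntegrable_const.sub (hm.intervalIntegrable_abs _ _)))
    (hb.integral_defect_le hm hl)
  refine (ae_restrict_iff' measurableSet_Ioc).2 (Filter.Eventually.of_forall fun q hq => ?_)
  exact sub_nonneg.2 (hb.abs_le q hq.1.le (by linarith [hq.2, hb.one_le]))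

lemma NearMax.exists_loss_add_loss_le (hm : MulLike a φ K) (hb : NearMax a ε κ R α)
    (hl : LossBound a φ ε κ R α) {h : ℝ} (hh : 0 ≤ h) (hh' : h ≤ R / 8) :
    ∃ r, R / 2 ≤ r ∧ r ≤ 5 * R / 8 ∧ loss a φ r + loss a φ (r + h) ≤ 135 * ε * α * R ^ 2 := by
  have hR := hb.one_le
  have hα := hb.α_pos
  have hε := hb.ε_pos
  have hκR : κ * R ≤ R / 32 := by nlinarith [hb.κ_le]
  have iD : ∀ u s t, IntervalIntegrable (fun q => α - |meanVal a (q + u)|) volume s t :=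
    fun u s t => intervalIntegrable_const.sub (intervalIntegrable_of_bdd (K := K)
      ((measurable_meanVal a).comp (measurable_id.add_const u)).abs
      (fun q => by rw [abs_abs]; exact hm.abs_meanVal_le _) _ _)
  obtain ⟨r, hr1, hr2, hr3⟩ : ∃ r, R / 2 ≤ r ∧ r ≤ 5 * R / 8 ∧
      (α - |meanVal a r|) + (α - |meanVal a (r + h)|) ≤ 129 * ε * α := by
    by_contra hc
    push Not at hc
    have h1 := hb.integral_shift_defect_le hm hl (s := R / 2) (t := 5 * R / 8) le_rfl
      (by linarith) (by linarith) (by linarith)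
    have h2 := hb.integral_shift_defect_le hm hl (s := R / 2) (t := 5 * R / 8) hh
      (by linarith) (by linarith) (by linarith)
    have h3 : ∫ q in (R / 2)..(5 * R / 8), 129 * ε * α
        ≤ ∫ q in (R / 2)..(5 * R / 8), ((α - |meanVal a (q + 0)|) + (α - |meanVal a (q + h)|)) :=
      intervalIntegral.integral_mono_on (by linarith) intervalIntegrable_const
        ((iD 0 _ _).add (iD h _ _)) fun q hq => by rw [add_zero]; exact (hc q hq.1 hq.2).le
    rw [intervalIntegral.integral_add (iD 0 _ _) (iD h _ _), intervalIntegral.integral_const,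
      smul_eq_mul] at h3
    have h4 : 0 < ε * α * R := by positivity
    nlinarith
  refine ⟨r, hr1, hr2, ?_⟩
  have nn : ∀ r, κ * R ≤ r → r ≤ R →
      0 ≤ ∫ q in (κ * R)..r, (r - q) * (α - |meanVal a q|) := fun r h1 h2 =>
    intervalIntegral.integral_nonneg h1 fun q hq =>
      mul_nonneg (by linarith [hq.2]) (sub_nonneg.2 (hb.abs_le q hq.1 (hq.2.trans h2)))
  have l1 := hl r (by linarith) (by linarith)
  have l2 := hl (r + h) (by linarith) (by linarith)
  have n1 := nn r (by linarith) (by linarith)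
  have n2 := nn (r + h) (by linarith) (by linarith)
  have d1 : r ^ 2 * (α - |meanVal a r|) ≤ R ^ 2 * (α - |meanVal a r|) :=
    mul_le_mul_of_nonneg_right (by nlinarith)
      (sub_nonneg.2 (hb.abs_le r (by linarith) (by linarith)))
  have d2 : (r + h) ^ 2 * (α - |meanVal a (r + h)|) ≤ R ^ 2 * (α - |meanVal a (r + h)|) :=
    mul_le_mul_of_nonneg_right (by nlinarith)
      (sub_nonneg.2 (hb.abs_le _ (by linarith) (by linarith)))
  have d3 := mul_le_mul_of_nonneg_left hr3 (sq_nonneg R)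
  nlinarith

end

lemma NearMax.le_two_mul {a φ : ℕ → ℝ} {K ε κ R α : ℝ} (hm : MulLike a φ K)
    (hb : NearMax a ε κ R α) : α ≤ 2 * K := by
  have h1 := hb.le_abs.trans (hm.abs_meanVal_le R)
  nlinarith [hb.ε_le, hb.α_pos]

lemma exists_integral_signTest_le : ∃ C : ℝ, 1 ≤ C ∧ ∀ (a φ : ℕ → ℝ) (K ε κ R α : ℝ),
    MulLike a φ K → NearMax a ε κ R α → LossBound a φ ε κ R α → C * K ≤ ε * α * R →
    ∀ h, 0 ≤ h → h ≤ R / 8 → ∃ c : ℝ, (c = 1 ∨ c = -1) ∧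
      ∫ q in (0 : ℝ)..(3 * R / 8), signTest (fun q => clip α (meanVal a q)) c h q
        ≤ 1084 * ε * α ^ 2 * R := by
  obtain ⟨C, hC, hS⟩ := exists_selberg_integral
  refine ⟨32 * C, by linarith, fun a φ K ε κ R α hm hb hl hCK h hh hh' => ?_⟩
  have hR := hb.one_le
  have hα := hb.α_pos
  have hε := hb.ε_pos
  have hK := hm.nonneg
  have hαK := hb.le_two_mul hm
  obtain ⟨r, hr1, hr2, hr⟩ := hb.exists_loss_add_loss_le hm hl hh hh'
  obtain ⟨c, hc, hsum⟩ := sum_signTest_le_loss (r := r) hm hα.le hh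
  refine ⟨c, hc, ?_⟩
  obtain ⟨V, hV, hvar⟩ := variation_signTest hm hα.le hh hc
  set Φ := signTest (fun q => clip α (meanVal a q)) c h with hΦ
  have hΦm : Measurable Φ :=
    measurable_signTest ((measurable_clip α).comp (measurable_meanVal a)) c h
  have hΦ0 : ∀ q, 0 ≤ Φ q := fun q => signTest_nonneg _ hc h q
  have hΦle : ∀ q, |Φ q| ≤ 16 * α * K := fun q => by
    rw [abs_of_nonneg (hΦ0 q)]
    refine (signTest_le hc (fun q => abs_clip_le hα.le _) h q).trans ?_
    nlinarith
  have h1 := hS (16 * α * K) Φ V hΦm hΦle (fun t ht => ⟨(hV t ht).1, (hV t ht).2.trans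
    (mul_le_mul_of_nonneg_right (by nlinarith) (by linarith))⟩) hvar r (by linarith)
  have h2 : C * (16 * α * K) * (r + 1) ≤ ε * α ^ 2 * R ^ 2 := by
    have h3 : C * (16 * α * K) * (r + 1) ≤ C * (16 * α * K) * (2 * R) :=
      mul_le_mul_of_nonneg_left (by linarith) (by positivity)
    have h4 := mul_le_mul_of_nonneg_left hCK (by positivity : 0 ≤ α * R)
    nlinarith
  have h5 : 2 * α * (loss a φ r + loss a φ (r + h)) ≤ 2 * α * (135 * ε * α * R ^ 2) :=
    mul_le_mul_of_nonneg_left hr (by linarith)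
  have iΦ := intervalIntegrable_of_bdd hΦm hΦle
  have iM : ∀ s t, IntervalIntegrable (fun q => (r - q) * Φ q) volume s t := fun s t =>
    (iΦ s t).continuousOn_mul (by fun_prop)
  have h6 : R / 8 * (∫ q in (0 : ℝ)..(3 * R / 8), Φ q) ≤ ∫ q in (0 : ℝ)..r, (r - q) * Φ q := by
    rw [← intervalIntegral.integral_const_mul]
    refine (intervalIntegral.integral_mono_on (by linarith) ((iΦ _ _).const_mul _) (iM _ _)
      fun q hq => mul_le_mul_of_nonneg_right (by linarith [hq.2]) (hΦ0 q)).trans ?_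
    refine intervalIntegral.integral_mono_interval le_rfl (by linarith) (by linarith) ?_ (iM _ _)
    refine (ae_restrict_iff' measurableSet_Ioc).2 (Filter.Eventually.of_forall fun q hq => ?_)
    exact mul_nonneg (by linarith [hq.2]) (hΦ0 q)
  have h7 := (abs_le.1 h1).1
  have h8 : R / 8 * (∫ q in (0 : ℝ)..(3 * R / 8), Φ q) ≤ R / 8 * (1084 * ε * α ^ 2 * R) := by
    nlinarith
  exact le_of_mul_le_mul_left h8 (by linarith)

lemma autocorr_defect_le {x y z α c : ℝ} (hx : |x| ≤ α) (hy : |y| ≤ α) (hz : |z| ≤ α)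
    (hc : c = 1 ∨ c = -1) :
    |x * z| - x * z ≤ (|x * y| - c * (x * y)) + (|y * z| - c * (y * z)) + 2 * α * (α - |y|) := by
  have key : ∀ x y z : ℝ, |x| ≤ α → |y| ≤ α → |z| ≤ α → 0 ≤ x →
      |x * z| - x * z ≤ (|x * y| - c * (x * y)) + (|y * z| - c * (y * z))
        + 2 * α * (α - |y|) := by
    intro x y z hx hy hz hx0
    have hα : 0 ≤ α := (abs_nonneg x).trans hx
    have n1 : ∀ w : ℝ, 0 ≤ |w| - c * w := fun w => by
      rcases hc with rfl | rfl
      · linarith [le_abs_self w]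
      · linarith [neg_le_abs w]
    have n3 : 0 ≤ α * (α - |y|) := mul_nonneg hα (by linarith)
    have n4 := n1 (x * y)
    have n5 := n1 (y * z)
    rcases le_total 0 z with hz0 | hz0
    · rw [abs_of_nonneg (mul_nonneg hx0 hz0)]
      linarith
    · rw [abs_of_nonpos (mul_nonpos_of_nonneg_of_nonpos hx0 hz0)]
      rw [abs_of_nonneg hx0] at hx
      rw [abs_of_nonpos hz0] at hz
      rcases le_total 0 y with hy0 | hy0
      · rw [abs_of_nonneg (mul_nonneg hx0 hy0),
          abs_of_nonpos (mul_nonpos_of_nonneg_of_nonpos hy0 hz0)] at *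
        rw [abs_of_nonneg hy0] at *
        rcases hc with rfl | rfl <;>
          nlinarith [mul_nonneg hx0 (sub_nonneg.2 hy), mul_nonneg (neg_nonneg.2 hz0)
            (sub_nonneg.2 hy), mul_nonneg hx0 (sub_nonneg.2 hz),
            mul_nonneg (neg_nonneg.2 hz0) (sub_nonneg.2 hx), mul_nonneg (sub_nonneg.2 hy)
            (sub_nonneg.2 hx), mul_nonneg (sub_nonneg.2 hy) (sub_nonneg.2 hz)]
      · rw [abs_of_nonpos (mul_nonpos_of_nonneg_of_nonpos hx0 hy0),
          abs_of_nonneg (mul_nonneg_of_nonpos_of_nonpos hy0 hz0)] at *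
        rw [abs_of_nonpos hy0] at *
        rcases hc with rfl | rfl <;>
          nlinarith [mul_nonneg hx0 (sub_nonneg.2 hy), mul_nonneg (neg_nonneg.2 hz0)
            (sub_nonneg.2 hy), mul_nonneg hx0 (sub_nonneg.2 hz),
            mul_nonneg (neg_nonneg.2 hz0) (sub_nonneg.2 hx), mul_nonneg (sub_nonneg.2 hy)
            (sub_nonneg.2 hx), mul_nonneg (sub_nonneg.2 hy) (sub_nonneg.2 hz)]
  rcases le_total 0 x with h0 | h0
  · exact key x y z hx hy hz h0
  · have := key (-x) (-y) (-z) (by rwa [abs_neg]) (by rwa [abs_neg]) (by rwa [abs_neg])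
      (by linarith)
    simpa only [neg_mul_neg, abs_neg] using this

lemma exists_autocorr_le : ∃ C : ℝ, 1 ≤ C ∧ ∀ (a φ : ℕ → ℝ) (K ε κ R α : ℝ),
    MulLike a φ K → NearMax a ε κ R α → LossBound a φ ε κ R α → C * K ≤ ε * α * R →
    ∀ u, 0 ≤ u → u ≤ R / 4 → ∫ q in (κ * R)..(R / 4),
      (|meanVal a q * meanVal a (q + u)| - meanVal a q * meanVal a (q + u))
        ≤ 2184 * ε * α ^ 2 * R := by
  obtain ⟨C, hC, hS⟩ := exists_integral_signTest_le
  refine ⟨C, hC, fun a φ K ε κ R α hm hb hl hCK u hu hu' => ?_⟩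
  obtain ⟨c, hc, h1⟩ := hS a φ K ε κ R α hm hb hl hCK (u / 2) (by linarith) (by linarith)
  have hR := hb.one_le
  have hα := hb.α_pos
  have hκR : κ * R ≤ R / 32 := by nlinarith [hb.κ_le]
  have hκR0 : 0 ≤ κ * R := mul_nonneg hb.κ_nonneg (by linarith)
  set H := meanVal a with hH
  have hHm : Measurable H := measurable_meanVal a
  set Φ := signTest (fun q => clip α (H q)) c (u / 2) with hΦ
  have hΦm : Measurable Φ := measurable_signTest ((measurable_clip α).comp hHm) c _
  have hΦ0 : ∀ q, 0 ≤ Φ q := fun q => signTest_nonneg _ hc _ q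
  have hΦle : ∀ q, |Φ q| ≤ 2 * α ^ 2 := fun q => by
    rw [abs_of_nonneg (hΦ0 q)]
    exact signTest_le hc (fun q => abs_clip_le hα.le _) _ q
  have iΦ := intervalIntegrable_of_bdd hΦm hΦle
  have iΦ' : ∀ s t, IntervalIntegrable (fun q => Φ (q + u / 2)) volume s t :=
    intervalIntegrable_of_bdd (hΦm.comp (measurable_id.add_const (u / 2))) (fun q => hΦle _)
  have iD : ∀ s t, IntervalIntegrable (fun q => 2 * α * (α - |H (q + u / 2)|)) volume s t :=
    fun s t => (intervalIntegrable_const.sub (intervalIntegrable_of_bdd (K := K)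
      (hHm.comp (measurable_id.add_const (u / 2))).abs
      (fun q => by rw [abs_abs]; exact hm.abs_meanVal_le _) _ _)).const_mul _
  have iJ : ∀ s t, IntervalIntegrable (fun q => |H q * H (q + u)| - H q * H (q + u)) volume s t :=
    fun s t => by
      have hmu : Measurable fun q => H q * H (q + u) :=
        hHm.mul (hHm.comp (measurable_id.add_const u))
      have hb : ∀ q, |H q * H (q + u)| ≤ K * K := fun q => by
        rw [abs_mul]
        exact mul_le_mul (hm.abs_meanVal_le _) (hm.abs_meanVal_le _) (abs_nonneg _) hm.nonneg
      exact (intervalIntegrable_of_bdd hmu.abs (K := K * K)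
        (fun q => by rw [abs_abs]; exact hb q) _ _).sub (intervalIntegrable_of_bdd hmu hb _ _)
  have hsub : ∀ s t, 0 ≤ s → s ≤ t → t ≤ 3 * R / 8 →
      ∫ q in s..t, Φ q ≤ 1084 * ε * α ^ 2 * R := fun s t hs hst ht => by
    refine le_trans (intervalIntegral.integral_mono_interval hs hst ht ?_ (iΦ _ _)) h1
    exact Filter.Eventually.of_forall hΦ0
  have b1 := hsub (κ * R) (R / 4) hκR0 (by linarith) (by linarith)
  have b2 : ∫ q in (κ * R)..(R / 4), Φ (q + u / 2) ≤ 1084 * ε * α ^ 2 * R := by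
    rw [intervalIntegral.integral_comp_add_right Φ]
    exact hsub _ _ (by linarith) (by linarith) (by linarith)
  have b3 : ∫ q in (κ * R)..(R / 4), 2 * α * (α - |H (q + u / 2)|) ≤ 16 * ε * α ^ 2 * R := by
    rw [intervalIntegral.integral_const_mul]
    have := mul_le_mul_of_nonneg_left (hb.integral_shift_defect_le hm hl (s := κ * R) (t := R / 4)
      (u := u / 2) (by linarith) le_rfl (by linarith) (by linarith)) (by linarith : 0 ≤ 2 * α)
    linarith
  calc _ ≤ ∫ q in (κ * R)..(R / 4), (Φ q + Φ (q + u / 2) + 2 * α * (α - |H (q + u / 2)|)) := by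
        refine intervalIntegral.integral_mono_on (by linarith) (iJ _ _)
          (((iΦ _ _).add (iΦ' _ _)).add (iD _ _)) fun q hq => ?_
        have x1 : |H q| ≤ α := hb.abs_le q hq.1 (by linarith [hq.2])
        have x2 : |H (q + u / 2)| ≤ α :=
          hb.abs_le (q + u / 2) (by linarith [hq.1]) (by linarith [hq.2])
        have x3 : |H (q + u)| ≤ α := hb.abs_le (q + u) (by linarith [hq.1]) (by linarith [hq.2])
        simp only [hΦ, signTest, clip_of_abs_le x1, clip_of_abs_le x2]
        rw [add_assoc q, add_halves, clip_of_abs_le x3]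
        exact autocorr_defect_le x1 x2 x3 hc
    _ = (∫ q in (κ * R)..(R / 4), Φ q) + (∫ q in (κ * R)..(R / 4), Φ (q + u / 2))
        + ∫ q in (κ * R)..(R / 4), 2 * α * (α - |H (q + u / 2)|) := by
        rw [intervalIntegral.integral_add ((iΦ _ _).add (iΦ' _ _)) (iD _ _),
          intervalIntegral.integral_add (iΦ _ _) (iΦ' _ _)]
    _ ≤ _ := by linarith

/-- If `|meanVal a|` is nearly maximal at `R`, then `a` nearly has constant sign below `R`. -/
lemma exists_constant_sign : ∃ C : ℝ, 1 ≤ C ∧ ∀ (a φ : ℕ → ℝ) (K ε κ R α : ℝ),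
    MulLike a φ K → NearMax a ε κ R α → C * K ≤ ε * α * R →
    (∀ r, R / 8 ≤ r → r ≤ R / 4 → α * R / 32 ≤ ∫ q in (0 : ℝ)..r, meanVal a q) ∨
    (∀ r, R / 8 ≤ r → r ≤ R / 4 → ∫ q in (0 : ℝ)..r, meanVal a q ≤ -(α * R / 32)) := by
  obtain ⟨C1, hC1, h1⟩ := exists_loss_le
  obtain ⟨C2, hC2, h2⟩ := exists_autocorr_le
  refine ⟨C1 + C2, by linarith, fun a φ K ε κ R α hm hb hCK => ?_⟩
  have hK := hm.nonneg
  have hl : LossBound a φ ε κ R α := h1 a φ K ε κ R α hm hb (by nlinarith)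
  have hJ := h2 a φ K ε κ R α hm hb hl (by nlinarith)
  have hD := hb.integral_defect_le hm hl
  have hR : 0 < R := by linarith [hb.one_le]
  rcases le_total 0 (∫ q in (κ * R)..(R / 4), meanVal a q) with h0 | h0
  · left
    intro r hr hr'
    exact le_integral_of_autocorr (measurable_meanVal a) hm.abs_meanVal_le hb.κ_nonneg hb.κ_le hR
      hb.α_pos hb.ε_pos.le hb.ε_le hb.integral_le hD hb.abs_le hJ h0 hr hr'
  · right
    intro r hr hr'
    have := le_integral_of_autocorr (H := fun q => -meanVal a q) (K := K) (κ := κ) (R := R)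
      (α := α) (ε := ε) (measurable_meanVal a).neg
      (fun q => by rw [abs_neg]; exact hm.abs_meanVal_le q) hb.κ_nonneg hb.κ_le hR hb.α_pos
      hb.ε_pos.le hb.ε_le (by simpa only [abs_neg] using hb.integral_le)
      (by simpa only [abs_neg] using hD) (fun q h h' => by rw [abs_neg]; exact hb.abs_le q h h')
      (fun u h h' => by simpa only [neg_mul_neg] using hJ u h h')
      (by rw [intervalIntegral.integral_neg]; linarith) hr hr'
    rw [intervalIntegral.integral_neg] at this
    linarith

/-- Logarithmic means in terms of mean values. -/
lemma sum_div_eq_meanVal_add_integral (a : ℕ → ℝ) {r : ℝ} (hr : 0 ≤ r) :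
    ∑ n ∈ upTo (exp r), a n / n = meanVal a r + ∫ q in (0 : ℝ)..r, meanVal a q := by
  have h1 : ∀ q ∈ Set.uIcc 0 r, meanVal a q
      = ∑ n ∈ upTo (exp r), (Set.Ici (log n)).indicator (fun q => a n * exp (-q)) q := by
    intro q hq
    rw [Set.uIcc_of_le hr] at hq
    rw [meanVal, summ, Finset.mul_sum]
    refine (Finset.sum_congr rfl fun n hn => ?_).trans
      (Finset.sum_subset (upTo_subset (exp_le_exp.2 hq.2)) fun n hn hn' => ?_)
    rotate_left
    · rw [Set.indicator_of_notMem]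
      intro h
      refine hn' (mem_upTo.2 ⟨(mem_upTo.1 hn).1, ?_⟩)
      rw [← exp_log (pos_of_mem_upTo hn)]
      exact exp_le_exp.2 h
    · rw [Set.indicator_of_mem, mul_comm]
      rw [Set.mem_Ici, ← log_exp q]
      exact log_le_log (pos_of_mem_upTo hn) (le_of_mem_upTo hn)
  have hc : ∀ n : ℕ, Continuous fun q : ℝ => a n * exp (-q) := fun n => by fun_prop
  have hint : ∀ n : ℕ, ∀ s t : ℝ, IntervalIntegrable
      ((Set.Ici (log n)).indicator (fun q => a n * exp (-q))) volume s t := fun n s t =>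
    ⟨((hc n).intervalIntegrable s t).1.indicator measurableSet_Ici,
      ((hc n).intervalIntegrable s t).2.indicator measurableSet_Ici⟩
  have h2 : ∀ n ∈ upTo (exp r), ∫ q in (0 : ℝ)..r,
      (Set.Ici (log n)).indicator (fun q => a n * exp (-q)) q = a n / n - a n * exp (-r) := by
    intro n hn
    have hn0 := pos_of_mem_upTo hn
    have hl : log n ≤ r := by
      rw [← log_exp r]; exact log_le_log hn0 (le_of_mem_upTo hn)
    have hl0 : 0 ≤ log (n : ℝ) := log_natCast_nonneg n
    rw [← intervalIntegral.integral_add_adjacent_intervals (hint n 0 (log n)) (hint n _ _)]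
    have e1 : ∫ q in (0 : ℝ)..(log n), (Set.Ici (log n)).indicator (fun q => a n * exp (-q)) q
        = 0 := by
      refine intervalIntegral.integral_zero_ae ?_
      filter_upwards [compl_mem_ae_iff.2 (measure_singleton (log (n : ℝ)))] with q hq hq'
      rw [Set.uIoc_of_le hl0] at hq'
      exact Set.indicator_of_notMem (fun h => hq (le_antisymm hq'.2 h)) _
    have e2 : ∫ q in (log n)..r, (Set.Ici (log n)).indicator (fun q => a n * exp (-q)) q
        = ∫ q in (log n)..r, a n * exp (-q) := by
      refine intervalIntegral.integral_congr fun q hq => ?_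
      rw [Set.uIcc_of_le hl] at hq
      exact Set.indicator_of_mem hq.1 _
    rw [e1, e2, intervalIntegral.integral_const_mul,
      intervalIntegral.integral_comp_neg (fun q => exp q), integral_exp, exp_neg (log _),
      exp_log hn0]
    ring
  rw [intervalIntegral.integral_congr h1,
    intervalIntegral.integral_finsetSum fun n _ => hint n 0 r, Finset.sum_congr rfl h2,
    Finset.sum_sub_distrib, ← Finset.sum_mul, meanVal, summ]
  ring

lemma exists_near_max : ∃ γ : ℝ, 0 < γ ∧ γ ≤ 1 / 2 ∧ ∀ K : ℝ, ∃ C : ℝ, 1 ≤ C ∧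
    ∀ a φ : ℕ → ℝ, MulLike a φ K → ∀ r₀ L : ℝ, 1 ≤ r₀ → r₀ ≤ L →
    ∃ R, r₀ ≤ R ∧ R ≤ L ∧ L ^ γ * |meanVal a L| ≤ 2 * (R ^ γ * |meanVal a R|) ∧
      (C * r₀ ≤ R * |meanVal a R| →
        (∀ r, R / 8 ≤ r → r ≤ R / 4 →
          R * |meanVal a R| / 32 ≤ ∫ q in (0 : ℝ)..r, meanVal a q) ∨
        (∀ r, R / 8 ≤ r → r ≤ R / 4 →
          ∫ q in (0 : ℝ)..r, meanVal a q ≤ -(R * |meanVal a R| / 32))) := by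
  obtain ⟨C1, hC1, hblock⟩ := exists_constant_sign
  obtain ⟨ε, hε⟩ : ∃ ε : ℝ, ε = 1 / 10 ^ 6 := ⟨_, rfl⟩
  obtain ⟨κ, hκ⟩ : ∃ κ : ℝ, κ = ε / 4 := ⟨_, rfl⟩
  have hε0 : 0 < ε := by rw [hε]; norm_num
  have hκ0 : 0 < κ := by rw [hκ]; linarith
  have hκ1 : κ ≤ 1 / 32 := by rw [hκ, hε]; norm_num
  have hℓ : 0 ≤ -log κ := by
    have := log_nonpos hκ0.le (by linarith); linarith
  obtain ⟨γ, hγ⟩ : ∃ γ : ℝ, γ = ε / 4 / (1 + -log κ) := ⟨_, rfl⟩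
  have hγ0 : 0 < γ := by rw [hγ]; positivity
  have hγε : γ ≤ ε / 4 := by
    rw [hγ]; exact div_le_self (by linarith) (by linarith)
  have hε1 : ε ≤ 1 / 2 := by rw [hε]; norm_num
  have hκγ : 1 - ε / 4 ≤ κ ^ γ := by
    rw [rpow_def_of_pos hκ0]
    have h1 := add_one_le_exp (log κ * γ)
    have h2 : γ * (1 + -log κ) = ε / 4 := by rw [hγ]; field_simp
    nlinarith
  refine ⟨γ, hγ0, by linarith, fun K => ⟨1 + (C1 + 2) * |K| / ε + |K| / κ, ?_,
    fun a φ hm r₀ L hr₀ hL => ?_⟩⟩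
  · have : 0 ≤ (C1 + 2) * |K| / ε := by positivity
    have : 0 ≤ |K| / κ := by positivity
    linarith
  have hK := hm.nonneg
  rw [abs_of_nonneg hK]
  set g : ℝ → ℝ := fun r => r ^ γ * |meanVal a r| with hg
  have hbdd : BddAbove (g '' Set.Icc r₀ L) := by
    refine ⟨L ^ γ * K, ?_⟩
    rintro _ ⟨r, hr, rfl⟩
    exact mul_le_mul (rpow_le_rpow (by linarith [hr.1]) hr.2 hγ0.le) (hm.abs_meanVal_le r)
      (abs_nonneg _) (rpow_nonneg (by linarith) _)
  set B := sSup (g '' Set.Icc r₀ L) with hB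
  have hle : ∀ r, r₀ ≤ r → r ≤ L → g r ≤ B := fun r h h' =>
    le_csSup hbdd ⟨r, ⟨h, h'⟩, rfl⟩
  have hg0 : ∀ r, 0 ≤ r → 0 ≤ g r := fun r hr => mul_nonneg (rpow_nonneg hr _) (abs_nonneg _)
  obtain ⟨R, hR1, hR2, hR⟩ : ∃ R, r₀ ≤ R ∧ R ≤ L ∧ (1 - ε / 2) * B ≤ g R := by
    rcases le_or_gt B 0 with hB0 | hB0
    · refine ⟨L, hL, le_rfl, le_trans ?_ (hg0 L (by linarith))⟩
      exact mul_nonpos_of_nonneg_of_nonpos (by linarith) hB0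
    · obtain ⟨_, ⟨R, hR, rfl⟩, h⟩ := exists_lt_of_lt_csSup (s := g '' Set.Icc r₀ L)
        (b := (1 - ε / 2) * B) ⟨_, ⟨L, ⟨hL, le_rfl⟩, rfl⟩⟩ (by rw [← hB]; nlinarith)
      exact ⟨R, hR.1, hR.2, h.le⟩
  have hBn : 0 ≤ B := (hg0 L (by linarith)).trans (hle L hL le_rfl)
  refine ⟨R, hR1, hR2, ?_, fun hbig => ?_⟩
  · have := hle L hL le_rfl
    simp only [hg] at this hR
    nlinarith
  have hRpos : 0 < R := by linarith
  have hHK := hm.abs_meanVal_le R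
  have hbig1 : (C1 + 2) * K * r₀ ≤ ε * (R * |meanVal a R|) ∧ r₀ * K ≤ κ * (R * |meanVal a R|) ∧
      0 < R * |meanVal a R| := by
    have e1 : (C1 + 2) * K / ε * r₀ * ε = (C1 + 2) * K * r₀ := by field_simp
    have e2 : K / κ * r₀ * κ = r₀ * K := by field_simp
    have p1 : 0 ≤ (C1 + 2) * K / ε * r₀ := by positivity
    have p2 : 0 ≤ K / κ * r₀ := by positivity
    have q1 : (C1 + 2) * K / ε * r₀ ≤ R * |meanVal a R| := by linarith
    have q2 : K / κ * r₀ ≤ R * |meanVal a R| := by linarith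
    refine ⟨?_, ?_, by linarith⟩
    · have := mul_le_mul_of_nonneg_right q1 hε0.le; linarith
    · have := mul_le_mul_of_nonneg_right q2 hκ0.le; linarith
  obtain ⟨b1, b2, b3⟩ := hbig1
  have hHR : 0 < |meanVal a R| := pos_of_mul_pos_right b3 hRpos.le
  have hKpos : 0 < K := hHR.trans_le hHK
  have hκR : r₀ ≤ κ * R := by
    have : κ * (R * |meanVal a R|) ≤ κ * R * K := by
      rw [← mul_assoc]; exact mul_le_mul_of_nonneg_left hHK (by positivity)
    exact le_of_mul_le_mul_right (b2.trans this) hKpos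
  have hκRpos : 0 < κ * R := by positivity
  have hκRR : κ * R ≤ R := by nlinarith
  set α := B * (κ * R) ^ (-γ) with hα
  have hdec : ∀ q, r₀ ≤ q → q ≤ L → |meanVal a q| ≤ B * q ^ (-γ) := fun q h h' => by
    have hq : 0 < q := by linarith
    rw [rpow_neg hq.le, ← div_eq_mul_inv, le_div_iff₀ (rpow_pos_of_pos hq _), mul_comm]
    exact hle q h h'
  have habs : ∀ q, κ * R ≤ q → q ≤ R → |meanVal a q| ≤ α := fun q h h' =>
    (hdec q (hκR.trans h) (h'.trans hR2)).trans (mul_le_mul_of_nonneg_left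
      (rpow_le_rpow_of_nonpos hκRpos h (by linarith)) hBn)
  have hαR := habs R hκRR le_rfl
  have hαpos : 0 < α := hHR.trans_le hαR
  have hint : ∫ q in (0 : ℝ)..(κ * R), |meanVal a q| ≤ K * r₀ + 2 * (κ * R) * α := by
    rw [← intervalIntegral.integral_add_adjacent_intervals (hm.intervalIntegrable_abs 0 r₀)
      (hm.intervalIntegrable_abs _ _)]
    refine add_le_add ?_ ?_
    · refine (intervalIntegral.integral_mono_on (by linarith) (hm.intervalIntegrable_abs _ _)
        (intervalIntegrable_const (c := K)) fun q _ => hm.abs_meanVal_le q).trans ?_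
      rw [intervalIntegral.integral_const, smul_eq_mul]; linarith
    · have hir : ∀ s t : ℝ, IntervalIntegrable (fun q : ℝ => B * q ^ (-γ)) volume s t := fun s t =>
        (intervalIntegral.intervalIntegrable_rpow' (by linarith)).const_mul _
      refine (intervalIntegral.integral_mono_on hκR (hm.intervalIntegrable_abs _ _)
        (hir _ _) fun q hq => hdec q hq.1 (by linarith [hq.2])).trans ?_
      rw [intervalIntegral.integral_const_mul, integral_rpow (Or.inl (by linarith)),
        rpow_add hκRpos, rpow_one, hα]
      have p1 : 0 ≤ r₀ ^ (-γ + 1) := rpow_nonneg (by linarith) _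
      have p2 : 0 ≤ (κ * R) ^ (-γ) := rpow_nonneg hκRpos.le _
      have p3 : ((κ * R) ^ (-γ) * (κ * R) - r₀ ^ (-γ + 1)) / (-γ + 1)
          ≤ 2 * ((κ * R) ^ (-γ) * (κ * R)) := by
        rw [div_le_iff₀ (by linarith)]
        nlinarith [mul_nonneg p2 hκRpos.le]
      have := mul_le_mul_of_nonneg_left p3 hBn
      linarith
  have hαRR : R * |meanVal a R| ≤ α * R := by
    rw [mul_comm]; exact mul_le_mul_of_nonneg_right hαR hRpos.le
  have hεαR : ε * (R * |meanVal a R|) ≤ ε * (α * R) := mul_le_mul_of_nonneg_left hαRR hε0.le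
  have hnm : NearMax a ε κ R α :=
    { ε_pos := hε0, ε_le := hε.le, κ_nonneg := hκ0.le, κ_le := hκ1, one_le := by linarith
      α_pos := hαpos, abs_le := habs
      le_abs := by
        have e1 : α * κ ^ γ * R ^ γ = B := by
          rw [hα, mul_assoc, mul_assoc, ← mul_rpow hκ0.le hRpos.le, ← rpow_add hκRpos]; simp
        have hRγ : 0 < R ^ γ := rpow_pos_of_pos hRpos _
        have e2 : (1 - ε / 2) * (α * κ ^ γ) ≤ |meanVal a R| := by
          refine le_of_mul_le_mul_right ?_ hRγ
          rw [mul_assoc, e1, mul_comm |meanVal a R|]; exact hR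
        have e3 : α * (1 - ε / 4) ≤ α * κ ^ γ := mul_le_mul_of_nonneg_left hκγ hαpos.le
        have e4 := mul_le_mul_of_nonneg_left e3 (by linarith : 0 ≤ 1 - ε / 2)
        nlinarith [mul_pos hαpos hε0]
      integral_le := by
        refine hint.trans ?_
        have p1 : 0 ≤ C1 * K * r₀ := by positivity
        have p2 : 2 * (κ * R) * α = ε / 2 * (α * R) := by rw [hκ]; ring
        linarith }
  have := hblock a φ K ε κ R α hm hnm (by
    have p1 : C1 * K ≤ C1 * K * r₀ := le_mul_of_one_le_right (by positivity) hr₀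
    have p2 : 0 ≤ K * r₀ := by positivity
    linarith)
  rcases this with h | h
  · exact Or.inl fun r h1 h2 => le_trans (by linarith) (h r h1 h2)
  · exact Or.inr fun r h1 h2 => (h r h1 h2).trans (by linarith)

/-- The logarithmic mean `∑_{n ≤ e^r} a n / n`. -/
noncomputable def logSum (a : ℕ → ℝ) (r : ℝ) : ℝ := ∑ n ∈ upTo (exp r), a n / n

lemma exists_meanVal_vM_sub_one_le : ∃ γ C : ℝ, 0 < γ ∧ γ ≤ 1 / 2 ∧ 1 ≤ C ∧ ∀ r, 0 ≤ r →
    (1 + r) ^ γ * |meanVal (fun n => vM n - 1) r| ≤ C := by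
  obtain ⟨γ, hγ, hγ1, hnm⟩ := exists_near_max
  obtain ⟨K, hm⟩ := exists_mulLike_vM
  obtain ⟨C, hC, hnm⟩ := hnm K
  obtain ⟨M, hM, hmer⟩ := exists_mertens
  set a : ℕ → ℝ := fun n => vM n - 1 with ha
  have hK := hm.nonneg
  have hint : ∀ r, 0 ≤ r → |∫ q in (0 : ℝ)..r, meanVal a q| ≤ M + 1 + K := fun r hr => by
    have h1 := sum_div_eq_meanVal_add_integral a hr
    have h2 : ∑ n ∈ upTo (exp r), a n / n
        = ∑ n ∈ upTo (exp r), vM n / n - ∑ n ∈ upTo (exp r), (1 : ℝ) / n := by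
      rw [← Finset.sum_sub_distrib]
      exact Finset.sum_congr rfl fun n _ => by simp only [ha, sub_div]
    have h3 := abs_le.1 (hmer _ (one_le_exp hr))
    have h4 := sum_inv_upTo_le (one_le_exp hr)
    have h5 := log_le_sum_inv_upTo (one_le_exp hr)
    have h6 := abs_le.1 (hm.abs_meanVal_le r)
    rw [log_exp] at h3 h4 h5
    rw [abs_le]
    constructor <;> linarith [h3.1, h3.2, h6.1, h6.2]
  set D := 2 * (C + 32 * (M + 1 + K)) with hD
  have hlarge : ∀ L, 1 ≤ L → L ^ γ * |meanVal a L| ≤ D := fun L hL => by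
    obtain ⟨R, hR1, hR2, h1, h2⟩ := hnm a _ hm 1 L le_rfl hL
    have h3 : R * |meanVal a R| ≤ C + 32 * (M + 1 + K) := by
      by_contra hc
      push Not at hc
      have h4 := abs_le.1 (hint (R / 4) (by linarith))
      rcases h2 (by linarith) with h | h
      · have := h (R / 4) (by linarith) le_rfl; linarith [h4.2]
      · have := h (R / 4) (by linarith) le_rfl; linarith [h4.1]
    have h5 : R ^ γ ≤ R := by
      conv_rhs => rw [← rpow_one R]
      exact rpow_le_rpow_of_exponent_le hR1 (by linarith)
    have h6 := mul_le_mul_of_nonneg_right h5 (abs_nonneg (meanVal a R))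
    linarith
  refine ⟨γ, 2 * D + 2 * K, hγ, hγ1, by linarith, fun r hr => ?_⟩
  rcases le_total 1 r with h | h
  · have h1 : (1 + r) ^ γ ≤ 2 * r ^ γ := by
      calc (1 + r) ^ γ ≤ (2 * r) ^ γ := rpow_le_rpow (by linarith) (by linarith) hγ.le
        _ = 2 ^ γ * r ^ γ := mul_rpow (by norm_num) hr
        _ ≤ 2 * r ^ γ := by
          refine mul_le_mul_of_nonneg_right ?_ (rpow_nonneg hr _)
          conv_rhs => rw [← rpow_one (2 : ℝ)]
          exact rpow_le_rpow_of_exponent_le (by norm_num) (by linarith)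
    have h2 := mul_le_mul_of_nonneg_right h1 (abs_nonneg (meanVal a r))
    linarith [hlarge r h]
  · have h1 : (1 + r) ^ γ ≤ 2 := by
      calc (1 + r) ^ γ ≤ (1 + r) ^ (1 : ℝ) :=
            rpow_le_rpow_of_exponent_le (by linarith) (by linarith)
        _ ≤ 2 := by rw [rpow_one]; linarith
    have h2 := mul_le_mul h1 (hm.abs_meanVal_le r) (abs_nonneg _) (by norm_num)
    linarith

lemma sum_inv_mul_rpow_log_div_le {γ q : ℝ} (hγ : 0 < γ) (hγ1 : γ ≤ 1 / 2) (hq : 0 ≤ q) :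
    ∑ m ∈ upTo (exp q), (1 : ℝ) / m * (1 + (q - log m)) ^ (-γ) ≤ 3 * (1 + q) ^ (1 - γ / 2) := by
  set T := √q with hT
  have hT0 : 0 ≤ T := sqrt_nonneg q
  have hT2 : T * T = q := mul_self_sqrt hq
  have hq1 : 0 < 1 + q := by linarith
  have hTq : T ≤ 1 + q := by nlinarith [sq_nonneg (T - 1)]
  set y := exp (max 0 (q - T)) with hy
  have hyq : y ≤ exp q := exp_le_exp.2 (max_le hq (by linarith))
  have h1 : ∀ m ∈ upTo (exp q), (1 : ℝ) / m * (1 + (q - log m)) ^ (-γ)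
      ≤ (1 + q) ^ (-(γ / 2)) * (1 / m) + if m ∈ upTo y then 0 else (1 : ℝ) / m := by
    intro m hm
    have hm0 := pos_of_mem_upTo hm
    have hlm : log m ≤ q := by rw [← log_exp q]; exact log_le_log hm0 (le_of_mem_upTo hm)
    have hm1 := one_le_of_mem_upTo hm
    have hl0 : 0 ≤ log (m : ℝ) := log_nonneg hm1
    split_ifs with hmy
    · rw [add_zero, mul_comm]
      refine mul_le_mul_of_nonneg_right ?_ (by positivity)
      have h2 : log m ≤ max 0 (q - T) := by
        rw [← log_exp (max 0 (q - T))]; exact log_le_log hm0 (le_of_mem_upTo hmy)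
      have h3 : (1 + q) ^ (1 / 2 : ℝ) ≤ 1 + (q - log m) := by
        rw [← sqrt_eq_rpow, sqrt_le_left (by linarith)]
        rcases le_total 0 (q - T) with h4 | h4
        · rw [max_eq_right h4] at h2; nlinarith
        · rw [max_eq_left h4] at h2; nlinarith
      calc (1 + (q - log m)) ^ (-γ) ≤ ((1 + q) ^ (1 / 2 : ℝ)) ^ (-γ) :=
            rpow_le_rpow_of_nonpos (rpow_pos_of_pos hq1 _) h3 (by linarith)
        _ = _ := by rw [← rpow_mul hq1.le]; congr 1; ring
    · have h2 : (1 + (q - log m)) ^ (-γ) ≤ 1 :=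
        rpow_le_one_of_one_le_of_nonpos (by linarith) (by linarith)
      have h3 : 0 ≤ (1 + q) ^ (-(γ / 2)) * (1 / (m : ℝ)) :=
        mul_nonneg (rpow_nonneg hq1.le _) (by positivity)
      have h4 : (1 : ℝ) / m * (1 + (q - log m)) ^ (-γ) ≤ 1 / m :=
        mul_le_of_le_one_right (by positivity) h2
      linarith
  refine (Finset.sum_le_sum h1).trans ?_
  rw [Finset.sum_add_distrib, ← Finset.mul_sum]
  have h2 : ∑ m ∈ upTo (exp q), (if m ∈ upTo y then 0 else (1 : ℝ) / m) ≤ 1 + T := by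
    have e : ∑ m ∈ upTo (exp q), (if m ∈ upTo y then 0 else (1 : ℝ) / m)
        = ∑ m ∈ upTo (exp q), (1 : ℝ) / m - ∑ m ∈ upTo y, (1 : ℝ) / m := by
      rw [← Finset.sum_sdiff (upTo_subset hyq) (f := fun m : ℕ => (1 : ℝ) / m),
        add_sub_cancel_right,
        ← Finset.sum_sdiff (upTo_subset hyq), Finset.sum_congr rfl fun m hm => if_neg
          (Finset.mem_sdiff.1 hm).2, Finset.sum_congr rfl fun m hm => if_pos hm]
      simp
    have h3 := sum_inv_upTo_le (one_le_exp hq)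
    have h4 := log_le_sum_inv_upTo (one_le_exp (le_max_left 0 (q - T)))
    rw [log_exp] at h3 h4
    rw [e]
    linarith [le_max_right 0 (q - T)]
  have h3 := sum_inv_upTo_le (one_le_exp hq)
  rw [log_exp] at h3
  have h4 := mul_le_mul_of_nonneg_left h3 (rpow_nonneg hq1.le (-(γ / 2)))
  have e1 : (1 + q) ^ (-(γ / 2)) * (1 + q) = (1 + q) ^ (1 - γ / 2) := by
    rw [sub_eq_neg_add, rpow_add hq1, rpow_one]
  have e2 : 1 + T ≤ 2 * (1 + q) ^ (1 - γ / 2) := by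
    calc 1 + T ≤ 2 * (1 + q) ^ (1 / 2 : ℝ) := by
          rw [← sqrt_eq_rpow]
          have a1 : 1 ≤ √(1 + q) := one_le_sqrt.2 (by linarith)
          have a2 : T ≤ √(1 + q) := sqrt_le_sqrt (by linarith)
          linarith
      _ ≤ _ := mul_le_mul_of_nonneg_left
          (rpow_le_rpow_of_exponent_le (by linarith) (by linarith)) (by norm_num)
  linarith

lemma exists_mul_meanVal_add_logSum : ∃ γ C : ℝ, 0 < γ ∧ γ ≤ 1 / 2 ∧ 1 ≤ C ∧
    ∀ f : ℕ → ℝ, BddMul f → ∀ q, 0 ≤ q → |q * meanVal f q + logSum f q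
      - ∑ n ∈ upTo (exp q), (1 + f n) * vM n / n * meanVal f (q - log n)|
        ≤ C * (1 + q) ^ (1 - γ) := by
  obtain ⟨γ, C, hγ, hγ1, hC, hpnt⟩ := exists_meanVal_vM_sub_one_le
  refine ⟨γ / 2, 3 + 3 * C, by linarith, by linarith, by linarith, fun f hf q hq => ?_⟩
  set x := exp q with hx
  have hx0 : 0 < x := exp_pos q
  have hx1 : 1 ≤ x := one_le_exp hq
  have hlog : log x = q := log_exp q
  have h1 := hf.mulLike.log_le x hx1
  have hpsi : ∀ m ∈ upTo x, |x / m - summ vM (x / m)|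
      ≤ 1 + C * x * (1 / m * (1 + (q - log m)) ^ (-γ)) := by
    intro m hm
    have hm0 := pos_of_mem_upTo hm
    have hd := one_le_div_of_mem_upTo hm
    have hl : log (x / m) = q - log m := by rw [log_div hx0.ne' hm0.ne', hlog]
    have hl0 : 0 ≤ q - log m := by rw [← hl]; exact log_nonneg hd
    have h2 := hpnt (q - log m) hl0
    have h3 : summ (fun n => vM n - 1) (x / m) = summ vM (x / m) - ⌊x / m⌋₊ := by
      rw [← summ_one_eq]; simp only [summ, Finset.sum_sub_distrib]
    have h4 := mul_meanVal_log (fun n => vM n - 1) (by linarith : 0 < x / m)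
    rw [hl, h3] at h4
    have hp : 0 < (1 + (q - log m)) ^ γ := rpow_pos_of_pos (by linarith) _
    have h5 : |meanVal (fun n => vM n - 1) (q - log m)| ≤ C * (1 + (q - log m)) ^ (-γ) := by
      rw [rpow_neg (by linarith), ← div_eq_mul_inv, le_div_iff₀ hp, mul_comm]; exact h2
    have h6 : |summ vM (x / m) - ⌊x / m⌋₊| ≤ x / m * (C * (1 + (q - log m)) ^ (-γ)) := by
      rw [← h4, abs_mul, abs_of_pos (by linarith : 0 < x / m)]
      exact mul_le_mul_of_nonneg_left h5 (by linarith)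
    have h7 := Nat.floor_le (by linarith : 0 ≤ x / m)
    have h8 := Nat.lt_floor_add_one (x / m)
    have e : x / m * (C * (1 + (q - log m)) ^ (-γ))
        = C * x * (1 / m * (1 + (q - log m)) ^ (-γ)) := by ring
    rw [e] at h6
    rw [abs_le] at h6 ⊢
    constructor <;> linarith [h6.1, h6.2]
  have h2 : |∑ m ∈ upTo x, f m * (x / m - summ vM (x / m))|
      ≤ x + C * x * (3 * (1 + q) ^ (1 - γ / 2)) := by
    calc _ ≤ ∑ m ∈ upTo x, (1 + C * x * (1 / m * (1 + (q - log m)) ^ (-γ))) := by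
          refine (Finset.abs_sum_le_sum_abs _ _).trans (Finset.sum_le_sum fun m hm => ?_)
          rw [abs_mul]
          exact (mul_le_of_le_one_left (abs_nonneg _) (hf.abs_le m (mem_upTo.1 hm).1)).trans
            (hpsi m hm)
      _ ≤ _ := by
          rw [Finset.sum_add_distrib, ← Finset.mul_sum]
          have := summ_one hx0.le
          rw [summ] at this
          refine add_le_add this (mul_le_mul_of_nonneg_left ?_ (by positivity))
          exact sum_inv_mul_rpow_log_div_le hγ hγ1 hq
  have h3 : ∑ m ∈ upTo x, f m * (x / m - summ vM (x / m))
      = x * logSum f q - ∑ n ∈ upTo x, vM n * summ f (x / n) := by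
    have e := sum_upTo_comm (fun n m => vM n * f m) x
    simp only [summ, Finset.mul_sum, logSum, mul_sub, Finset.sum_sub_distrib, e]
    congr 1
    · exact Finset.sum_congr rfl fun m _ => by ring
    · exact Finset.sum_congr rfl fun m _ => Finset.sum_congr rfl fun n _ => by ring
  have h4 : ∑ n ∈ upTo x, (1 + f n) * vM n / n * meanVal f (q - log n)
      = (∑ n ∈ upTo x, vM n * summ f (x / n) + ∑ n ∈ upTo x, f n * vM n * summ f (x / n)) / x := by
    rw [← Finset.sum_add_distrib, Finset.sum_div]
    refine Finset.sum_congr rfl fun n hn => ?_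
    rw [div_mul_eq_mul_div, mul_div_assoc, meanVal_sub_log f q (mem_upTo.1 hn).1]
    ring
  have h5 : q * meanVal f q + logSum f q
      - ∑ n ∈ upTo x, (1 + f n) * vM n / n * meanVal f (q - log n)
      = ((summ f x * log x - ∑ n ∈ upTo x, f n * vM n * summ f (x / n))
        + ∑ m ∈ upTo x, f m * (x / m - summ vM (x / m))) / x := by
    rw [h4, h3, hlog, hx, summ_exp]
    field_simp
    ring
  have hone : 1 ≤ (1 + q) ^ (1 - γ / 2) := one_le_rpow (by linarith) (by linarith)
  rw [h5, abs_div, abs_of_pos hx0, div_le_iff₀ hx0]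
  refine (abs_add_le _ _).trans ((add_le_add h1 h2).trans ?_)
  nlinarith

lemma BddMul.abs_meanVal_le_one {f : ℕ → ℝ} (hf : BddMul f) (r : ℝ) : |meanVal f r| ≤ 1 := by
  rw [meanVal, abs_mul, abs_of_pos (exp_pos _), exp_neg, inv_mul_le_one₀ (exp_pos r)]
  exact (abs_summ_le f _).trans (hf.summ_abs_le (exp_pos r).le)

lemma continuousWithinAt_meanVal (a : ℕ → ℝ) (q : ℝ) :
    ContinuousWithinAt (meanVal a) (Set.Ioi q) q := by
  have h1 : ContinuousWithinAt (fun t => exp (-t) * summ a (exp q)) (Set.Ioi q) q := by fun_prop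
  refine h1.congr_of_eventuallyEq ?_ rfl
  have h2 : ∀ᶠ t in nhdsWithin q (Set.Ioi q), exp t < ⌊exp q⌋₊ + 1 :=
    (continuous_exp.tendsto q).eventually_lt_const (Nat.lt_floor_add_one _) |>.filter_mono
      nhdsWithin_le_nhds
  filter_upwards [h2, self_mem_nhdsWithin] with t ht htq
  have h3 : ⌊exp t⌋₊ = ⌊exp q⌋₊ := by
    refine le_antisymm ?_ (Nat.floor_le_floor (exp_le_exp.2 (le_of_lt htq)))
    refine Nat.lt_succ_iff.1 ((Nat.floor_lt (exp_pos t).le).2 ?_)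
    push_cast; exact ht
  rw [meanVal, summ, summ, upTo, upTo, h3]

lemma continuous_integral_meanVal {a φ : ℕ → ℝ} {K : ℝ} (h : MulLike a φ K) :
    Continuous fun t => ∫ q in (0 : ℝ)..t, meanVal a q :=
  intervalIntegral.continuous_primitive (fun s t => h.intervalIntegrable s t) 0

/-- Integration by parts for the primitive of a mean value. -/
lemma add_one_mul_integral_meanVal {a φ : ℕ → ℝ} {K : ℝ} (h : MulLike a φ K) (q : ℝ) :
    (q + 1) * (∫ t in (0 : ℝ)..q, meanVal a t)
      = ∫ t in (0 : ℝ)..q, ((t + 1) * meanVal a t + ∫ t' in (0 : ℝ)..t, meanVal a t') := by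
  have hc := continuous_integral_meanVal h
  have hd : ∀ t, HasDerivWithinAt (fun t => (t + 1) * ∫ q in (0 : ℝ)..t, meanVal a q)
      ((t + 1) * meanVal a t + ∫ t' in (0 : ℝ)..t, meanVal a t') (Set.Ioi t) t := by
    intro t
    have h1 : HasDerivWithinAt (fun t => ∫ q in (0 : ℝ)..t, meanVal a q) (meanVal a t)
        (Set.Ioi t) t := by
      refine (intervalIntegral.integral_hasDerivWithinAt_right (h.intervalIntegrable 0 t)
        (t := Set.Ioi t) ?_ (continuousWithinAt_meanVal a t)).mono Set.Ioi_subset_Ici_self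
      exact (measurable_meanVal a).stronglyMeasurable.stronglyMeasurableAtFilter
    have h2 : HasDerivWithinAt (fun t : ℝ => t + 1) 1 (Set.Ioi t) t :=
      (hasDerivWithinAt_id t _).add_const 1
    have h3 := (h2.mul h1)
    rw [one_mul, add_comm] at h3
    exact h3
  have hi : IntervalIntegrable
      (fun t => (t + 1) * meanVal a t + ∫ t' in (0 : ℝ)..t, meanVal a t') volume 0 q :=
    ((h.intervalIntegrable 0 q).continuousOn_mul (by fun_prop)).add (hc.intervalIntegrable 0 q)
  rw [intervalIntegral.integral_eq_sub_of_hasDeriv_right (by fun_prop) (fun t _ => hd t) hi]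
  simp

/-- A bound for `(t + 1) * F + ∫ F` gives bounds for `∫ F` and for `F`. -/
lemma abs_bounds_of_abs_add_integral_le {a φ : ℕ → ℝ} {K E s : ℝ} (h : MulLike a φ K)
    (hb : ∀ t, 0 ≤ t → t ≤ s →
      |(t + 1) * meanVal a t + ∫ t' in (0 : ℝ)..t, meanVal a t'| ≤ E)
    {q : ℝ} (hq : 0 ≤ q) (hqs : q ≤ s) : (q + 1) * |meanVal a q| ≤ 2 * E := by
  have h1 : |∫ t in (0 : ℝ)..q, ((t + 1) * meanVal a t + ∫ t' in (0 : ℝ)..t, meanVal a t')|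
      ≤ E * |q - 0| := by
    rw [← Real.norm_eq_abs]
    refine intervalIntegral.norm_integral_le_of_norm_le_const fun t ht => ?_
    rw [Set.uIoc_of_le hq] at ht
    exact hb t ht.1.le (ht.2.trans hqs)
  rw [← add_one_mul_integral_meanVal h, abs_mul, sub_zero, abs_of_nonneg hq,
    abs_of_pos (by linarith : 0 < q + 1)] at h1
  have hE : 0 ≤ E := (abs_nonneg _).trans (hb q hq hqs)
  have h2 : |∫ t in (0 : ℝ)..q, meanVal a t| ≤ E := by
    refine le_of_mul_le_mul_left (h1.trans ?_) (by linarith : 0 < q + 1)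
    nlinarith
  have h3 := hb q hq hqs
  have h4 := abs_sub ((q + 1) * meanVal a q + ∫ t' in (0 : ℝ)..q, meanVal a t')
    (∫ t' in (0 : ℝ)..q, meanVal a t')
  rw [add_sub_cancel_right, abs_mul, abs_of_pos (by linarith : 0 < q + 1)] at h4
  linarith

/-- Smallness of a mean value in the `L¹` sense on `[0, s]` propagates to all later points. -/
lemma exists_abs_meanVal_le_integral : ∃ C : ℝ, 1 ≤ C ∧ ∀ (a φ : ℕ → ℝ) (K : ℝ), MulLike a φ K →
    ∀ s, 1 ≤ s → ∀ q, s ≤ q →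
      s * |meanVal a q| ≤ 2 * (∫ t in (0 : ℝ)..s, |meanVal a t|) + C * K := by
  obtain ⟨C, hC, hmain⟩ := exists_integral_inequality
  refine ⟨2 * C, by linarith, fun a φ K h s hs q hq => ?_⟩
  obtain ⟨I, hI⟩ : ∃ I, I = ∫ t in (0 : ℝ)..s, |meanVal a t| := ⟨_, rfl⟩
  rw [← hI]
  obtain ⟨A, hA⟩ : ∃ A, A = (fun t => |meanVal a t|) '' Set.Icc s q := ⟨_, rfl⟩
  have hbdd : BddAbove A := by
    refine ⟨K, ?_⟩
    rw [hA]; rintro _ ⟨t, -, rfl⟩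
    exact h.abs_meanVal_le t
  have hmem : ∀ t, s ≤ t → t ≤ q → |meanVal a t| ≤ sSup A := fun t h1 h2 =>
    le_csSup hbdd (by rw [hA]; exact ⟨t, ⟨h1, h2⟩, rfl⟩)
  have hne : A.Nonempty := by rw [hA]; exact ⟨_, q, ⟨hq, le_rfl⟩, rfl⟩
  have hm0 : 0 ≤ sSup A := (abs_nonneg _).trans (hmem q hq le_rfl)
  suffices hs' : s * sSup A ≤ 2 * I + 2 * C * K from
    (mul_le_mul_of_nonneg_left (hmem q hq le_rfl) (by linarith)).trans hs'
  refine le_of_forall_pos_le_add fun ε hε => ?_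
  have hq0 : 0 < q := by linarith
  obtain ⟨v, hv, hvA⟩ := exists_lt_of_lt_csSup hne (sub_lt_self (sSup A) (div_pos hε hq0))
  rw [hA] at hv
  obtain ⟨t, ⟨hst, htq⟩, rfl⟩ := hv
  have ht0 : 0 < t := by linarith
  have h1 := hmain a φ K h t ht0.le
  have hint : ∀ x y, IntervalIntegrable (fun z => (t - z) * |meanVal a z|) volume x y :=
    fun x y => (h.intervalIntegrable_abs x y).continuousOn_mul (by fun_prop)
  rw [← intervalIntegral.integral_add_adjacent_intervals (hint 0 s) (hint s t)] at h1
  have h2 : ∫ z in (0 : ℝ)..s, (t - z) * |meanVal a z| ≤ t * I := by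
    rw [hI, ← intervalIntegral.integral_const_mul]
    refine intervalIntegral.integral_mono_on (by linarith) (hint 0 s)
      ((h.intervalIntegrable_abs 0 s).const_mul t) fun z hz => ?_
    exact mul_le_mul_of_nonneg_right (by linarith [hz.1]) (abs_nonneg _)
  have h3 : ∫ z in s..t, (t - z) * |meanVal a z| ≤ sSup A * ((t - s) ^ 2 / 2) := by
    have e : ∫ z in s..t, (t - z) = (t - s) ^ 2 / 2 := by
      rw [intervalIntegral.integral_sub (by simp) (by simp), integral_id,
        intervalIntegral.integral_const, smul_eq_mul]
      ring
    rw [← e, ← intervalIntegral.integral_const_mul]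
    refine intervalIntegral.integral_mono_on hst (hint s t)
      (Continuous.intervalIntegrable (by fun_prop) _ _) fun z hz => ?_
    rw [mul_comm (sSup A)]
    exact mul_le_mul_of_nonneg_left (hmem z hz.1 (hz.2.trans htq)) (by linarith [hz.2])
  have hK : 0 ≤ K := h.nonneg
  have h4 : sSup A - ε / t ≤ |meanVal a t| := by
    refine le_trans ?_ hvA.le
    have : ε / q ≤ ε / t := div_le_div_of_nonneg_left hε.le ht0 htq
    linarith
  have h5 : t ^ 2 * (sSup A - ε / t) ≤ t ^ 2 * |meanVal a t| :=
    mul_le_mul_of_nonneg_left h4 (by positivity)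
  have e1 : t ^ 2 * (sSup A - ε / t) = t * (t * sSup A - ε) := by field_simp
  have hCK : 0 ≤ C * K := mul_nonneg (by linarith) hK
  have h6 : sSup A * (t - s) ^ 2 ≤ sSup A * (t * (t - s)) := by
    refine mul_le_mul_of_nonneg_left ?_ hm0
    nlinarith
  have h7 : C * K * (t + 1) ≤ C * K * (2 * t) :=
    mul_le_mul_of_nonneg_left (by linarith) hCK
  have h8 : t * (s * sSup A) ≤ t * (2 * I + 2 * C * K + ε) := by
    rw [e1] at h5
    nlinarith
  exact le_of_mul_le_mul_left h8 ht0

/-- The weight of the prime powers `n` in `(exp (r / U), exp (r / 2)]` with `f n` away from `-1`. -/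
noncomputable def midWeight (f : ℕ → ℝ) (r U : ℝ) : ℝ :=
  ∑ n ∈ upTo (exp (r / 2)) \ upTo (exp (r / U)), (1 + f n) * vM n / n

lemma BddMul.one_add_nonneg {f : ℕ → ℝ} (hf : BddMul f) {n : ℕ} (hn : 0 < n) : 0 ≤ 1 + f n := by
  linarith [(_root_.abs_le.1 (hf.abs_le n hn)).1]

lemma BddMul.weight_nonneg {f : ℕ → ℝ} (hf : BddMul f) {n : ℕ} (hn : 0 < n) :
    0 ≤ (1 + f n) * vM n / n :=
  div_nonneg (mul_nonneg (hf.one_add_nonneg hn) (vM_nonneg n)) n.cast_nonneg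

lemma BddMul.sum_weight_le {f : ℕ → ℝ} (hf : BddMul f) {C r U η : ℝ}
    (hC : ∀ x, 1 ≤ x → |∑ n ∈ upTo x, vM n / n - log x| ≤ C)
    (hr : 0 ≤ r) (hU : 2 ≤ U) (hW : midWeight f r U ≤ η * r) {t : ℝ} (ht : t ≤ r / 2) :
    ∑ n ∈ upTo (exp t), (1 + f n) * vM n / n ≤ η * r + 2 * (r / U + C) := by
  have h1 : ∑ n ∈ upTo (exp t), (1 + f n) * vM n / n
      ≤ ∑ n ∈ upTo (exp (r / 2)), (1 + f n) * vM n / n :=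
    Finset.sum_le_sum_of_subset_of_nonneg (upTo_subset (exp_le_exp.2 ht))
      fun n hn _ => hf.weight_nonneg (mem_upTo.1 hn).1
  have h2 : upTo (exp (r / U)) ⊆ upTo (exp (r / 2)) :=
    upTo_subset (exp_le_exp.2 (div_le_div_of_nonneg_left hr (by norm_num) hU))
  rw [← Finset.sum_sdiff h2] at h1
  have h3 : ∑ n ∈ upTo (exp (r / U)), (1 + f n) * vM n / n
      ≤ 2 * ∑ n ∈ upTo (exp (r / U)), vM n / n := by
    rw [Finset.mul_sum]
    refine Finset.sum_le_sum fun n hn => ?_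
    rw [mul_div_assoc]
    exact mul_le_mul_of_nonneg_right
      (by linarith [(_root_.abs_le.1 (hf.abs_le n (mem_upTo.1 hn).1)).2])
      (div_nonneg (vM_nonneg n) n.cast_nonneg)
  have h4 := (_root_.abs_le.1 (hC _ (one_le_exp (by positivity : 0 ≤ r / U)))).2
  rw [log_exp] at h4
  rw [midWeight] at hW
  linarith

lemma BddMul.abs_weighted_sum_le {f : ℕ → ℝ} (hf : BddMul f) (t : ℝ) :
    |∑ n ∈ upTo (exp t), (1 + f n) * vM n / n * meanVal f (t - log n)|
      ≤ ∑ n ∈ upTo (exp t), (1 + f n) * vM n / n := by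
  refine (Finset.abs_sum_le_sum_abs _ _).trans (Finset.sum_le_sum fun n hn => ?_)
  have h := hf.weight_nonneg (mem_upTo.1 hn).1
  rw [abs_mul, abs_of_nonneg h]
  exact mul_le_of_le_one_right h (hf.abs_meanVal_le_one _)

/-- If most of the primes in a middle range have `f p` close to `-1`, all later mean values
of `f` are small. -/
lemma exists_abs_meanVal_le_of_midWeight : ∃ γ C : ℝ, 0 < γ ∧ γ ≤ 1 / 2 ∧ 1 ≤ C ∧
    ∀ f : ℕ → ℝ, BddMul f → ∀ r U η : ℝ, 2 ≤ r → 2 ≤ U → 0 ≤ η → midWeight f r U ≤ η * r →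
      ∀ q, r / 2 ≤ q → |meanVal f q| ≤ C * (1 / U + η + r ^ (-γ)) * (1 + log U) := by
  obtain ⟨C1, hC1, hM⟩ := exists_mertens
  obtain ⟨γ, C2, hγ, hγ1, hC2, hS⟩ := exists_mul_meanVal_add_logSum
  obtain ⟨C3, hC3, hI⟩ := exists_abs_meanVal_le_integral
  obtain ⟨C4, hC4⟩ : ∃ C4, C4 = 2 + 2 * C1 + 2 * C2 := ⟨_, rfl⟩
  refine ⟨γ, 4 + 8 * C4 + 4 * C3, hγ, hγ1, by linarith, fun f hf r U η hr hU hη hW q hq => ?_⟩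
  obtain ⟨B, hB⟩ : ∃ B, B = 1 / U + η + r ^ (-γ) := ⟨_, rfl⟩
  have hr0 : 0 < r := by linarith
  have hpow0 : 0 < r ^ (-γ) := rpow_pos_of_pos hr0 _
  have hpow : r ^ (1 - γ) = r * r ^ (-γ) := by
    rw [sub_eq_add_neg, rpow_one_add' hr0.le (by linarith)]
  have hUi : 0 < 1 / U := by positivity
  have hB0 : 0 < B := by rw [hB]; positivity
  have hrB : r / U ≤ r * B := by
    rw [hB, div_eq_mul_one_div]
    exact mul_le_mul_of_nonneg_left (by linarith) hr0.le
  have hrB2 : 1 ≤ r * B := by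
    have h1 : 1 ≤ r ^ (1 - γ) := one_le_rpow (by linarith) (by linarith)
    rw [hpow] at h1
    refine h1.trans (mul_le_mul_of_nonneg_left ?_ hr0.le)
    linarith
  have hE : ∀ t, 0 ≤ t → t ≤ r / 2 →
      |(t + 1) * meanVal f t + ∫ t' in (0 : ℝ)..t, meanVal f t'| ≤ C4 * r * B := by
    intro t ht htr
    have e : (t + 1) * meanVal f t + ∫ t' in (0 : ℝ)..t, meanVal f t'
        = t * meanVal f t + logSum f t := by
      rw [logSum, sum_div_eq_meanVal_add_integral f ht]; ring
    rw [e]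
    have h1 := hS f hf t ht
    have h2 := hf.abs_weighted_sum_le t
    have h3 := hf.sum_weight_le hM hr0.le hU hW htr
    have h4 : (1 + t) ^ (1 - γ) ≤ 2 * r ^ (1 - γ) := by
      calc (1 + t) ^ (1 - γ) ≤ (2 * r) ^ (1 - γ) :=
            rpow_le_rpow (by linarith) (by linarith) (by linarith)
        _ = 2 ^ (1 - γ) * r ^ (1 - γ) := mul_rpow (by norm_num) hr0.le
        _ ≤ 2 ^ (1 : ℝ) * r ^ (1 - γ) := by
            refine mul_le_mul_of_nonneg_right ?_ (rpow_nonneg hr0.le _)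
            exact rpow_le_rpow_of_exponent_le (by norm_num) (by linarith)
        _ = _ := by rw [rpow_one]
    have h5 : C2 * (1 + t) ^ (1 - γ) ≤ C2 * (2 * r ^ (1 - γ)) :=
      mul_le_mul_of_nonneg_left h4 (by linarith)
    have h6 := abs_sub_abs_le_abs_sub (t * meanVal f t + logSum f t)
      (∑ n ∈ upTo (exp t), (1 + f n) * vM n / n * meanVal f (t - log n))
    have h7 : η * r + 2 * (r / U) + 2 * C2 * r ^ (1 - γ) + 2 * C1 ≤ C4 * r * B := by
      have a1 : r ^ (1 - γ) ≤ r * B := by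
        rw [hpow]
        refine mul_le_mul_of_nonneg_left ?_ hr0.le
        linarith
      have a2 : η * r + r / U ≤ r * B := by
        rw [hB, div_eq_mul_one_div]
        nlinarith [mul_pos hr0 hpow0]
      have a3 : C2 * r ^ (1 - γ) ≤ C2 * (r * B) := mul_le_mul_of_nonneg_left a1 (by linarith)
      have a4 : C1 * 1 ≤ C1 * (r * B) := mul_le_mul_of_nonneg_left hrB2 (by linarith)
      rw [hC4]
      linarith
    linarith
  have hC40 : 0 ≤ C4 := by rw [hC4]; linarith
  have hE0 : 0 ≤ C4 * r * B := mul_nonneg (mul_nonneg hC40 hr0.le) hB0.le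
  have hF : ∀ t, 0 < t → t ≤ r / 2 → |meanVal f t| ≤ 2 * (C4 * r * B) * t⁻¹ := by
    intro t ht htr
    have h1 := abs_bounds_of_abs_add_integral_le hf.mulLike hE ht.le htr
    rw [← div_eq_mul_inv, le_div_iff₀ ht]
    linarith [abs_nonneg (meanVal f t)]
  have hrU : 0 < r / U := by positivity
  have hrU2 : r / U ≤ r / 2 := div_le_div_of_nonneg_left hr0.le (by norm_num) hU
  have hint := hf.mulLike.intervalIntegrable_abs
  have hlogU : 0 ≤ log U := log_nonneg (by linarith)
  have hI1 : ∫ t in (0 : ℝ)..r / 2, |meanVal f t| ≤ r * B + 2 * (C4 * r * B) * log U := by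
    rw [← intervalIntegral.integral_add_adjacent_intervals (hint 0 (r / U)) (hint _ _)]
    refine add_le_add ?_ ?_
    · refine le_trans ?_ hrB
      calc _ ≤ ∫ _t in (0 : ℝ)..r / U, (1 : ℝ) :=
            intervalIntegral.integral_mono_on hrU.le (hint _ _) (by simp)
              fun t _ => hf.abs_meanVal_le_one t
        _ = _ := by simp
    · have hni : (0 : ℝ) ∉ Set.uIcc (r / U) (r / 2) := by
        rw [Set.uIcc_of_le hrU2]; exact fun h => absurd h.1 (not_le.2 hrU)
      calc _ ≤ ∫ t in (r / U)..(r / 2), 2 * (C4 * r * B) * t⁻¹ := by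
            refine intervalIntegral.integral_mono_on hrU2 (hint _ _)
              ((intervalIntegral.intervalIntegrable_inv (fun t ht h => hni (h ▸ ht))
                continuousOn_id).const_mul _)
              fun t ht => hF t (by linarith [ht.1]) ht.2
        _ = 2 * (C4 * r * B) * log (U / 2) := by
            rw [intervalIntegral.integral_const_mul, integral_inv hni]
            congr 2
            field_simp
        _ ≤ _ := mul_le_mul_of_nonneg_left
            (log_le_log (by positivity) (by linarith)) (by linarith)
  have h1 := hI f f 2 hf.mulLike (r / 2) (by linarith) q hq
  have h2 : r / 2 * |meanVal f q| ≤ r / 2 * ((4 + 8 * C4 + 4 * C3) * B * (1 + log U)) := by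
    have a1 : C3 * 1 ≤ C3 * (r * B) := mul_le_mul_of_nonneg_left hrB2 (by linarith)
    have a2 : 0 ≤ r * B * log U := by positivity
    have a3 : 0 ≤ C4 * (r * B) := by positivity
    have a4 : 0 ≤ C3 * (r * B * log U) := mul_nonneg (by linarith) a2
    nlinarith
  rw [← hB]
  exact le_of_mul_le_mul_left h2 (by linarith)

/-- The arithmetic function with values `f n` at `n ≠ 0`. -/
noncomputable def toArith (f : ℕ → ℝ) : ArithmeticFunction ℝ :=
  ⟨fun n => if n = 0 then 0 else f n, by simp⟩

lemma toArith_apply (f : ℕ → ℝ) {n : ℕ} (hn : 0 < n) : toArith f n = f n := by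
  simp [toArith, hn.ne']

/-- The divisor sum `n ↦ ∑ d ∣ n, f d`. -/
noncomputable def divSum (f : ℕ → ℝ) : ArithmeticFunction ℝ :=
  toArith f * (ArithmeticFunction.zeta : ArithmeticFunction ℝ)

lemma pmul_log_mul (u v : ArithmeticFunction ℝ) :
    (u * v).pmul ArithmeticFunction.log
      = u.pmul ArithmeticFunction.log * v + u * v.pmul ArithmeticFunction.log := by
  ext n
  simp only [ArithmeticFunction.pmul_apply, ArithmeticFunction.mul_apply,
    ArithmeticFunction.add_apply, ArithmeticFunction.log_apply, Finset.sum_mul]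
  rw [← Finset.sum_add_distrib]
  refine Finset.sum_congr rfl fun p hp => ?_
  obtain ⟨h1, h2⟩ := Nat.mem_divisorsAntidiagonal.1 hp
  rw [← h1] at h2 ⊢
  obtain ⟨h3, h4⟩ := mul_ne_zero_iff.1 h2
  rw [Nat.cast_mul, log_mul (by exact_mod_cast h3) (by exact_mod_cast h4)]
  ring

variable {f : ℕ → ℝ}

lemma pos_of_mem_antidiagonal {n : ℕ} {p : ℕ × ℕ} (hp : p ∈ n.divisorsAntidiagonal) :
    0 < p.1 ∧ 0 < p.2 := by
  obtain ⟨h1, h2⟩ := Nat.mem_divisorsAntidiagonal.1 hp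
  rw [← h1] at h2
  exact ⟨Nat.pos_of_ne_zero (left_ne_zero_of_mul h2), Nat.pos_of_ne_zero (right_ne_zero_of_mul h2)⟩

lemma BddMul.divSum_mul_log (hf : BddMul f) (n : ℕ) :
    divSum f n * log n = ∑ p ∈ n.divisorsAntidiagonal, (1 + f p.1) * vM p.1 * divSum f p.2 := by
  have h1 : (toArith f).pmul ArithmeticFunction.log
      = toArith (fun n => f n * vM n) * toArith f := by
    ext n
    rcases Nat.eq_zero_or_pos n with rfl | hn
    · simp
    rw [ArithmeticFunction.pmul_apply, toArith_apply f hn, ArithmeticFunction.log_apply,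
      ← sum_vM_antidiagonal hf n, ArithmeticFunction.mul_apply]
    refine Finset.sum_congr rfl fun p hp => ?_
    obtain ⟨h1, h2⟩ := pos_of_mem_antidiagonal hp
    rw [toArith_apply _ h1, toArith_apply _ h2]
  have h2 : (ArithmeticFunction.zeta : ArithmeticFunction ℝ).pmul ArithmeticFunction.log
      = ArithmeticFunction.vonMangoldt * (ArithmeticFunction.zeta : ArithmeticFunction ℝ) := by
    rw [ArithmeticFunction.vonMangoldt_mul_zeta, ArithmeticFunction.zeta_pmul]
  have h3 : (divSum f).pmul ArithmeticFunction.log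
      = (toArith (fun n => f n * vM n) + ArithmeticFunction.vonMangoldt) * divSum f := by
    rw [divSum, pmul_log_mul, h1, h2]; ring
  have h4 := congrArg (fun u : ArithmeticFunction ℝ => u n) h3
  simp only [ArithmeticFunction.pmul_apply, ArithmeticFunction.log_apply,
    ArithmeticFunction.mul_apply] at h4
  rw [h4]
  refine Finset.sum_congr rfl fun p hp => ?_
  rw [ArithmeticFunction.add_apply, toArith_apply _ (pos_of_mem_antidiagonal hp).1, vM]
  ring

lemma geom_sum_nonneg {x : ℝ} (h : |x| ≤ 1) (k : ℕ) : 0 ≤ ∑ i ∈ range k, x ^ i := by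
  rcases eq_or_ne x 1 with rfl | hx
  · simp
  have h1 : x < 1 := lt_of_le_of_ne (abs_le.1 h).2 hx
  rw [geom_sum_eq hx]
  have h2 : x ^ k ≤ 1 := (le_abs_self _).trans (by rw [abs_pow]; exact pow_le_one₀ (abs_nonneg _) h)
  exact div_nonneg_of_nonpos (by linarith) (by linarith)

lemma BddMul.map_pow (hf : BddMul f) {p : ℕ} (hp : 0 < p) (k : ℕ) : f (p ^ k) = f p ^ k := by
  induction k with
  | zero => simp [hf.map_one]
  | succ k ih => rw [pow_succ, hf.map_mul _ _ (pow_pos hp k) hp, ih, pow_succ]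

lemma BddMul.divSum_nonneg (hf : BddMul f) (n : ℕ) : 0 ≤ divSum f n := by
  have hm : (divSum f).IsMultiplicative := by
    refine ArithmeticFunction.IsMultiplicative.mul ⟨?_, fun {m n} _ => ?_⟩
      (ArithmeticFunction.isMultiplicative_zeta.natCast)
    · rw [toArith_apply f one_pos, hf.map_one]
    · rcases Nat.eq_zero_or_pos m with rfl | hm
      · simp
      rcases Nat.eq_zero_or_pos n with rfl | hn
      · simp
      rw [toArith_apply f hm, toArith_apply f hn, toArith_apply f (Nat.mul_pos hm hn),
        hf.map_mul m n hm hn]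
  rcases Nat.eq_zero_or_pos n with rfl | hn
  · simp
  rw [hm.multiplicative_factorization _ hn.ne']
  refine Finset.prod_nonneg fun p hp => ?_
  have hpp : p.Prime := Nat.prime_of_mem_primeFactors hp
  change 0 ≤ divSum f (p ^ n.factorization p)
  rw [divSum, ArithmeticFunction.coe_mul_zeta_apply, Nat.sum_divisors_prime_pow hpp]
  refine (geom_sum_nonneg (hf.abs_le p hpp.pos) (n.factorization p + 1)).trans_eq ?_
  refine Finset.sum_congr rfl fun i _ => ?_
  rw [toArith_apply f (pow_pos hpp.pos i), hf.map_pow hpp.pos]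

lemma summ_divSum (f : ℕ → ℝ) (x : ℝ) :
    summ (divSum f) x = ∑ n ∈ upTo x, f n * ⌊x / n⌋₊ := by
  have h := sum_upTo_conv (fun a _ => f a) x
  have h1 : summ (divSum f) x = ∑ n ∈ upTo x, ∑ p ∈ n.divisorsAntidiagonal, f p.1 := by
    refine Finset.sum_congr rfl fun n _ => ?_
    rw [divSum, ArithmeticFunction.mul_apply]
    refine Finset.sum_congr rfl fun p hp => ?_
    obtain ⟨h1, h2⟩ := pos_of_mem_antidiagonal hp
    rw [toArith_apply f h1, ArithmeticFunction.natCoe_apply,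
      ArithmeticFunction.zeta_apply_ne h2.ne']
    simp
  rw [h1, h]
  refine Finset.sum_congr rfl fun n _ => ?_
  simp [upTo, mul_comm]

/-- The defect between a logarithmic mean and the mean value of the divisor sum. -/
lemma meanVal_divSum_eq (f : ℕ → ℝ) (r : ℝ) :
    meanVal (divSum f) r
      = logSum f r - exp (-r) * ∑ n ∈ upTo (exp r), f n * Int.fract (exp r / n) := by
  rw [meanVal, summ_divSum, logSum, eq_sub_iff_add_eq, ← mul_add, ← Finset.sum_add_distrib,
    Finset.mul_sum]
  refine Finset.sum_congr rfl fun n _ => ?_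
  rw [← mul_add, natCast_floor_eq_intCast_floor (by positivity : (0 : ℝ) ≤ exp r / n),
    Int.floor_add_fract, exp_neg]
  field_simp

lemma BddMul.meanVal_divSum_nonneg (hf : BddMul f) (r : ℝ) : 0 ≤ meanVal (divSum f) r :=
  mul_nonneg (exp_pos _).le (Finset.sum_nonneg fun n _ => hf.divSum_nonneg n)

lemma BddMul.abs_defect_le (hf : BddMul f) (r : ℝ) :
    |exp (-r) * ∑ n ∈ upTo (exp r), f n * Int.fract (exp r / n)| ≤ 1 := by
  rw [abs_mul, abs_of_pos (exp_pos _), exp_neg, inv_mul_le_one₀ (exp_pos r)]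
  refine (Finset.abs_sum_le_sum_abs _ _).trans (le_trans (Finset.sum_le_sum fun n hn => ?_)
    (summ_one (exp_pos r).le))
  rw [abs_mul, abs_of_nonneg (Int.fract_nonneg (exp r / n))]
  exact mul_le_one₀ (hf.abs_le n (mem_upTo.1 hn).1) (Int.fract_nonneg _) (Int.fract_lt_one _).le

lemma BddMul.sum_weight_mul_meanVal_le (hf : BddMul f) (r : ℝ) :
    ∑ n ∈ upTo (exp r), (1 + f n) * vM n / n * meanVal (divSum f) (r - log n)
      ≤ r * meanVal (divSum f) r := by
  have h1 : ∑ n ∈ upTo (exp r), (1 + f n) * vM n / n * meanVal (divSum f) (r - log n)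
      = exp (-r) * ∑ n ∈ upTo (exp r), divSum f n * log n := by
    rw [Finset.sum_congr rfl fun n _ => hf.divSum_mul_log n,
      sum_upTo_conv (fun a b => (1 + f a) * vM a * divSum f b), Finset.mul_sum]
    refine Finset.sum_congr rfl fun n hn => ?_
    rw [← Finset.mul_sum, div_mul_eq_mul_div, mul_div_assoc,
      meanVal_sub_log _ r (mem_upTo.1 hn).1, summ, exp_neg]
    field_simp
  rw [h1, meanVal, summ, mul_left_comm]
  refine mul_le_mul_of_nonneg_left ?_ (exp_pos _).le
  rw [Finset.mul_sum]
  refine Finset.sum_le_sum fun n hn => ?_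
  rw [mul_comm]
  refine mul_le_mul_of_nonneg_right ?_ (hf.divSum_nonneg n)
  rw [← log_exp r]
  exact log_le_log (pos_of_mem_upTo hn) (le_of_mem_upTo hn)

/-- A large middle weight forces the mean value of the divisor sum not to decay much. -/
lemma BddMul.le_meanVal_divSum (hf : BddMul f) {r U η Q : ℝ} (hr : 0 < r)
    (hW : η * r ≤ midWeight f r U) (hQ : 0 ≤ Q)
    (h : ∀ q, r / 2 ≤ q → q ≤ r * (1 - 1 / U) → Q ≤ meanVal (divSum f) q) :
    Q * η ≤ meanVal (divSum f) r := by
  refine le_of_mul_le_mul_left ?_ hr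
  calc r * (Q * η) ≤ midWeight f r U * Q := by nlinarith
    _ ≤ ∑ n ∈ upTo (exp (r / 2)) \ upTo (exp (r / U)),
          (1 + f n) * vM n / n * meanVal (divSum f) (r - log n) := by
        rw [midWeight, Finset.sum_mul]
        refine Finset.sum_le_sum fun n hn => ?_
        obtain ⟨h1, h2⟩ := Finset.mem_sdiff.1 hn
        have hn0 := pos_of_mem_upTo h1
        refine mul_le_mul_of_nonneg_left (h _ ?_ ?_) (hf.weight_nonneg (mem_upTo.1 h1).1)
        · have := log_le_log hn0 (le_of_mem_upTo h1)
          rw [log_exp] at this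
          linarith
        · have h3 : exp (r / U) ≤ n := by
            by_contra hlt
            exact h2 (mem_upTo.2 ⟨(mem_upTo.1 h1).1, (not_le.1 hlt).le⟩)
          have := log_le_log (exp_pos _) h3
          rw [log_exp] at this
          have e : r * (1 - 1 / U) = r - r / U := by ring
          linarith
    _ ≤ ∑ n ∈ upTo (exp r), (1 + f n) * vM n / n * meanVal (divSum f) (r - log n) := by
        refine Finset.sum_le_sum_of_subset_of_nonneg
          (Finset.sdiff_subset.trans (upTo_subset (exp_le_exp.2 (by linarith)))) fun n hn _ =>
          mul_nonneg (hf.weight_nonneg (mem_upTo.1 hn).1) (hf.meanVal_divSum_nonneg _)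
    _ ≤ _ := hf.sum_weight_mul_meanVal_le r

lemma BddMul.le_meanVal_divSum_iterate {f : ℕ → ℝ} (hf : BddMul f) {R L U η Q : ℝ} (hR : 0 < R)
    (hU : 2 ≤ U) (hη : 0 ≤ η) (hη1 : η ≤ 1) (hQ : 0 ≤ Q)
    (hW : ∀ r, R ≤ r → r ≤ L → η * r ≤ midWeight f r U)
    (h : ∀ q, R / 2 ≤ q → q ≤ R → Q ≤ meanVal (divSum f) q) (k : ℕ) :
    ∀ r, R / 2 ≤ r → r ≤ L → r * (1 - 1 / U) ^ k ≤ R → Q * η ^ k ≤ meanVal (divSum f) r := by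
  have hU1 : 1 / U ≤ 1 / 2 := one_div_le_one_div_of_le (by norm_num) hU
  have hU0 : 0 < 1 / U := by positivity
  induction k with
  | zero => intro r h1 _ h3; simpa using h r h1 (by simpa using h3)
  | succ k ih =>
    intro r h1 h2 h3
    rcases le_or_gt r R with h4 | h4
    · exact (mul_le_of_le_one_right hQ (pow_le_one₀ hη hη1)).trans (h r h1 h4)
    rw [pow_succ, ← mul_assoc]
    refine hf.le_meanVal_divSum (by linarith) (hW r h4.le h2) (by positivity) fun q hq1 hq2 => ?_
    refine ih q (by linarith) (by nlinarith) (le_trans ?_ h3)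
    rw [pow_succ', ← mul_assoc]
    exact mul_le_mul_of_nonneg_right hq2 (pow_nonneg (by linarith) k)

/-- The defect between the logarithmic mean and the mean of the divisor sum is controlled by the
mean values of `f` near the endpoint. -/
lemma BddMul.abs_defect_le_of_abs_meanVal_le {f : ℕ → ℝ} (hf : BddMul f) {L m : ℝ} {J : ℕ}
    (hJ : 1 ≤ J) (hL : log J ≤ L) (hm : ∀ q, L - log J ≤ q → q ≤ L → |meanVal f q| ≤ m) :
    |exp (-L) * ∑ n ∈ upTo (exp L), f n * Int.fract (exp L / n)|
      ≤ 1 / J + m * (4 + 2 * log J) := by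
  obtain ⟨x, hx⟩ : ∃ x, x = exp L := ⟨_, rfl⟩
  have hx0 : 0 < x := by rw [hx]; exact exp_pos L
  have hJ0 : (0 : ℝ) < J := by exact_mod_cast hJ
  have hJ1 : (1 : ℝ) ≤ J := by exact_mod_cast hJ
  have hlJ : 0 ≤ log (J : ℝ) := log_nonneg hJ1
  have hlx : log x = L := by rw [hx, log_exp]
  have hyx : x / J ≤ x := div_le_self hx0.le hJ1
  have hexp : exp (L - log J) = x / J := by rw [exp_sub, exp_log hJ0, hx]
  have hsub : upTo (x / J) ⊆ upTo x := upTo_subset hyx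
  have hsumm : ∀ j : ℕ, 1 ≤ j → j ≤ J → |summ f (x / j)| ≤ m * x * (1 / j) := by
    intro j hj hjJ
    have hj0 : (0 : ℝ) < j := by exact_mod_cast hj
    have h1 := mul_meanVal_log f (div_pos hx0 hj0)
    rw [← h1, abs_mul, abs_of_pos (div_pos hx0 hj0), log_div hx0.ne' hj0.ne', hlx]
    have h2 := hm (L - log j)
      (by linarith [log_le_log hj0 (by exact_mod_cast hjJ : (j : ℝ) ≤ J)])
      (by linarith [log_natCast_nonneg j])
    calc x / j * |meanVal f (L - log j)| ≤ x / j * m :=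
          mul_le_mul_of_nonneg_left h2 (div_pos hx0 hj0).le
      _ = _ := by ring
  have h1 : |∑ n ∈ upTo (x / J), f n * Int.fract (x / n)| ≤ x / J := by
    refine (Finset.abs_sum_le_sum_abs _ _).trans (le_trans (Finset.sum_le_sum fun n hn => ?_)
      (summ_one (div_pos hx0 hJ0).le))
    rw [abs_mul, abs_of_nonneg (Int.fract_nonneg (x / n))]
    exact mul_le_one₀ (hf.abs_le n (mem_upTo.1 hn).1) (Int.fract_nonneg _) (Int.fract_lt_one _).le
  have h2 : |∑ n ∈ upTo x \ upTo (x / J), f n / n| ≤ m * (2 + log J) := by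
    have e : ∑ n ∈ upTo x \ upTo (x / J), f n / n
        = meanVal f L - meanVal f (L - log J) + ∫ q in (L - log J)..L, meanVal f q := by
      have e1 := sum_div_eq_meanVal_add_integral f (by linarith : 0 ≤ L)
      have e2 := sum_div_eq_meanVal_add_integral f (by linarith : 0 ≤ L - log J)
      have e3 := intervalIntegral.integral_add_adjacent_intervals
        (hf.mulLike.intervalIntegrable 0 (L - log J)) (hf.mulLike.intervalIntegrable _ L)
      have e4 := Finset.sum_sdiff (f := fun n : ℕ => f n / n) hsub
      rw [hexp] at e2
      rw [← hx] at e1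
      linarith
    have h3 : |∫ q in (L - log J)..L, meanVal f q| ≤ m * |L - (L - log J)| := by
      rw [← Real.norm_eq_abs]
      refine intervalIntegral.norm_integral_le_of_norm_le_const fun q hq => ?_
      rw [Set.uIoc_of_le (by linarith)] at hq
      exact hm q hq.1.le hq.2
    rw [sub_sub_cancel, abs_of_nonneg hlJ] at h3
    have h4 := hm L (by linarith) le_rfl
    have h5 := hm (L - log J) le_rfl (by linarith)
    rw [e]
    have h6 := abs_add_le (meanVal f L - meanVal f (L - log J))
      (∫ q in (L - log J)..L, meanVal f q)
    have h7 := abs_sub (meanVal f L) (meanVal f (L - log J))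
    linarith
  have h3 : |∑ n ∈ upTo x \ upTo (x / J), f n * ⌊x / n⌋₊| ≤ m * x * (2 + log J) := by
    have e : ∑ n ∈ upTo x \ upTo (x / J), f n * ⌊x / n⌋₊
        = ∑ j ∈ Finset.Ico 1 J, (summ f (x / j) - summ f (x / J)) := by
      have e1 : ∀ n ∈ upTo x \ upTo (x / J), f n * ⌊x / n⌋₊
          = ∑ j ∈ Finset.Ico 1 J, if (n : ℝ) ≤ x / j then f n else 0 := by
        intro n hn
        obtain ⟨hn1, hn2⟩ := Finset.mem_sdiff.1 hn
        have hn0 := pos_of_mem_upTo hn1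
        have hnJ : x / n < J := by
          rw [div_lt_comm₀ hn0 hJ0]
          by_contra hlt
          exact hn2 (mem_upTo.2 ⟨(mem_upTo.1 hn1).1, not_lt.1 hlt⟩)
        rw [← Finset.sum_filter, Finset.sum_const, nsmul_eq_mul, mul_comm]
        congr 2
        have e2 : (Finset.Ico 1 J).filter (fun j : ℕ => (n : ℝ) ≤ x / j)
            = Finset.Icc 1 ⌊x / n⌋₊ := by
          ext j
          simp only [Finset.mem_filter, Finset.mem_Ico, Finset.mem_Icc]
          constructor
          · rintro ⟨⟨a1, _⟩, a3⟩
            refine ⟨a1, Nat.le_floor ?_⟩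
            rwa [le_div_comm₀ hn0 (by exact_mod_cast a1)] at a3
          · rintro ⟨a1, a2⟩
            have a3 := (Nat.le_floor_iff (div_pos hx0 hn0).le).1 a2
            refine ⟨⟨a1, by exact_mod_cast a3.trans_lt hnJ⟩, ?_⟩
            rwa [le_div_comm₀ hn0 (by exact_mod_cast a1)]
        rw [e2, Nat.card_Icc, Nat.add_sub_cancel]
      rw [Finset.sum_congr rfl e1, Finset.sum_comm]
      refine Finset.sum_congr rfl fun j hj => ?_
      obtain ⟨hj1, hj2⟩ := Finset.mem_Ico.1 hj
      have hj0 : (0 : ℝ) < j := by exact_mod_cast hj1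
      have hs : upTo (x / J) ⊆ upTo (x / j) :=
        upTo_subset (div_le_div_of_nonneg_left hx0.le hj0 (by exact_mod_cast hj2.le))
      rw [← Finset.sum_filter, summ, summ, ← Finset.sum_sdiff hs, add_sub_cancel_right]
      refine Finset.sum_congr ?_ fun _ _ => rfl
      have hjx : x / j ≤ x := div_le_self hx0.le (by exact_mod_cast hj1)
      ext n
      simp only [Finset.mem_filter, Finset.mem_sdiff, mem_upTo]
      constructor
      · rintro ⟨⟨⟨a1, _⟩, a3⟩, a4⟩
        exact ⟨⟨a1, a4⟩, a3⟩
      · rintro ⟨⟨a1, a2⟩, a3⟩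
        exact ⟨⟨⟨a1, a2.trans hjx⟩, a3⟩, a2⟩
    have hm0 : 0 ≤ m := (abs_nonneg _).trans (hm L (by linarith) le_rfl)
    rw [e]
    calc _ ≤ ∑ j ∈ Finset.Ico 1 J, (m * x * (1 / j) + m * x * (1 / J)) := by
          refine (Finset.abs_sum_le_sum_abs _ _).trans (Finset.sum_le_sum fun j hj => ?_)
          obtain ⟨hj1, hj2⟩ := Finset.mem_Ico.1 hj
          exact (abs_sub _ _).trans (add_le_add (hsumm j hj1 hj2.le) (hsumm J hJ le_rfl))
      _ ≤ m * x * (1 + log J) + m * x * 1 := by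
          rw [Finset.sum_add_distrib, ← Finset.mul_sum]
          refine add_le_add (mul_le_mul_of_nonneg_left ?_ (by positivity)) ?_
          · refine le_trans (Finset.sum_le_sum_of_subset_of_nonneg ?_ fun _ _ _ => by positivity)
              (sum_inv_upTo_le hJ1)
            intro j hj
            obtain ⟨hj1, hj2⟩ := Finset.mem_Ico.1 hj
            exact mem_upTo.2 ⟨hj1, by exact_mod_cast hj2.le⟩
          · rw [Finset.sum_const, Nat.card_Ico, nsmul_eq_mul, mul_left_comm]
            refine mul_le_mul_of_nonneg_left ?_ (by positivity)
            rw [mul_one_div, div_le_one hJ0]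
            exact_mod_cast Nat.sub_le J 1
      _ = _ := by ring
  have h4 : ∑ n ∈ upTo x \ upTo (x / J), f n * Int.fract (x / n)
      = x * ∑ n ∈ upTo x \ upTo (x / J), f n / n
        - ∑ n ∈ upTo x \ upTo (x / J), f n * ⌊x / n⌋₊ := by
    rw [Finset.mul_sum, ← Finset.sum_sub_distrib]
    refine Finset.sum_congr rfl fun n _ => ?_
    rw [natCast_floor_eq_intCast_floor (by positivity : (0 : ℝ) ≤ x / n), Int.fract]
    ring
  rw [← hx, ← Finset.sum_sdiff hsub, h4, abs_mul, abs_of_pos (exp_pos _), exp_neg, ← hx,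
    inv_mul_le_iff₀ hx0]
  have h5 := abs_add_le (x * ∑ n ∈ upTo x \ upTo (x / J), f n / n
        - ∑ n ∈ upTo x \ upTo (x / J), f n * ⌊x / n⌋₊)
      (∑ n ∈ upTo (x / J), f n * Int.fract (x / n))
  have h6 := abs_sub (x * ∑ n ∈ upTo x \ upTo (x / J), f n / n)
    (∑ n ∈ upTo x \ upTo (x / J), f n * ⌊x / n⌋₊)
  rw [abs_mul, abs_of_pos hx0] at h6
  have h7 := mul_le_mul_of_nonneg_left h2 hx0.le
  have e : x * (1 / J + m * (4 + 2 * log J))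
      = x / J + x * (m * (2 + log J)) + m * x * (2 + log J) := by ring
  rw [e]
  linarith

lemma BddMul.meanVal_divSum_le {f : ℕ → ℝ} (hf : BddMul f) (r : ℝ) :
    meanVal (divSum f) r ≤ logSum f r + 1 := by
  rw [meanVal_divSum_eq]
  linarith [(_root_.abs_le.1 (hf.abs_defect_le r)).1]

lemma BddMul.logSum_le_meanVal_divSum {f : ℕ → ℝ} (hf : BddMul f) (r : ℝ) :
    logSum f r - 1 ≤ meanVal (divSum f) r := by
  rw [meanVal_divSum_eq]
  linarith [(_root_.abs_le.1 (hf.abs_defect_le r)).2]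

/-- A negative logarithmic mean forces a large mean value near the endpoint. -/
lemma BddMul.exists_large_meanVal {f : ℕ → ℝ} (hf : BddMul f) {l : ℝ} (hl : 4 ≤ l)
    (h1 : 1 ≤ log l) (h4 : 25 * log l ≤ l ^ (1 / 20 : ℝ)) (h5 : 16 * l ≤ exp l)
    (hneg : logSum f (exp l) < -l ^ (-(3 / 5) : ℝ)) :
    ∃ q, exp l / 2 ≤ q ∧ q ≤ exp l ∧ l ^ (-(13 / 20) : ℝ) < |meanVal f q| := by
  have hl0 : 0 < l := by linarith
  obtain ⟨δ, hδ⟩ : ∃ δ, δ = l ^ (-(3 / 5) : ℝ) := ⟨_, rfl⟩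
  have hδ0 : 0 < δ := by rw [hδ]; exact rpow_pos_of_pos hl0 _
  have hδ1 : δ ≤ 1 := by rw [hδ]; exact rpow_le_one_of_one_le_of_nonpos (by linarith) (by norm_num)
  have hδl : log δ = -(3 / 5) * log l := by rw [hδ, log_rpow hl0]
  obtain ⟨J, hJ⟩ : ∃ J, J = ⌈4 / δ⌉₊ := ⟨_, rfl⟩
  have hJ4 : 4 / δ ≤ J := by rw [hJ]; exact Nat.le_ceil _
  have h4δ : 4 ≤ 4 / δ := by rw [le_div_iff₀ hδ0]; linarith
  have hJ8 : (J : ℝ) ≤ 8 / δ := by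
    have := (Nat.ceil_lt_add_one (by positivity : 0 ≤ 4 / δ)).le
    rw [← hJ] at this
    have e : 8 / δ = 4 / δ + 4 / δ := by ring
    linarith
  have hJ0 : (0 : ℝ) < J := by linarith
  have hlog8 : log 8 ≤ 3 := by
    have : (8 : ℝ) = 2 ^ (3 : ℕ) := by norm_num
    rw [this, log_pow]
    have := log_two_lt_d9
    push_cast; linarith
  have hlogJ : log J ≤ 3 + 3 / 5 * log l := by
    have := log_le_log hJ0 hJ8
    rw [log_div (by norm_num) hδ0.ne', hδl] at this
    linarith
  have hll : log l ≤ l := (log_le_sub_one_of_pos hl0).trans (by linarith)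
  by_contra! hcon
  have hd := hf.abs_defect_le_of_abs_meanVal_le (L := exp l) (m := l ^ (-(13 / 20) : ℝ)) (J := J)
    (by exact_mod_cast (by linarith : (1 : ℝ) ≤ J)) (by linarith)
    fun q hq1 hq2 => hcon q (by linarith) hq2
  have hG := hf.meanVal_divSum_nonneg (exp l)
  rw [meanVal_divSum_eq] at hG
  have hneg' := (_root_.abs_le.1 hd).1
  have e1 : 1 / (J : ℝ) ≤ δ / 4 := by
    rw [div_le_div_iff₀ hJ0 (by norm_num)]
    rw [div_le_iff₀ hδ0] at hJ4
    linarith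
  have hp : 0 < l ^ (-(13 / 20) : ℝ) := rpow_pos_of_pos hl0 _
  have e2 : l ^ (-(13 / 20) : ℝ) * (4 + 2 * log J) ≤ δ / 2 := by
    have e3 : δ = l ^ (-(13 / 20) : ℝ) * l ^ (1 / 20 : ℝ) := by
      rw [hδ, ← rpow_add hl0]; norm_num
    rw [e3]
    have : 4 + 2 * log J ≤ l ^ (1 / 20 : ℝ) / 2 := by linarith
    have := mul_le_mul_of_nonneg_left this hp.le
    linarith
  rw [← hδ] at hneg
  linarith

/-- A large mean value forces large mean values of the divisor sum on an earlier block. -/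
lemma exists_large_divSum : ∃ κ C : ℝ, 1 ≤ κ ∧ 1 ≤ C ∧ ∀ (f : ℕ → ℝ), BddMul f →
    ∀ l q : ℝ, 1 ≤ l → C * l ^ (κ + 1) ≤ exp (l / 2) → exp l / 2 ≤ q → q ≤ exp l →
      2 / l ≤ |meanVal f q| →
      ∃ R, exp l * l ^ (-κ) / 8 ≤ R ∧ R ≤ exp l / 4 ∧
        ∀ r, R / 2 ≤ r → r ≤ R → exp (l / 2) ≤ meanVal (divSum f) r := by
  obtain ⟨γ, hγ, hγ1, h⟩ := exists_near_max
  obtain ⟨C, hC, hmax⟩ := h 2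
  have hκ1 : 1 ≤ 1 / γ := by rw [le_div_iff₀ hγ]; linarith
  refine ⟨1 / γ, 256 + 2 * C, hκ1, by linarith, fun f hf l q hl hlC hq1 hq2 hF => ?_⟩
  obtain ⟨κ, hκ⟩ : ∃ κ, κ = 1 / γ := ⟨_, rfl⟩
  rw [← hκ] at hlC hκ1 ⊢
  have hl0 : 0 < l := by linarith
  have he0 := exp_pos (l / 2)
  have hee : exp l = exp (l / 2) * exp (l / 2) := by rw [← exp_add]; ring_nf
  have hp1 : 1 ≤ l ^ (κ + 1) := one_le_rpow hl (by linarith)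
  have he : 256 ≤ exp (l / 2) := by nlinarith
  have hq256 : 4 ≤ q := by nlinarith
  have hq0 : 0 < q := by linarith
  have hsq : √q * √q = q := mul_self_sqrt hq0.le
  have hs1 : 1 ≤ √q := by rw [one_le_sqrt]; linarith
  have hse : exp (l / 2) / 2 ≤ √q := by
    refine le_sqrt_of_sq_le ?_
    nlinarith
  obtain ⟨R, hR1, hR2, hR3, hR4⟩ := hmax f f hf.mulLike (√q) q hs1 (by nlinarith)
  have hR0 : 0 < R := by linarith
  have hFR : 1 / l ≤ |meanVal f R| := by
    have h1 : R ^ γ * |meanVal f R| ≤ q ^ γ * |meanVal f R| :=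
      mul_le_mul_of_nonneg_right (rpow_le_rpow hR0.le hR2 hγ.le) (abs_nonneg _)
    have h2 : |meanVal f q| ≤ 2 * |meanVal f R| := by
      refine le_of_mul_le_mul_left ?_ (rpow_pos_of_pos hq0 γ)
      linarith
    have e : 2 / l = 2 * (1 / l) := by ring
    linarith
  have hRq : q * l ^ (-κ) ≤ R := by
    have h1 : (q * l ^ (-κ)) ^ γ ≤ R ^ γ := by
      rw [mul_rpow hq0.le (rpow_nonneg hl0.le _), ← rpow_mul hl0.le]
      have e : -κ * γ = -1 := by rw [hκ]; field_simp
      rw [e, rpow_neg_one, ← one_div]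
      have h2 : R ^ γ * |meanVal f R| ≤ R ^ γ * 1 :=
        mul_le_mul_of_nonneg_left (hf.abs_meanVal_le_one R) (rpow_nonneg hR0.le _)
      have h3 := mul_le_mul_of_nonneg_left hF (rpow_nonneg hq0.le γ)
      have e : q ^ γ * (2 / l) = 2 * (q ^ γ * (1 / l)) := by ring
      linarith
    exact (rpow_le_rpow_iff (mul_nonneg hq0.le (rpow_nonneg hl0.le _)) hR0.le hγ).1 h1
  obtain ⟨A, hA⟩ : ∃ A, A = l ^ (κ + 1) := ⟨_, rfl⟩
  have hA0 : 0 < A := by linarith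
  have hRF : q / A ≤ R * |meanVal f R| := by
    have e : q / A = q * l ^ (-κ) * (1 / l) := by
      rw [hA, rpow_neg hl0.le, rpow_add_one hl0.ne']
      field_simp
    rw [e]
    exact mul_le_mul hRq hFR (by positivity) hR0.le
  rw [← hA] at hlC
  have hqA : exp l / (2 * A) ≤ q / A := by
    rw [div_le_div_iff₀ (by positivity) hA0]
    nlinarith
  have hbig : (128 + C) * exp (l / 2) ≤ exp l / (2 * A) := by
    rw [le_div_iff₀ (by positivity), hee]
    nlinarith
  have hcond : C * √q ≤ R * |meanVal f R| := by
    have h1 : √q ≤ exp (l / 2) := sqrt_le_iff.2 ⟨he0.le, by linarith [sq (exp (l / 2))]⟩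
    have h2 := mul_le_mul_of_nonneg_left h1 (by linarith : 0 ≤ C)
    linarith
  have hsmall : exp (l / 2) + 2 ≤ R * |meanVal f R| / 32 := by
    have := mul_pos (by linarith : 0 < C) he0
    linarith
  refine ⟨R / 4, ?_, by linarith, fun r hr1 hr2 => ?_⟩
  · have := mul_le_mul_of_nonneg_right hq1 (rpow_nonneg hl0.le (-κ))
    linarith
  have hr0 : 0 ≤ r := by linarith
  have hid : logSum f r = meanVal f r + ∫ q in (0 : ℝ)..r, meanVal f q :=
    sum_div_eq_meanVal_add_integral f hr0
  have hF1 := _root_.abs_le.1 (hf.abs_meanVal_le_one r)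
  have hG := hf.logSum_le_meanVal_divSum r
  rcases hR4 hcond with hpos | hneg
  · linarith [hpos r (by linarith) hr2, hF1.1]
  · linarith [hneg r (by linarith) hr2, hF1.2, hf.meanVal_divSum_le r,
      hf.meanVal_divSum_nonneg r]

lemma eventually_mul_log_le {C s : ℝ} (hs : 0 < s) : ∀ᶠ l in Filter.atTop, C * log l ≤ l ^ s := by
  have h := (isLittleO_log_rpow_atTop hs).def (c := (|C| + 1)⁻¹) (by positivity)
  filter_upwards [h, Filter.eventually_ge_atTop 1] with l h1 h2
  have h3 : 0 ≤ log l := log_nonneg h2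
  rw [norm_of_nonneg h3, norm_of_nonneg (rpow_nonneg (by linarith) _),
    inv_mul_eq_div, le_div_iff₀ (by positivity)] at h1
  nlinarith [le_abs_self C]

lemma eventually_mul_log_sq_le {C s : ℝ} (hs : 0 < s) :
    ∀ᶠ l in Filter.atTop, C * (log l) ^ 2 ≤ l ^ s := by
  filter_upwards [eventually_mul_log_le (C := |C| + 1) (half_pos hs),
    Filter.eventually_ge_atTop 1] with l h1 h2
  have h3 : 0 ≤ log l := log_nonneg h2
  have h4 : l ^ s = l ^ (s / 2) * l ^ (s / 2) := by rw [← rpow_add (by linarith)]; ring_nf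
  have h5 : 0 ≤ |C| := abs_nonneg C
  rw [h4]
  calc C * (log l) ^ 2 ≤ ((|C| + 1) * log l) * ((|C| + 1) * log l) := by
        have : C ≤ (|C| + 1) * (|C| + 1) := by nlinarith [le_abs_self C]
        nlinarith [sq_nonneg (log l)]
    _ ≤ _ := mul_le_mul h1 h1 (by positivity) (rpow_nonneg (by linarith) _)

lemma eventually_mul_rpow_le_exp {C s b : ℝ} (hb : 0 < b) :
    ∀ᶠ l in Filter.atTop, C * l ^ s ≤ exp (b * l) := by
  have h := (isLittleO_rpow_exp_pos_mul_atTop s hb).def (c := (|C| + 1)⁻¹) (by positivity)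
  filter_upwards [h, Filter.eventually_ge_atTop 1] with l h1 h2
  have h3 : 0 ≤ l ^ s := rpow_nonneg (by linarith) _
  rw [norm_of_nonneg h3, norm_of_nonneg (exp_pos _).le,
    inv_mul_eq_div, le_div_iff₀ (by positivity)] at h1
  nlinarith [le_abs_self C]

/-- Iterating the lower bound for the divisor sum from a large block up to the endpoint. -/
lemma BddMul.one_lt_meanVal_divSum {f : ℕ → ℝ} (hf : BddMul f) {κ l R : ℝ} (hκ : 1 ≤ κ)
    (hl : 4 ≤ l) (h1 : 1 ≤ log l) (h6 : 4 * (4 + κ) * (log l) ^ 2 ≤ l ^ (1 / 4 : ℝ))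
    (hR1 : exp l * l ^ (-κ) / 8 ≤ R) (hR2 : R ≤ exp l / 4)
    (hR : ∀ r, R / 2 ≤ r → r ≤ R → exp (l / 2) ≤ meanVal (divSum f) r)
    (hW : ∀ r, R ≤ r → r ≤ exp l → l ^ (-(3 / 4) : ℝ) * r ≤ midWeight f r (l ^ (3 / 4 : ℝ))) :
    1 < meanVal (divSum f) (exp l) := by
  have hl0 : 0 < l := by linarith
  have hlκ := rpow_pos_of_pos hl0 (-κ)
  have hR0 : 0 < R := lt_of_lt_of_le (by positivity) hR1
  obtain ⟨U, hU⟩ : ∃ U, U = l ^ (3 / 4 : ℝ) := ⟨_, rfl⟩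
  have hη : l ^ (-(3 / 4) : ℝ) = 1 / U := by rw [hU, rpow_neg hl0.le, one_div]
  have hU2 : 2 ≤ U := by
    rw [hU]
    calc (2 : ℝ) = 4 ^ (1 / 2 : ℝ) := by
          rw [← sqrt_eq_rpow, show (4 : ℝ) = 2 ^ 2 by norm_num, sqrt_sq (by norm_num)]
      _ ≤ 4 ^ (3 / 4 : ℝ) := rpow_le_rpow_of_exponent_le (by norm_num) (by norm_num)
      _ ≤ _ := rpow_le_rpow (by norm_num) hl (by norm_num)
  have hU0 : 0 < U := by linarith
  have hη1 : 1 / U ≤ 1 := by rw [div_le_one hU0]; linarith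
  rw [hη, ← hU] at hW
  obtain ⟨B, hB⟩ : ∃ B, B = 3 + κ * log l := ⟨_, rfl⟩
  have hB0 : 0 ≤ B := by rw [hB]; positivity
  have hlog8 : log 8 ≤ 3 := by
    have : (8 : ℝ) = 2 ^ (3 : ℕ) := by norm_num
    rw [this, log_pow]
    have := log_two_lt_d9
    push_cast; linarith
  have hLB : exp l ≤ R * exp B := by
    have e1 : 8 * l ^ κ ≤ exp B := by
      rw [hB, exp_add, mul_comm κ, ← rpow_def_of_pos hl0]
      refine mul_le_mul_of_nonneg_right ?_ (rpow_nonneg hl0.le κ)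
      rw [← log_le_iff_le_exp (by norm_num)]
      exact hlog8
    have e2 : exp l = exp l * l ^ (-κ) / 8 * (8 * l ^ κ) := by
      rw [rpow_neg hl0.le]
      have := (rpow_pos_of_pos hl0 κ).ne'
      field_simp
    rw [e2]
    exact mul_le_mul hR1 e1 (by positivity) hR0.le
  obtain ⟨k, hk⟩ : ∃ k, k = ⌈U * B⌉₊ := ⟨_, rfl⟩
  have hk1 : U * B ≤ k := by rw [hk]; exact Nat.le_ceil _
  have hk2 : (k : ℝ) ≤ U * B + 1 := by
    rw [hk]; exact (Nat.ceil_lt_add_one (by positivity)).le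
  have hit := hf.le_meanVal_divSum_iterate (L := exp l) hR0 hU2 (by positivity) hη1
    (exp_pos (l / 2)).le hW hR k (exp l) (by linarith [exp_pos l]) le_rfl ?_
  · refine lt_of_lt_of_le ?_ hit
    have e : (1 / U) ^ k = exp (-(3 / 4) * log l * k) := by
      rw [← hη, ← rpow_natCast, ← rpow_mul hl0.le, rpow_def_of_pos hl0]
      ring_nf
    rw [e, ← exp_add, one_lt_exp_iff]
    have hU1 : l = U * l ^ (1 / 4 : ℝ) := by
      rw [hU, ← rpow_add hl0]; norm_num
    have hkb : (k : ℝ) ≤ U * ((4 + κ) * log l) := by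
      refine hk2.trans ?_
      have : B + 1 ≤ (4 + κ) * log l := by rw [hB]; linarith
      have := mul_le_mul_of_nonneg_left this hU0.le
      linarith
    have a1 : log l * k ≤ l / 4 := by
      calc log l * k ≤ log l * (U * ((4 + κ) * log l)) :=
            mul_le_mul_of_nonneg_left hkb (by linarith)
        _ = U * (4 * (4 + κ) * (log l) ^ 2) / 4 := by ring
        _ ≤ U * l ^ (1 / 4 : ℝ) / 4 := by
            have := mul_le_mul_of_nonneg_left h6 hU0.le
            linarith
        _ = l / 4 := by rw [← hU1]
    linarith
  · have h2 : (1 - 1 / U) ^ k ≤ exp (-B) := by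
      calc (1 - 1 / U) ^ k ≤ exp (-(1 / U)) ^ k :=
            pow_le_pow_left₀ (by linarith) (one_sub_le_exp_neg _) k
        _ = exp (k * -(1 / U)) := (exp_nat_mul _ _).symm
        _ ≤ _ := by
            rw [exp_le_exp]
            have : B ≤ k * (1 / U) := by
              rw [mul_one_div, le_div_iff₀ hU0]; linarith
            linarith
    calc _ ≤ R * exp B * exp (-B) :=
          mul_le_mul hLB h2 (pow_nonneg (by linarith) k) (by positivity)
      _ = R := by rw [mul_assoc, ← exp_add, add_neg_cancel, exp_zero, mul_one]

lemma exists_logSum_ge : ∃ l₀ : ℝ, ∀ l, l₀ ≤ l → ∀ f : ℕ → ℝ, BddMul f →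
    -l ^ (-(3 / 5) : ℝ) ≤ logSum f (exp l) := by
  obtain ⟨γ, C, hγ, -, hC, hbad⟩ := exists_abs_meanVal_le_of_midWeight
  obtain ⟨κ, C', hκ, hC', hblock⟩ := exists_large_divSum
  have hev := ((((Filter.eventually_ge_atTop (4 : ℝ)).and
    (eventually_mul_log_le (C := 25) (s := 1 / 20) (by norm_num))).and
    (eventually_mul_log_le (C := 6 * C) (s := 1 / 10) (by norm_num))).and
    ((eventually_mul_rpow_le_exp (C := 1) (s := 3 / 4) (half_pos hγ)).and
    (eventually_mul_rpow_le_exp (C := C' + 8) (s := κ + 1) (b := 1 / 2) (by norm_num)))).and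
    ((eventually_mul_log_sq_le (C := 4 * (4 + κ)) (s := 1 / 4) (by norm_num)).and
    (tendsto_log_atTop.eventually_ge_atTop 1))
  obtain ⟨l₀, hl₀⟩ := Filter.eventually_atTop.1 hev
  refine ⟨l₀, fun l hl f hf => ?_⟩
  obtain ⟨⟨⟨⟨hl4, h4⟩, h3⟩, h2, h5⟩, h6, h1⟩ := hl₀ l hl
  have hl0 : 0 < l := by linarith
  by_contra! hneg
  have e2 : 1 / 2 * l = l / 2 := by ring
  rw [e2] at h5
  have hp1 : l ≤ l ^ (κ + 1) := by
    calc l = l ^ (1 : ℝ) := (rpow_one l).symm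
      _ ≤ _ := rpow_le_rpow_of_exponent_le (by linarith) (by linarith)
  have hee : exp l = exp (l / 2) * exp (l / 2) := by rw [← exp_add]; ring_nf
  have he8 : 8 * l ^ (κ + 1) ≤ exp (l / 2) := by nlinarith
  have he32 : 32 ≤ exp (l / 2) := by linarith
  have h16 : 16 * l ≤ exp l := by nlinarith
  obtain ⟨q, hq1, hq2, hq⟩ := hf.exists_large_meanVal hl4 h1 h4 h16 hneg
  have hq' : 2 / l ≤ |meanVal f q| := by
    refine le_trans ?_ hq.le
    have e : l ^ (-(13 / 20) : ℝ) = l ^ (7 / 20 : ℝ) / l := by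
      rw [← rpow_sub_one hl0.ne']; norm_num
    rw [e]
    refine div_le_div_of_nonneg_right ?_ hl0.le
    have : l ^ (1 / 20 : ℝ) ≤ l ^ (7 / 20 : ℝ) :=
      rpow_le_rpow_of_exponent_le (by linarith) (by norm_num)
    linarith
  obtain ⟨R, hR1, hR2, hR⟩ := hblock f hf l q (by linarith)
    (by nlinarith) hq1 hq2 hq'
  have hRs : exp (l / 2) ≤ R := by
    refine le_trans ?_ hR1
    have a1 : l ^ (-κ) = l / l ^ (κ + 1) := by
      rw [rpow_neg hl0.le, rpow_add_one hl0.ne']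
      field_simp
    have hp0 : 0 < l ^ (κ + 1) := by linarith
    rw [a1, hee, ← mul_div_assoc, div_div, le_div_iff₀ (by positivity)]
    have := exp_pos (l / 2)
    nlinarith
  have hG := hf.one_lt_meanVal_divSum hκ hl4 h1 h6 hR1 hR2 hR fun r hr1 hr2 => ?_
  · have := hf.meanVal_divSum_le (exp l)
    linarith [rpow_pos_of_pos hl0 (-(3 / 5) : ℝ)]
  by_contra! hlt
  have hU2 : 2 ≤ l ^ (3 / 4 : ℝ) := by
    have : l ^ (1 / 20 : ℝ) ≤ l ^ (3 / 4 : ℝ) :=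
      rpow_le_rpow_of_exponent_le (by linarith) (by norm_num)
    linarith
  have hη0 := rpow_pos_of_pos hl0 (-(3 / 4) : ℝ)
  have hb := hbad f hf r (l ^ (3 / 4 : ℝ)) (l ^ (-(3 / 4) : ℝ)) (by linarith) hU2 hη0.le hlt.le q
    (by linarith)
  refine absurd hb (not_le.2 (lt_of_le_of_lt ?_ hq))
  have hr0 : 0 < r := by linarith
  have b1 : r ^ (-γ) ≤ l ^ (-(3 / 4) : ℝ) := by
    rw [rpow_neg hr0.le, rpow_neg hl0.le]
    refine inv_anti₀ (rpow_pos_of_pos hl0 _) ?_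
    calc l ^ (3 / 4 : ℝ) ≤ exp (γ / 2 * l) := by linarith
      _ = exp (l / 2) ^ γ := by rw [← exp_mul]; ring_nf
      _ ≤ _ := rpow_le_rpow (exp_pos _).le (by linarith) hγ.le
  have b2 : 1 / l ^ (3 / 4 : ℝ) = l ^ (-(3 / 4) : ℝ) := by rw [rpow_neg hl0.le, one_div]
  have b3 : 1 + log (l ^ (3 / 4 : ℝ)) ≤ 2 * log l := by rw [log_rpow hl0]; linarith
  have b4 : l ^ (-(13 / 20) : ℝ) = l ^ (-(3 / 4) : ℝ) * l ^ (1 / 10 : ℝ) := by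
    rw [← rpow_add hl0]; norm_num
  rw [b2, b4]
  calc _ ≤ C * (3 * l ^ (-(3 / 4) : ℝ)) * (2 * log l) := by
        refine mul_le_mul (mul_le_mul_of_nonneg_left (by linarith) (by linarith)) b3 ?_
          (by positivity)
        have := log_nonneg (by linarith : 1 ≤ l ^ (3 / 4 : ℝ))
        linarith
    _ = l ^ (-(3 / 4) : ℝ) * (6 * C * log l) := by ring
    _ ≤ _ := mul_le_mul_of_nonneg_left h3 hη0.le

end

end NegTrunc

/-- there is `x₀` such that for all `x ≥ x₀` and every completely
multiplicative `f` with `-1 ≤ f n ≤ 1`, `∑_{n ≤ x} f n / n ≥ -1/(log log x)^(3/5)`. -/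
theorem negative_truncations_lower_bound :
    ∃ x₀ : ℝ, ∀ x : ℝ, x₀ ≤ x →
      ∀ f : ℕ → ℝ, IsComplMult f → (∀ n : ℕ, 0 < n → -1 ≤ f n ∧ f n ≤ 1) →
        -1 / (Real.log (Real.log x)) ^ ((3 : ℝ) / 5) ≤
          ∑ n ∈ Finset.Icc 1 ⌊x⌋₊, f n / n := by

  obtain ⟨l₀, hl₀⟩ := NegTrunc.exists_logSum_ge
  refine ⟨Real.exp (Real.exp (max l₀ 1)), fun x hx f hf hb => ?_⟩
  have hx0 : 0 < x := (Real.exp_pos _).trans_le hx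
  have h1 : Real.exp (max l₀ 1) ≤ Real.log x := (Real.le_log_iff_exp_le hx0).2 hx
  have h2 : 0 < Real.log x := (Real.exp_pos _).trans_le h1
  have h3 : max l₀ 1 ≤ Real.log (Real.log x) := (Real.le_log_iff_exp_le h2).2 h1
  have h4 : 0 < Real.log (Real.log x) := by linarith [le_max_right l₀ 1]
  have h := hl₀ _ ((le_max_left l₀ 1).trans h3) f
    ⟨hf.1, hf.2, fun n hn => abs_le.2 (hb n hn)⟩
  rw [NegTrunc.logSum, Real.exp_log h2, Real.exp_log hx0, Real.rpow_neg h4.le] at h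
  have h5 : Finset.Icc 1 ⌊x⌋₊ = NegTrunc.upTo x := Finset.Icc_add_one_left_eq_Ioc 0 _
  rw [neg_div, one_div, h5]
  exact h
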